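/- Let 1 ≤ p, q ≤ ∞. (i) For every v ∈ L^p(ℝ) such that w := 𝓕^{−1}( v̂ · e^{−·} ) ∈ L^q(ℝ) (where (v̂ · e^{−·})(k) = v̂(k) e^{−k}), there exists a unique h ∈ H^{p,q}(S) whose trace along ℝ is h_0 = v, and its trace along ℝ + i is h_1 = w, i.e. ĥ_1(k) = v̂(k) e^{−k}. (ii) Conversely, every h ∈ H^{p,q}(S) has traces h_0 ∈ L^p(ℝ) and h_1 ∈ L^q(ℝ) with ĥ_1(k) = e^{−k} ĥ_0(k) in the tempered distribution sense. (iii) There exist constants c, C > 0 depending only on p and q such that c · ‖h‖_{H^{p,q}} ≤ ‖h_0‖_{L^p(ℝ)} + ‖h_1‖_{L^q(ℝ)} ≤ C · ‖h‖_{H^{p,q}} for all h ∈ H^{p,q}(S). -/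

import Mathlib

open MeasureTheory Complex Filter Set
open scoped Real ENNReal Topology

noncomputable section

def Strip : Set ℂ := {z : ℂ | 0 < z.im ∧ z.im < 1}

def bLine (h : ℂ → ℂ) (y : ℝ) : ℝ → ℂ := fun x => h (x + y * Complex.I)

def hardyNorm (p q : ℝ≥0∞) (h : ℂ → ℂ) : ℝ≥0∞ :=
  ⨆ y ∈ Set.Ioo (0:ℝ) 1,
    ⨅ (f : ℝ → ℂ) (g : ℝ → ℂ) (_ : Measurable f) (_ : Measurable g)
      (_ : f + g = bLine h y),
      ENNReal.ofReal (1 - y)⁻¹ * eLpNorm f p volume +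
        ENNReal.ofReal y⁻¹ * eLpNorm g q volume

def MemHardy (p q : ℝ≥0∞) (h : ℂ → ℂ) : Prop :=
  DifferentiableOn ℂ h Strip ∧ hardyNorm p q h < ⊤

def IsTrace0 (h : ℂ → ℂ) (v : ℝ → ℂ) : Prop :=
  ∀ φ : SchwartzMap ℝ ℂ,
    Tendsto (fun y : ℝ => ∫ x : ℝ, h (x + y * Complex.I) * (starRingEnd ℂ) (φ x))
      (𝓝[>] (0:ℝ)) (𝓝 (∫ x : ℝ, v x * (starRingEnd ℂ) (φ x)))

def IsTrace1 (h : ℂ → ℂ) (w : ℝ → ℂ) : Prop :=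
  ∀ φ : SchwartzMap ℝ ℂ,
    Tendsto (fun y : ℝ => ∫ x : ℝ, h (x + y * Complex.I) * (starRingEnd ℂ) (φ x))
      (𝓝[<] (1:ℝ)) (𝓝 (∫ x : ℝ, w x * (starRingEnd ℂ) (φ x)))

/-- Fourier transform with the convention `f̂(k) = ∫ f(x) e^{-ikx} dx`. -/
def fInt (φ : ℝ → ℂ) (x : ℝ) : ℂ := ∫ k : ℝ, φ k * Complex.exp (-(Complex.I * k * x))

/-- `ĥ₁ = e^{-·} ĥ₀` in the sense of tempered distributions, tested against
Fourier transforms of compactly supported smooth functions. -/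
def FourierRelExp (h0 h1 : ℝ → ℂ) : Prop :=
  ∀ φ : ℝ → ℂ, ContDiff ℝ (⊤ : ℕ∞) φ → HasCompactSupport φ →
    (∫ x : ℝ, h1 x * fInt φ x) = ∫ x : ℝ, h0 x * fInt (fun k => Real.exp (-k) * φ k) x

/-- the weight -/
def wt (x : ℝ) : ℝ := (1 + x ^ 2)⁻¹

lemma wt_pos (x : ℝ) : 0 < wt x := by unfold wt; positivity
lemma wt_le_one (x : ℝ) : wt x ≤ 1 := by
  unfold wt
  exact inv_le_one_of_one_le₀ (by nlinarith [sq_nonneg x])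
lemma continuous_wt : Continuous wt := by
  unfold wt
  exact Continuous.inv₀ (by fun_prop) (fun x => by positivity)
lemma integrable_wt : Integrable wt := integrable_inv_one_add_sq
lemma wt_sq_le (x : ℝ) : wt x ^ 2 ≤ wt x := by
  have := wt_pos x
  have := wt_le_one x
  nlinarith
lemma memLp_wt (p : ℝ≥0∞) (hp : 1 ≤ p) : MemLp wt p volume := by
  by_cases h : p = ⊤
  · subst h
    refine memLp_top_of_bound continuous_wt.aestronglyMeasurable 1 (Eventually.of_forall fun x => ?_)
    rw [Real.norm_of_nonneg (wt_pos x).le]; exact wt_le_one x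
  · refine (memLp_norm_rpow_iff (q := p) (p := p) continuous_wt.aestronglyMeasurable
      (by positivity) h).1 ?_ 
    rw [ENNReal.div_self (by positivity) h, memLp_one_iff_integrable]
    refine integrable_wt.mono ?_ (Eventually.of_forall fun x => ?_)
    · exact ((continuous_wt.norm).rpow_const (fun x => Or.inr (by positivity))).aestronglyMeasurable
    · rw [Real.norm_of_nonneg (wt_pos x).le, Real.norm_of_nonneg (by have := wt_pos x; positivity)]
      have : (1:ℝ) ≤ p.toReal := by
        rw [← ENNReal.toReal_one]; exact ENNReal.toReal_mono h hp
      simpa using Real.rpow_le_rpow_of_exponent_ge (wt_pos x) (wt_le_one x) this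

lemma wt_mul_le (s t : ℝ) : wt s * wt (t - s) ≤ 2 * wt t := by
  unfold wt
  rw [← mul_inv, ← div_eq_mul_inv, le_div_iff₀ (by positivity), inv_mul_le_iff₀ (by positivity)]
  nlinarith [sq_nonneg (s - (t - s)), sq_nonneg (s * (t-s))]

/-- holomorphy of parameter integrals -/
lemma differentiableAt_integral {α : Type*} [MeasurableSpace α] {μ : Measure α}
    {F : ℂ → α → ℂ} {z₀ : ℂ} {R : ℝ} (hR : 0 < R) {b : α → ℝ}
    (hm : ∀ z ∈ Metric.ball z₀ R, AEStronglyMeasurable (F z) μ)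
    (hd : ∀ᵐ t ∂μ, DifferentiableOn ℂ (fun z => F z t) (Metric.ball z₀ R))
    (hb : ∀ᵐ t ∂μ, ∀ z ∈ Metric.ball z₀ R, ‖F z t‖ ≤ b t)
    (hbi : Integrable b μ) : DifferentiableAt ℂ (fun z => ∫ t, F z t ∂μ) z₀ := by
  have hR2 : 0 < R / 2 := by positivity
  have key := hasDerivAt_integral_of_dominated_loc_of_deriv_le (𝕜 := ℂ) (F := F)
    (F' := fun z t => deriv (fun z => F z t) z) (bound := fun t => b t / (R/4)) (x₀ := z₀)
    (μ := μ) (s := Metric.ball z₀ (R/2)) (Metric.ball_mem_nhds _ hR2) ?_ ?_ ?_ ?_ ?_ ?_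
  · exact key.2.differentiableAt
  · filter_upwards [Metric.ball_mem_nhds z₀ hR] with z hz using hm z hz
  · exact hbi.mono' (hm _ (Metric.mem_ball_self hR)) (hb.mono fun t ht => ht _ (Metric.mem_ball_self hR))
  · -- measurability of the derivative
    let u : ℕ → ℂ := fun n => ((R/2) * (1/((n:ℝ)+1)) : ℝ)
    have hu0 : Tendsto u atTop (𝓝 0) := by
      have := (tendsto_one_div_add_atTop_nhds_zero_nat (𝕜 := ℝ)).const_mul (R/2)
      rw [mul_zero] at this
      have h2 := (Complex.continuous_ofReal.tendsto 0).comp this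
      simpa [u, Function.comp_def] using h2
    have hune : ∀ n, u n ≠ 0 := fun n => by
      simp only [u, ne_eq, Complex.ofReal_eq_zero]; positivity
    have humem : ∀ n, z₀ + u n ∈ Metric.ball z₀ R := fun n => by
      rw [mem_ball_iff_norm, add_sub_cancel_left]
      simp only [u, Complex.norm_real, norm_mul]
      rw [Real.norm_of_nonneg hR2.le, Real.norm_of_nonneg (by positivity)]
      have : 1 / ((n:ℝ)+1) ≤ 1 := by
        rw [div_le_one (by positivity)]; have : (0:ℝ) ≤ n := by positivity
        linarith
      nlinarith
    refine aestronglyMeasurable_of_tendsto_ae (u := atTop)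
      (f := fun (n:ℕ) t => (u n)⁻¹ • (F (z₀ + u n) t - F z₀ t)) ?_ ?_
    · intro n
      exact AEStronglyMeasurable.const_smul ((hm _ (humem n)).sub (hm _ (Metric.mem_ball_self hR))) (u n)⁻¹
    · filter_upwards [hd] with t ht
      have h1 : HasDerivAt (fun z => F z t) (deriv (fun z => F z t) z₀) z₀ :=
        ((ht.differentiableAt (Metric.ball_mem_nhds _ hR))).hasDerivAt
      have h2 := h1.tendsto_slope_zero
      exact h2.comp (tendsto_nhdsWithin_iff.2 ⟨hu0, Eventually.of_forall fun n => hune n⟩)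
  · filter_upwards [hd, hb] with t ht hbt z hz
    rw [Metric.mem_ball] at hz
    refine Complex.norm_deriv_le_of_forall_mem_sphere_norm_le (by positivity) ?_ ?_
    · refine DifferentiableOn.diffContOnCl (ht.mono ?_)
      rw [closure_ball _ (by positivity)]
      intro w hw
      rw [Metric.mem_closedBall] at hw
      rw [Metric.mem_ball]
      linarith [dist_triangle w z z₀]
    · intro w hw
      refine hbt w ?_
      rw [Metric.mem_sphere] at hw
      rw [Metric.mem_ball]
      linarith [dist_triangle w z z₀]
  · exact hbi.div_const _
  · filter_upwards [hd] with t ht z hz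
    refine ((ht.differentiableAt (Metric.isOpen_ball.mem_nhds ?_))).hasDerivAt
    exact Metric.ball_subset_ball (by linarith) hz

/-- Cauchy shift between horizontal lines. -/
lemma shift {Φ : ℂ → ℂ} {a b M : ℝ} (hab : a ≤ b)
    (hd : ∀ z : ℂ, a ≤ z.im → z.im ≤ b → DifferentiableAt ℂ Φ z)
    (hi : ∀ y ∈ Icc a b, Integrable (fun x : ℝ => Φ (x + y * I)))
    (hM : ∀ y ∈ Icc a b, ∫ x : ℝ, ‖Φ (x + y * I)‖ ≤ M) :
    ∫ x : ℝ, Φ (x + a * I) = ∫ x : ℝ, Φ (x + b * I) := by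
  have hcont : ContinuousOn (fun p : ℝ × ℝ => Φ (p.1 + p.2 * I)) (univ ×ˢ Icc a b) := by
    intro p hp
    have h1 : ContinuousAt Φ (p.1 + p.2 * I) := (hd _ (by simpa using hp.2.1) (by simpa using hp.2.2)).continuousAt
    have h2 : ContinuousAt (fun p : ℝ × ℝ => ((p.1:ℂ) + p.2 * I)) p := by fun_prop
    exact (ContinuousAt.comp (f := fun p : ℝ × ℝ => ((p.1:ℂ) + p.2 * I)) h1 h2).continuousWithinAt
  -- integrability on the product
  have hprod : Integrable (fun p : ℝ × ℝ => Φ (p.1 + p.2 * I))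
      ((volume : Measure ℝ).prod ((volume : Measure ℝ).restrict (Icc a b))) := by
    have hmeas : AEStronglyMeasurable (fun p : ℝ × ℝ => Φ (p.1 + p.2 * I))
      ((volume : Measure ℝ).prod ((volume : Measure ℝ).restrict (Icc a b))) := by
      have := hcont.aestronglyMeasurable (μ := (volume : Measure ℝ).prod (volume : Measure ℝ))
        (MeasurableSet.univ.prod measurableSet_Icc)
      rwa [← Measure.prod_restrict, Measure.restrict_univ] at this
    rw [integrable_prod_iff' hmeas]
    constructor
    · exact (ae_restrict_iff' measurableSet_Icc).2 (Eventually.of_forall hi)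
    · refine Integrable.of_bound (C := M) ?_ ?_
      · exact (hmeas.norm.prod_swap.integral_prod_right')
      · refine (ae_restrict_iff' measurableSet_Icc).2 (Eventually.of_forall fun y hy => ?_)
        rw [Real.norm_of_nonneg (by positivity)]
        exact hM y hy
  have hV := hprod.norm.integral_prod_left
  set V : ℝ → ℝ := fun x => ∫ y in Icc a b, ‖Φ (x + y * I)‖ with hVdef
  have hV' : Integrable V := hV
  have hV0 : ∀ x, 0 ≤ V x := fun x => by positivity
  have hW : Integrable (fun x => V x + V (-x)) := hV'.add hV'.comp_neg
  have hfreq : ∀ δ > 0, ∃ᶠ R in (atTop : Filter ℝ), V R + V (-R) ≤ δ := by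
    intro δ hδ hcon
    simp only [not_le] at hcon
    obtain ⟨N, hN⟩ := eventually_atTop.1 hcon
    have h1 : volume {x | δ ≤ ‖V x + V (-x)‖} < ⊤ := hW.measure_norm_ge_lt_top hδ
    have h2 : Ici N ⊆ {x | δ ≤ ‖V x + V (-x)‖} := fun x hx => by
      have := hN x hx
      simp only [Set.mem_ofPred_eq]
      rw [Real.norm_of_nonneg (by linarith [hV0 x, hV0 (-x)])]; exact this.le
    have h3 := measure_mono (μ := volume) h2
    rw [Real.volume_Ici, top_le_iff] at h3
    rw [h3] at h1
    exact lt_irrefl _ h1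
  have ha : a ∈ Icc a b := ⟨le_rfl, hab⟩
  have hb : b ∈ Icc a b := ⟨hab, le_rfl⟩
  have ht : ∀ y ∈ Icc a b, Tendsto (fun R : ℝ => ∫ x in (-R)..R, Φ (x + y * I)) atTop
      (𝓝 (∫ x : ℝ, Φ (x + y * I))) := fun y hy =>
    intervalIntegral_tendsto_integral (hi y hy) tendsto_neg_atTop_atBot tendsto_id
  have hlim := ((ht a ha).sub (ht b hb)).norm
  have hvert : ∀ R : ℝ, ‖∫ y in a..b, Φ (R + y * I)‖ ≤ V R := fun R => by
    refine (intervalIntegral.norm_integral_le_integral_norm hab).trans ?_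
    rw [intervalIntegral.integral_of_le hab, ← integral_Icc_eq_integral_Ioc]
  have hbound : ∀ R : ℝ, ‖(∫ x in (-R)..R, Φ (x + a * I)) - ∫ x in (-R)..R, Φ (x + b * I)‖
      ≤ V R + V (-R) := by
    intro R
    have := Complex.integral_boundary_rect_eq_zero_of_differentiableOn Φ (-R + a * I) (R + b * I) ?_
    · simp at this
      have h2 : (∫ x in (-R)..R, Φ (x + a * I)) - ∫ x in (-R)..R, Φ (x + b * I)
        = I * (∫ y in a..b, Φ (((-R : ℝ) : ℂ) + y * I)) - I * ∫ y in a..b, Φ (R + y * I) := by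
        push_cast
        linear_combination this
      rw [h2]
      refine (norm_sub_le _ _).trans ?_
      rw [norm_mul, norm_mul, Complex.norm_I, one_mul, one_mul, add_comm]
      exact add_le_add (hvert R) (hvert (-R))
    · intro z hz
      have := hz.2
      simp [uIcc_of_le hab] at this
      exact (hd z this.1 this.2).differentiableWithinAt
  by_contra hne
  have hpos : 0 < ‖(∫ x : ℝ, Φ (x + a * I)) - ∫ x : ℝ, Φ (x + b * I)‖ := by
    rw [norm_pos_iff, sub_ne_zero]; exact hne
  have := le_of_tendsto_of_frequently hlim ((hfreq _ (half_pos hpos)).mono fun R hR => (hbound R).trans hR)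
  linarith

structure ClsA (h : ℂ → ℂ) (M : ℝ) : Prop where
  hd : DifferentiableOn ℂ h Strip
  hi : ∀ y ∈ Ioo (0:ℝ) 1, Integrable (fun x : ℝ => ‖h (x + y * I)‖ * wt x)
  hM : ∀ y ∈ Ioo (0:ℝ) 1, ∫ x : ℝ, ‖h (x + y * I)‖ * wt x ≤ M

structure ClsG (G : ℂ → ℂ) (C : ℝ) : Prop where
  hd : ∀ z : ℂ, 0 ≤ z.im → z.im ≤ 1 → DifferentiableAt ℂ G z
  hb : ∀ z : ℂ, 0 ≤ z.im → z.im ≤ 1 → ‖G z‖ ≤ C * wt z.re ^ 2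

lemma isOpen_Strip : IsOpen Strip := by
  have : Strip = Complex.im ⁻¹' (Ioo 0 1) := by ext z; simp [Strip]
  rw [this]; exact isOpen_Ioo.preimage Complex.continuous_im

lemma mem_Strip_line {x y : ℝ} (hy : y ∈ Ioo (0:ℝ) 1) : (x + y * I : ℂ) ∈ Strip := by
  simp [Strip]; exact hy

lemma continuous_line {h : ℂ → ℂ} (hd : DifferentiableOn ℂ h Strip) {y : ℝ} (hy : y ∈ Ioo (0:ℝ) 1) :
    Continuous (fun x : ℝ => h (x + y * I)) :=
  hd.continuousOn.comp_continuous (by fun_prop) (fun x => mem_Strip_line hy)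

lemma ClsG.nonneg {G : ℂ → ℂ} {C : ℝ} (hG : ClsG G C) : 0 ≤ C := by
  have h := hG.hb 0 (by simp) (by simp)
  have := norm_nonneg (G 0)
  simp [wt] at h
  linarith

lemma ClsG.continuous_line {G : ℂ → ℂ} {C : ℝ} (hG : ClsG G C) {y : ℝ} (hy : y ∈ Icc (0:ℝ) 1) :
    Continuous (fun x : ℝ => G (x + y * I)) := by
  rw [continuous_iff_continuousAt]
  intro x
  have h1 : ContinuousAt G (x + y * I) := (hG.hd _ (by simpa using hy.1) (by simpa using hy.2)).continuousAt
  exact ContinuousAt.comp (f := fun x : ℝ => ((x:ℂ) + y * I)) h1 (by fun_prop)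

lemma ClsG.bound_line {G : ℂ → ℂ} {C : ℝ} (hG : ClsG G C) {x y : ℝ} (hy : y ∈ Icc (0:ℝ) 1) :
    ‖G (x + y * I)‖ ≤ C * wt x ^ 2 := by
  simpa using hG.hb (x + y * I) (by simpa using hy.1) (by simpa using hy.2)

/-- integrability of weighted products -/
lemma integrable_mul_of_wt {μ : Measure ℝ} {f φ : ℝ → ℂ} {C : ℝ} (hf : Integrable (fun x => ‖f x‖ * wt x) μ)
    (hfm : AEStronglyMeasurable f μ) (hφ : AEStronglyMeasurable φ μ) (hb : ∀ x, ‖φ x‖ ≤ C * wt x) :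
    Integrable (fun x => f x * φ x) μ := by
  refine (hf.const_mul C).mono' (hfm.mul hφ) (Eventually.of_forall fun x => ?_)
  rw [norm_mul]
  nlinarith [hb x, norm_nonneg (f x)]

lemma norm_integral_mul_le_wt {μ : Measure ℝ} {f φ : ℝ → ℂ} {C : ℝ} (hf : Integrable (fun x => ‖f x‖ * wt x) μ)
    (hb : ∀ x, ‖φ x‖ ≤ C * wt x) :
    ‖∫ x, f x * φ x ∂μ‖ ≤ C * ∫ x, ‖f x‖ * wt x ∂μ := by
  rw [← integral_const_mul]
  refine norm_integral_le_of_norm_le (hf.const_mul C) (Eventually.of_forall fun x => ?_)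
  rw [norm_mul]
  nlinarith [hb x, norm_nonneg (f x)]

lemma le_wt_of_sq {C a x : ℝ} (hC : 0 ≤ C) (h : a ≤ C * wt x ^ 2) : a ≤ C * wt x :=
  h.trans (mul_le_mul_of_nonneg_left (wt_sq_le x) hC)

lemma ClsA.shift {h G : ℂ → ℂ} {M C : ℝ} (hA : ClsA h M) (hG : ClsG G C) {y y1 : ℝ} (hy : 0 < y)
    (hyy : y ≤ y1) (hy1 : y1 < 1) :
    ∫ x : ℝ, h (x + y * I) * G x = ∫ x : ℝ, h (x + y1 * I) * G (x + (y1 - y : ℝ) * I) := by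
  have key := _root_.shift (Φ := fun z => h (z + y * I) * G z) (a := 0) (b := y1 - y) (M := C * M)
    (by linarith) ?_ ?_ ?_
  · simp only [ofReal_zero, zero_mul, add_zero] at key
    rw [key]
    congr 1; ext x; congr 2
    push_cast; ring
  · intro z hz1 hz2
    have h1 : DifferentiableAt ℂ h (z + y * I) := by
      refine (hA.hd _ ?_).differentiableAt (isOpen_Strip.mem_nhds ?_) <;>
      · simp [Strip]; constructor <;> linarith
    exact (DifferentiableAt.comp (f := fun z => z + y * I) z h1 (by fun_prop)).mul
      (hG.hd z hz1 (by linarith))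
  all_goals
    intro s hs
    have hs' : s + y ∈ Ioo (0:ℝ) 1 := ⟨by linarith [hs.1], by linarith [hs.2]⟩
    have hs2 : s ∈ Icc (0:ℝ) 1 := ⟨hs.1, by linarith [hs.2]⟩
    have e : ∀ x : ℝ, ((x:ℂ) + s * I + y * I) = x + (s + y : ℝ) * I := fun x => by push_cast; ring
    simp only [e]
    have hb : ∀ x : ℝ, ‖G (x + s * I)‖ ≤ C * wt x := fun x =>
      le_wt_of_sq hG.nonneg (hG.bound_line hs2)
  · exact integrable_mul_of_wt (hA.hi _ hs') (continuous_line hA.hd hs').aestronglyMeasurable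
      (hG.continuous_line hs2).aestronglyMeasurable hb
  · calc _ ≤ ∫ x : ℝ, C * (‖h (x + (s+y : ℝ) * I)‖ * wt x) := by
          refine integral_mono_of_nonneg (Eventually.of_forall fun x => norm_nonneg _)
            ((hA.hi _ hs').const_mul C) (Eventually.of_forall fun x => ?_)
          simp only [norm_mul]
          nlinarith [hb x, norm_nonneg (h (x + (s+y : ℝ) * I))]
      _ ≤ C * M := by
          rw [integral_const_mul]
          exact mul_le_mul_of_nonneg_left (hA.hM _ hs') hG.nonneg

lemma ClsA.tendsto_G {h G : ℂ → ℂ} {M C : ℝ} (hA : ClsA h M) (hG : ClsG G C) {y1 : ℝ}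
    (hy1 : y1 ∈ Ioo (0:ℝ) 1) :
    Tendsto (fun y : ℝ => ∫ x : ℝ, h (x + y * I) * G x) (𝓝[>] 0)
      (𝓝 (∫ x : ℝ, h (x + y1 * I) * G (x + y1 * I))) := by
  have hev : ∀ᶠ y : ℝ in 𝓝[>] 0, y ∈ Ioo 0 y1 := Ioo_mem_nhdsGT hy1.1
  have : Tendsto (fun y : ℝ => ∫ x : ℝ, h (x + y1 * I) * G (x + (y1 - y : ℝ) * I)) (𝓝[>] 0)
      (𝓝 (∫ x : ℝ, h (x + y1 * I) * G (x + y1 * I))) := by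
    refine tendsto_integral_filter_of_dominated_convergence
      (fun x => C * (‖h (x + y1 * I)‖ * wt x)) ?_ ?_ ((hA.hi _ hy1).const_mul C) ?_
    · filter_upwards [hev] with y hy
      exact ((continuous_line hA.hd hy1).mul (hG.continuous_line
        ⟨by linarith [hy.2], by linarith [hy.1, hy1.2]⟩)).aestronglyMeasurable
    · filter_upwards [hev] with y hy
      refine Eventually.of_forall fun x => ?_
      have := le_wt_of_sq hG.nonneg (hG.bound_line (x := x) (y := y1 - y)
        ⟨by linarith [hy.2], by linarith [hy.1, hy1.2]⟩)
      rw [norm_mul]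
      nlinarith [norm_nonneg (h (x + y1 * I))]
    · refine Eventually.of_forall fun x => ?_
      refine Tendsto.const_mul _ ?_
      have h1 : ContinuousAt G (x + y1 * I) :=
        (hG.hd _ (by simpa using hy1.1.le) (by simpa using hy1.2.le)).continuousAt
      have h2 : Tendsto (fun y : ℝ => ((x:ℂ) + (y1 - y : ℝ) * I)) (𝓝[>] 0) (𝓝 (x + y1 * I)) := by
        have : Continuous (fun y : ℝ => ((x:ℂ) + (y1 - y : ℝ) * I)) := by fun_prop
        have := this.tendsto 0
        simp only [sub_zero] at this
        exact this.mono_left nhdsWithin_le_nhds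
      exact h1.tendsto.comp h2
  refine this.congr' ?_
  filter_upwards [hev] with y hy
  exact (hA.shift hG hy.1 hy.2.le hy1.2).symm

/-- Gaussian test functions -/
def gau (ξ : ℝ) (z : ℂ) : ℂ := Complex.exp (-z ^ 2) * Complex.exp (-(2 * π * ξ * z * I))

lemma exp_neg_sq_le (x : ℝ) : Real.exp (-x^2) ≤ 4 * wt x ^ 2 := by
  have h1 := Real.add_one_le_exp (x^2/2)
  have h2 : Real.exp (x^2) = Real.exp (x^2/2)^2 := by
    rw [← Real.exp_nat_mul]; congr 1; push_cast; ring
  rw [Real.exp_neg, wt, inv_pow, ← div_eq_mul_inv, le_div_iff₀ (by positivity),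
    inv_mul_le_iff₀ (by positivity), h2]
  nlinarith [sq_nonneg x]

lemma clsG_gau (ξ : ℝ) : ClsG (gau ξ) (Real.exp (1 + 2 * π * |ξ|) * 4) where
  hd := fun z _ _ => by unfold gau; fun_prop
  hb := fun z h0 h1 => by
    unfold gau
    rw [norm_mul, Complex.norm_exp, Complex.norm_exp, ← Real.exp_add]
    have e : (-z ^ 2).re + (-(2 * π * ξ * z * I)).re = -z.re^2 + (z.im^2 + 2 * π * ξ * z.im) := by
      simp [pow_two]
      ring
    rw [e, Real.exp_add, mul_comm, mul_assoc (Real.exp (1 + 2 * π * |ξ|))]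
    refine mul_le_mul (Real.exp_le_exp.2 ?_) (exp_neg_sq_le _) (Real.exp_pos _).le (Real.exp_pos _).le
    have : ξ * z.im ≤ |ξ| := by
      calc ξ * z.im ≤ |ξ| * z.im := mul_le_mul_of_nonneg_right (le_abs_self _) h0
        _ ≤ |ξ| := by nlinarith [abs_nonneg ξ]
    nlinarith [Real.pi_pos]

open scoped FourierTransform in
lemma ae_zero_of_gau {μ : Measure ℝ} [SFinite μ] {k : ℝ → ℂ} (hm : AEStronglyMeasurable k μ)
    (hk : Integrable (fun x => ‖k x‖ * wt x) μ)
    (h0 : ∀ ξ : ℝ, ∫ x : ℝ, k x * gau ξ x ∂μ = 0) : ∀ᵐ x ∂μ, k x = 0 := by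
  have hintg : Integrable (fun x : ℝ => k x * Complex.exp (-(x:ℂ)^2)) μ := by
    refine integrable_mul_of_wt (C := 4) hk hm (by fun_prop) (fun x => ?_)
    rw [Complex.norm_exp]
    have : (-(x:ℂ)^2).re = -x^2 := by simp [pow_two]
    rw [this]
    exact le_wt_of_sq (by norm_num) (exp_neg_sq_le x)
  have : ∀ᵐ x : ℝ ∂μ, k x * Complex.exp (-(x:ℂ)^2) = 0 := by
    refine ae_eq_zero_of_integral_contDiff_smul_eq_zero hintg.locallyIntegrable ?_
    intro g hg hgs
    let ψ : SchwartzMap ℝ ℂ := HasCompactSupport.toSchwartzMap (f := fun x => (g x : ℂ))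
      (hgs.comp_left (g := fun x : ℝ => (x:ℂ)) (by simp)) (Complex.ofRealCLM.contDiff.comp hg)
    let φ : SchwartzMap ℝ ℂ := 𝓕⁻ ψ
    have e1 : ∀ x : ℝ, (g x : ℂ) = ∫ ξ : ℝ, Complex.exp (↑(-2 * π * ξ * x) * I) • φ ξ := by
      intro x
      have h1 : 𝓕 φ = ψ := by simp [φ]
      have h2 : 𝓕 φ x = (g x : ℂ) := by rw [h1]; rfl
      rw [← h2, SchwartzMap.fourier_coe, Real.fourier_real_eq_integral_exp_smul]
    have e2 : ∀ x : ℝ, g x • (k x * Complex.exp (-(x:ℂ)^2)) =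
      ∫ ξ : ℝ, φ ξ * (k x * gau ξ x) := by
      intro x
      rw [Complex.real_smul, e1 x, mul_comm, ← integral_const_mul]
      congr 1; ext ξ
      simp only [gau, smul_eq_mul]
      have : (↑(-2 * π * ξ * x) * I : ℂ) = -(2 * π * ξ * x * I) := by push_cast; ring
      rw [this]; ring
    simp only [e2]
    rw [integral_integral_swap]
    · simp only [integral_const_mul, h0, mul_zero, integral_zero]
    · have h1 := hintg.mul_prod (φ.integrable (μ := volume))
      refine h1.mono ?_ (Eventually.of_forall fun p => ?_)
      · refine AEStronglyMeasurable.mul ?_ (AEStronglyMeasurable.mul ?_ ?_)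
        · exact (φ.continuous.comp continuous_snd).aestronglyMeasurable
        · exact hm.comp_fst
        · exact Continuous.aestronglyMeasurable (by unfold gau; fun_prop)
      · simp only [Function.uncurry, gau, norm_mul, Complex.norm_exp]
        rw [show (-(2 * π * (p.2:ℂ) * p.1 * I)).re = 0 by simp]
        simp [mul_comm]
  filter_upwards [this] with x hx
  simpa [Complex.exp_ne_zero] using hx

lemma riesz_factor {V E : Type*} [AddCommGroup V] [Module ℂ V] [NormedAddCommGroup E]
    [InnerProductSpace ℂ E] [CompleteSpace E] (T : V →ₗ[ℂ] E) (l : V →ₗ[ℂ] ℂ) (K : ℝ)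
    (hl : ∀ v, ‖l v‖ ≤ K * ‖T v‖) : ∃ e : E, ∀ v, l v = inner ℂ e (T v) := by
  have hker : LinearMap.ker T ≤ LinearMap.ker l := fun v hv => by
    rw [LinearMap.mem_ker] at hv ⊢
    have := hl v
    rw [hv, norm_zero, mul_zero] at this
    exact norm_le_zero_iff.1 this
  let f0 : LinearMap.range T →ₗ[ℂ] ℂ :=
    ((LinearMap.ker T).liftQ l hker) ∘ₗ (T.quotKerEquivRange.symm : _ →ₗ[ℂ] _)
  have hf0 : ∀ v, f0 ⟨T v, v, rfl⟩ = l v := fun v => by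
    have : T.quotKerEquivRange.symm ⟨T v, v, rfl⟩ = (LinearMap.ker T).mkQ v := by
      rw [LinearEquiv.symm_apply_eq]; rfl
    simp [f0, this]
  let f : StrongDual ℂ (LinearMap.range T) := f0.mkContinuous K (by
    rintro ⟨_, v, rfl⟩
    rw [hf0]; exact hl v)
  obtain ⟨g, hg, -⟩ := exists_extension_norm_eq (LinearMap.range T) f
  refine ⟨(InnerProductSpace.toDual ℂ E).symm g, fun v => ?_⟩
  rw [InnerProductSpace.toDual_symm_apply, ← hf0 v]
  exact (hg ⟨T v, v, rfl⟩).symm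

lemma weak_limit {ι : Type*} (U : Ultrafilter ι) (u : ι → ℝ → ℂ) (M : ℝ)
    (hc : ∀ i, Continuous (u i)) (hi : ∀ i, Integrable (fun x => ‖u i x‖ * wt x))
    (hM : ∀ i, ∫ x, ‖u i x‖ * wt x ≤ M) :
    ∃ (μ : FiniteMeasure ℝ) (k : ℝ → ℂ), Integrable k (μ : Measure ℝ) ∧
      ∀ θ : BoundedContinuousFunction ℝ ℂ,
        Tendsto (fun i => ∫ x, u i x * (wt x ^ 2 * θ x)) U (𝓝 (∫ x, k x * θ x ∂(μ : Measure ℝ))) := by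
  let d : ι → ℝ → NNReal := fun i x => Real.toNNReal (‖u i x‖ * wt x ^ 2)
  have hdm : ∀ i, Measurable (d i) := fun i => by
    have := hc i
    have := continuous_wt
    exact Continuous.measurable (by fun_prop)
  have hdc : ∀ i x, (d i x : ℝ) = ‖u i x‖ * wt x ^ 2 := fun i x =>
    Real.coe_toNNReal _ (by positivity)
  let lam : ι → Measure ℝ := fun i => volume.withDensity (fun x => (d i x : ℝ≥0∞))
  have hlam : ∀ i (s : Set ℝ) (c : ℝ), MeasurableSet s → 0 ≤ c → (∀ x ∈ s, wt x ≤ c) →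
      lam i s ≤ ENNReal.ofReal (c * M) := by
    intro i s c hs hc0 hsc
    rw [withDensity_apply _ hs]
    calc ∫⁻ x in s, (d i x : ℝ≥0∞) ≤ ∫⁻ x in s, ENNReal.ofReal (c * (‖u i x‖ * wt x)) := by
          refine setLIntegral_mono' hs fun x hx => ?_
          refine ENNReal.ofReal_le_ofReal ?_
          have := mul_le_mul_of_nonneg_left (hsc x hx) (mul_nonneg (norm_nonneg (u i x)) (wt_pos x).le)
          nlinarith
      _ ≤ ∫⁻ x, ENNReal.ofReal (c * (‖u i x‖ * wt x)) := setLIntegral_le_lintegral _ _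
      _ = ENNReal.ofReal (∫ x, c * (‖u i x‖ * wt x)) := by
          rw [ofReal_integral_eq_lintegral_ofReal ((hi i).const_mul c)]
          exact Eventually.of_forall fun x => mul_nonneg hc0 (mul_nonneg (norm_nonneg _) (wt_pos x).le)
      _ ≤ _ := by
          refine ENNReal.ofReal_le_ofReal ?_
          rw [integral_const_mul]
          exact mul_le_mul_of_nonneg_left (hM i) hc0
  have hfin : ∀ i, IsFiniteMeasure (lam i) := fun i => ⟨by
    refine (hlam i univ 1 MeasurableSet.univ zero_le_one (fun x _ => wt_le_one x)).trans_lt ?_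
    exact ENNReal.ofReal_lt_top⟩
  let L : ι → FiniteMeasure ℝ := fun i => ⟨lam i, hfin i⟩
  have hcomp := isCompact_setOfPred_finiteMeasure_mass_le_compl_isCompact_le (E := ℝ)
    (u := fun n : ℕ => Real.toNNReal (wt n * M)) (K := fun n : ℕ => Icc (-(n:ℝ)) n)
    (Real.toNNReal (1 * M)) ?_ (fun n => isCompact_Icc) (Or.inl inferInstance)
  swap
  · have h1 : Tendsto (fun n : ℕ => wt n * M) atTop (𝓝 0) := by
      have : Tendsto (fun n : ℕ => wt n) atTop (𝓝 0) := by
        unfold wt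
        refine tendsto_inv_atTop_zero.comp ?_
        refine tendsto_atTop_mono (fun n : ℕ => ?_) tendsto_natCast_atTop_atTop
        nlinarith [sq_nonneg ((n:ℝ) - 1)]
      simpa using this.mul_const M
    have h2 := (continuous_real_toNNReal.tendsto 0).comp h1
    rw [Real.toNNReal_zero] at h2
    exact h2
  obtain ⟨μ, -, hμ⟩ := isCompact_iff_ultrafilter_le_nhds'.1 hcomp (U.map L) (by
    rw [Ultrafilter.mem_map]
    refine Filter.univ_mem' fun i => ?_
    constructor
    · have := hlam i univ 1 MeasurableSet.univ zero_le_one (fun x _ => wt_le_one x)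
      rw [← ENNReal.coe_le_coe, FiniteMeasure.ennreal_mass]
      exact this
    · intro n
      have := hlam i (Icc (-(n:ℝ)) n)ᶜ (wt n) measurableSet_Icc.compl (wt_pos _).le (fun x hx => by
        unfold wt
        refine inv_anti₀ (by positivity) ?_
        have : (n:ℝ) < |x| := by
          by_contra hcon
          exact hx (abs_le.1 (not_lt.1 hcon))
        nlinarith [sq_abs x, (Nat.cast_nonneg n : (0:ℝ) ≤ n)])
      rw [← ENNReal.coe_le_coe, FiniteMeasure.ennreal_coeFn_eq_coeFn_toMeasure]
      exact this)
  have hμt : Tendsto L U (𝓝 μ) := hμ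
  rw [FiniteMeasure.tendsto_iff_forall_integral_tendsto] at hμt
  -- the functional
  have hb : ∀ i (θ : BoundedContinuousFunction ℝ ℂ),
      ‖∫ x, u i x * (wt x ^ 2 * θ x)‖ ≤ ∫ x, ‖θ x‖ ∂(lam i) := by
    intro i θ
    rw [integral_withDensity_eq_integral_smul (hdm i)]
    refine (norm_integral_le_integral_norm _).trans (le_of_eq ?_)
    congr 1; ext x
    rw [NNReal.smul_def, hdc, smul_eq_mul, norm_mul, norm_mul, norm_pow, Complex.norm_real,
      Real.norm_of_nonneg (wt_pos x).le]
    ring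
  have hintg : ∀ i (θ : BoundedContinuousFunction ℝ ℂ),
      Integrable (fun x => u i x * (wt x ^ 2 * θ x)) := by
    intro i θ
    have hcw := continuous_wt
    refine integrable_mul_of_wt (C := ‖θ‖) (hi i) (hc i).aestronglyMeasurable
      (Continuous.aestronglyMeasurable (by fun_prop)) (fun x => ?_)
    rw [norm_mul, norm_pow, Complex.norm_real, Real.norm_of_nonneg (wt_pos x).le]
    have := θ.norm_coe_le_norm x
    have := wt_sq_le x
    have := wt_pos x
    have := norm_nonneg θ
    calc wt x ^ 2 * ‖θ x‖ ≤ wt x * ‖θ‖ := by gcongr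
      _ = _ := mul_comm _ _
  let nrm : BoundedContinuousFunction ℝ ℂ → BoundedContinuousFunction ℝ ℝ := fun θ =>
    BoundedContinuousFunction.ofNormedAddCommGroup (fun x => ‖θ x‖) (by fun_prop) ‖θ‖
      (fun x => by simpa using θ.norm_coe_le_norm x)
  have hex : ∀ θ : BoundedContinuousFunction ℝ ℂ, ∃ l : ℂ,
      Tendsto (fun i => ∫ x, u i x * (wt x ^ 2 * θ x)) U (𝓝 l) := by
    intro θ
    have hbd : ∀ i, ‖∫ x, u i x * (wt x ^ 2 * θ x)‖ ≤ ‖θ‖ * M := by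
      intro i
      refine (norm_integral_mul_le_wt (C := ‖θ‖) (hi i) (fun x => ?_)).trans
        (mul_le_mul_of_nonneg_left (hM i) (norm_nonneg _))
      rw [norm_mul, norm_pow, Complex.norm_real, Real.norm_of_nonneg (wt_pos x).le]
      have := θ.norm_coe_le_norm x
      have := wt_sq_le x
      have := wt_pos x
      have := norm_nonneg θ
      calc wt x ^ 2 * ‖θ x‖ ≤ wt x * ‖θ‖ := by gcongr
        _ = _ := mul_comm _ _
    obtain ⟨l, -, hl⟩ := isCompact_iff_ultrafilter_le_nhds'.1
      (isCompact_closedBall (0:ℂ) (‖θ‖ * M)) (U.map fun i => ∫ x, u i x * (wt x ^ 2 * θ x)) (by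
        rw [Ultrafilter.mem_map]
        refine Filter.univ_mem' fun i => ?_
        simpa using hbd i)
    exact ⟨l, hl⟩
  choose l hl using hex
  let ell : BoundedContinuousFunction ℝ ℂ →ₗ[ℂ] ℂ :=
    { toFun := l
      map_add' := fun a b => by
        refine tendsto_nhds_unique (hl (a+b)) (((hl a).add (hl b)).congr fun i => ?_)
        rw [← integral_add (hintg i a) (hintg i b)]
        congr 1; ext x; simp; ring
      map_smul' := fun c a => by
        refine tendsto_nhds_unique (hl (c • a)) (((hl a).const_mul c).congr fun i => ?_)
        rw [← integral_const_mul]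
        congr 1; ext x; simp; ring }
  have hell : ∀ θ, ‖l θ‖ ≤ ∫ x, ‖θ x‖ ∂(μ : Measure ℝ) := by
    intro θ
    refine le_of_tendsto_of_tendsto' (hl θ).norm (hμt (nrm θ)) (fun i => hb i θ)
  have : Fact ((1:ℝ≥0∞) ≤ 2) := ⟨by norm_num⟩
  let T := BoundedContinuousFunction.toLp (E := ℂ) 2 (μ : Measure ℝ) ℂ
  have hT : ∀ θ, (T θ : ℝ → ℂ) =ᵐ[(μ : Measure ℝ)] θ := fun θ =>
    BoundedContinuousFunction.coeFn_toLp 2 (μ : Measure ℝ) ℂ θ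
  obtain ⟨e, he⟩ := riesz_factor (V := BoundedContinuousFunction ℝ ℂ) (E := Lp ℂ 2 (μ : Measure ℝ))
    T.toLinearMap ell (((μ : Measure ℝ) univ) ^ (1/(1:ℝ≥0∞).toReal - 1/(2:ℝ≥0∞).toReal)).toReal (by
    intro θ
    refine (hell θ).trans ?_
    have hae : AEStronglyMeasurable (θ : ℝ → ℂ) (μ : Measure ℝ) := θ.continuous.aestronglyMeasurable
    have h1 := eLpNorm_le_eLpNorm_mul_rpow_measure_univ (p := 1) (q := 2) (μ := (μ : Measure ℝ)) (by norm_num)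
      hae
    rw [integral_norm_eq_lintegral_enorm hae, ← eLpNorm_one_eq_lintegral_enorm]
    have h2 : eLpNorm (θ : ℝ → ℂ) 2 (μ : Measure ℝ) = eLpNorm (T θ) 2 (μ : Measure ℝ) :=
      eLpNorm_congr_ae (hT θ).symm
    rw [h2] at h1
    have h3 := ENNReal.toReal_mono ?_ h1
    · rw [ENNReal.toReal_mul, mul_comm] at h3
      exact h3
    · refine ENNReal.mul_ne_top (Lp.eLpNorm_ne_top _) ?_
      exact ENNReal.rpow_ne_top_of_nonneg (by norm_num) (measure_ne_top _ _))
  refine ⟨μ, fun x => (starRingEnd ℂ) (e x), ?_, fun θ => ?_⟩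
  · have := (Lp.memLp e).integrable (by norm_num)
    exact (Complex.conjCLE.toContinuousLinearMap.integrable_comp this)
  · have h1 := he θ
    have h2 : ∫ x, (starRingEnd ℂ) (e x) * θ x ∂(μ : Measure ℝ) = l θ := by
      change _ = ell θ
      rw [h1, L2.inner_def]
      refine integral_congr_ae ?_
      filter_upwards [hT θ] with x hx
      simp only [ContinuousLinearMap.coe_coe, hx]
      simp [mul_comm]
    rw [h2]; exact hl θ

def cauchyInt (A : Set ℝ) (δ : ℝ) (z : ℂ) : ℂ := ∫ a in A, I / (z - a + δ * I)

lemma cauchyInt_den_ne {z : ℂ} {δ : ℝ} (hz : -δ < z.im) (a : ℝ) : z - a + δ * I ≠ 0 := by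
  intro h
  have := congrArg Complex.im h
  simp at this
  linarith

lemma cauchyInt_cont {z : ℂ} {δ : ℝ} (hz : -δ < z.im) :
    Continuous (fun a : ℝ => I / (z - a + δ * I)) :=
  Continuous.div (by fun_prop) (by fun_prop) (cauchyInt_den_ne hz)

lemma cauchyInt_diff {A : Set ℝ} (hA : volume A ≠ ⊤) {δ : ℝ} (hδ : 0 < δ) {z : ℂ} (hz : 0 ≤ z.im) :
    DifferentiableAt ℂ (cauchyInt A δ) z := by
  have himb : ∀ w ∈ Metric.ball z (δ/2), -(δ/2) < w.im := by
    intro w hw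
    have h1 := abs_im_le_norm (w - z)
    rw [Metric.mem_ball, dist_eq_norm] at hw
    have := (abs_lt.1 (h1.trans_lt hw)).1
    simp at this; linarith
  have : IsFiniteMeasure (volume.restrict A) := ⟨by simpa using hA.lt_top⟩
  refine differentiableAt_integral (R := δ/2) (by positivity) (b := fun _ => 2/δ)
    (fun w hw => ?_) (Eventually.of_forall fun a => ?_) (Eventually.of_forall fun a w hw => ?_)
    (integrable_const _)
  · exact (cauchyInt_cont (by linarith [himb w hw])).aestronglyMeasurable
  · intro w hw
    have := cauchyInt_den_ne (z := w) (δ := δ) (by linarith [himb w hw]) a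
    exact (DifferentiableAt.div (c := fun _ => I) (d := fun w : ℂ => w - a + δ * I) (by fun_prop) (by fun_prop) this).differentiableWithinAt
  · have h1 := abs_im_le_norm (w - a + δ * I)
    have h2 := himb w hw
    have h3 : (w - a + δ * I).im = w.im + δ := by simp
    rw [h3] at h1
    have h4 := le_abs_self (w.im + δ)
    rw [norm_div, norm_I, div_le_div_iff₀ (by linarith) hδ]
    linarith

lemma cauchyInt_norm_le {A : Set ℝ} (hA : volume A ≠ ⊤) {δ : ℝ} {z : ℂ} {r : ℝ}
    (hr : 0 < r) (h : ∀ a ∈ A, r ≤ ‖z - a + δ * I‖) :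
    ‖cauchyInt A δ z‖ ≤ 1 / r * (volume A).toReal := by
  refine norm_setIntegral_le_of_norm_le_const hA.lt_top (fun a ha => ?_)
  rw [norm_div, norm_I]
  exact one_div_le_one_div_of_le hr (h a ha)

lemma cauchyInt_re {A : Set ℝ} (hA : volume A ≠ ⊤) {δ : ℝ} (hδ : 0 < δ) {z : ℂ} (hz : 0 ≤ z.im) :
    (cauchyInt A δ z).re = ∫ a in A, (z.im + δ) / ((z.re - a)^2 + (z.im + δ)^2) := by
  have : IsFiniteMeasure (volume.restrict A) := ⟨by simpa using hA.lt_top⟩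
  have hi : Integrable (fun a : ℝ => I / (z - a + δ * I)) (volume.restrict A) := by
    refine Integrable.of_bound (C := 1/δ) (cauchyInt_cont (by linarith)).aestronglyMeasurable
      (Eventually.of_forall fun a => ?_)
    have h1 := abs_im_le_norm (z - a + δ * I)
    have h3 : (z - a + δ * I).im = z.im + δ := by simp
    rw [h3] at h1
    have h4 := le_abs_self (z.im + δ)
    rw [norm_div, norm_I]
    exact one_div_le_one_div_of_le hδ (by linarith)
  have := integral_re hi
  rw [cauchyInt]
  refine this.symm.trans ?_
  congr 1; ext a
  simp [Complex.div_re, normSq_apply]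
  ring

lemma peak_fn {K : Set ℝ} (hK : IsCompact K) (h0 : volume K = 0) : ∃ F : ℕ → ℂ → ℂ,
    (∀ n z, 0 ≤ z.im → DifferentiableAt ℂ (F n) z) ∧ (∀ n z, 0 ≤ z.im → ‖F n z‖ ≤ 1) ∧
    (∀ x : ℝ, x ∈ K → Tendsto (fun n => F n x) atTop (𝓝 0)) ∧
    (∀ x : ℝ, x ∉ K → Tendsto (fun n => F n x) atTop (𝓝 1)) ∧
    (∀ x : ℝ, Tendsto (fun n => F n (x + (1/2:ℝ) * I)) atTop (𝓝 1)) := by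
  have hex : ∀ n : ℕ, ∃ δ : ℝ, 0 < δ ∧ δ ≤ 1/((n:ℝ)+1) ∧
      volume (Metric.cthickening δ K) ≤ ENNReal.ofReal (1/((n:ℝ)+1)^2) := by
    intro n
    have h1 := (tendsto_measure_cthickening_of_isCompact (μ := (volume : Measure ℝ)) hK).mono_left
      (nhdsWithin_le_nhds (s := Ioi 0))
    rw [h0] at h1
    have h2 : ∀ᶠ r : ℝ in 𝓝[>] 0, volume (Metric.cthickening r K) ≤ ENNReal.ofReal (1/((n:ℝ)+1)^2) :=
      h1.eventually_le_const (by
        rw [ENNReal.ofReal_pos]; positivity)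
    have h3 : ∀ᶠ r : ℝ in 𝓝[>] 0, r ∈ Ioo 0 (1/((n:ℝ)+1)) := Ioo_mem_nhdsGT (by positivity)
    obtain ⟨r, h2, h3⟩ := (h2.and h3).exists
    exact ⟨r, h3.1, h3.2.le, h2⟩
  choose δ hδ0 hδ1 hδ2 using hex
  let A : ℕ → Set ℝ := fun n => Metric.cthickening (δ n) K
  have hAm : ∀ n, MeasurableSet (A n) := fun n => Metric.isClosed_cthickening.measurableSet
  have hAt : ∀ n, volume (A n) ≠ ⊤ := fun n => ((hδ2 n).trans_lt ENNReal.ofReal_lt_top).ne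
  have hAv : ∀ n, (volume (A n)).toReal ≤ 1/((n:ℝ)+1)^2 := fun n =>
    ENNReal.toReal_le_of_le_ofReal (by positivity) (hδ2 n)
  let g : ℕ → ℂ → ℂ := fun n => cauchyInt (A n) (δ n)
  have hre : ∀ n z, 0 ≤ z.im → 0 ≤ (g n z).re := by
    intro n z hz
    rw [cauchyInt_re (hAt n) (hδ0 n) hz]
    refine integral_nonneg fun a => ?_
    have := hδ0 n
    positivity
  have htend : ∀ (z : ℂ) (r : ℝ), 0 < r → (∀ᶠ n in atTop, ∀ a ∈ A n, r ≤ ‖z - a + δ n * I‖) →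
      Tendsto (fun n : ℕ => Complex.exp (-(((n:ℂ)+1) * g n z))) atTop (𝓝 1) := by
    intro z r hr hev
    have : Tendsto (fun n : ℕ => -(((n:ℂ)+1) * g n z)) atTop (𝓝 0) := by
      have h4 := (tendsto_one_div_add_atTop_nhds_zero_nat (𝕜 := ℝ)).const_mul (1/r)
      rw [mul_zero] at h4
      refine squeeze_zero_norm' ?_ h4
      filter_upwards [hev] with n hn
      have h5 := cauchyInt_norm_le (hAt n) hr hn
      rw [norm_neg, norm_mul]
      have h6 : ‖((n:ℂ)+1)‖ = (n:ℝ)+1 := by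
        rw [← Nat.cast_one, ← Nat.cast_add, Complex.norm_natCast]; simp
      rw [h6]
      have h7 := hAv n
      have hn0 : (0:ℝ) < (n:ℝ)+1 := by positivity
      calc ((n:ℝ)+1) * ‖g n z‖ ≤ ((n:ℝ)+1) * (1 / r * (1/((n:ℝ)+1)^2)) := by
            refine mul_le_mul_of_nonneg_left (h5.trans ?_) hn0.le
            exact mul_le_mul_of_nonneg_left h7 (by positivity)
        _ = _ := by field_simp
    have h8 := (Complex.continuous_exp.tendsto 0).comp this
    rw [Complex.exp_zero] at h8
    exact h8
  have hnorm : ∀ (n : ℕ) z, ‖Complex.exp (-(((n:ℂ)+1) * g n z))‖ = Real.exp (-(((n:ℝ)+1) * (g n z).re)) := by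
    intro n z
    rw [Complex.norm_exp]
    simp
  refine ⟨fun n z => Complex.exp (-(((n:ℂ)+1) * g n z)), fun n z hz => ?_, fun n z hz => ?_,
    fun x hx => ?_, fun x hx => ?_, fun x => ?_⟩
  · exact ((cauchyInt_diff (hAt n) (hδ0 n) hz).const_mul _).neg.cexp
  · rw [hnorm, Real.exp_le_one_iff]
    have := hre n z hz
    have : (0:ℝ) ≤ ((n:ℝ)+1) * (g n z).re := by positivity
    linarith
  · have h1 : ∀ n, 1 ≤ (g n x).re := by
      intro n
      have hd := hδ0 n
      rw [cauchyInt_re (hAt n) hd (by simp)]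
      have hsub : Icc (x - δ n) (x + δ n) ⊆ A n := by
        rw [← Real.closedBall_eq_Icc]
        exact Metric.closedBall_subset_cthickening hx _
      have hcont : Continuous (fun a : ℝ => ((x:ℂ).im + δ n) / (((x:ℂ).re - a)^2 + ((x:ℂ).im + δ n)^2)) := by
        refine Continuous.div (by fun_prop) (by fun_prop) (fun a => ?_)
        simp
        positivity
      have hcomp : IsCompact (A n) := hK.cthickening
      calc (1:ℝ) = ∫ a in Icc (x - δ n) (x + δ n), 1 / (2 * δ n) := by
            rw [setIntegral_const, measureReal_def, Real.volume_Icc, ENNReal.toReal_ofReal (by linarith), smul_eq_mul]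
            field_simp; ring
        _ ≤ ∫ a in Icc (x - δ n) (x + δ n), ((x:ℂ).im + δ n) / (((x:ℂ).re - a)^2 + ((x:ℂ).im + δ n)^2) := by
            refine setIntegral_mono_on (continuous_const.continuousOn.integrableOn_compact isCompact_Icc) (hcont.continuousOn.integrableOn_compact isCompact_Icc)
              measurableSet_Icc (fun a ha => ?_)
            simp only [ofReal_im, ofReal_re, zero_add]
            rw [div_le_div_iff₀ (by positivity) (by positivity)]
            have : (x - a)^2 ≤ δ n ^ 2 := sq_le_sq' (by linarith [ha.2]) (by linarith [ha.1])
            nlinarith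
        _ ≤ _ := by
            refine setIntegral_mono_set (hcont.continuousOn.integrableOn_compact hcomp) ?_
              hsub.eventuallyLE
            refine Eventually.of_forall fun a => ?_
            simp; positivity
    refine squeeze_zero_norm (fun n => ?_) (?_ : Tendsto (fun n : ℕ => Real.exp (-(n:ℝ))) atTop (𝓝 0))
    · rw [hnorm, Real.exp_le_exp]
      have := h1 n
      have h0 : (0:ℝ) ≤ n := Nat.cast_nonneg n
      nlinarith
    · exact Real.tendsto_exp_neg_atTop_nhds_zero.comp tendsto_natCast_atTop_atTop
  · rcases K.eq_empty_or_nonempty with rfl | hne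
    · refine htend x 1 one_pos (Eventually.of_forall fun n a ha => ?_)
      simp [A] at ha
    · have hd : 0 < Metric.infDist x K := (hK.isClosed.notMem_iff_infDist_pos hne).1 hx
      refine htend x (Metric.infDist x K / 2) (by positivity) ?_
      have h1 := tendsto_one_div_add_atTop_nhds_zero_nat (𝕜 := ℝ)
      filter_upwards [h1.eventually (gt_mem_nhds (half_pos hd))] with n hn a ha
      have h2 : Metric.infDist a K ≤ δ n := by
        obtain ⟨y, hy, hay⟩ : ∃ y ∈ K, dist a y ≤ δ n := by
          have : a ∈ Metric.cthickening (δ n) K := ha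
          rw [hK.cthickening_eq_biUnion_closedBall (hδ0 n).le] at this
          simpa using this
        exact (Metric.infDist_le_dist_of_mem hy).trans hay
      have h3 := Metric.infDist_le_infDist_add_dist (s := K) (x := x) (y := a)
      have h4 := abs_re_le_norm ((x:ℂ) - a + δ n * I)
      have h5 : ((x:ℂ) - a + δ n * I).re = x - a := by simp
      rw [h5] at h4
      rw [Real.dist_eq] at h3
      have := hδ1 n
      linarith
  · refine htend _ (1/2) (by norm_num) (Eventually.of_forall fun n a ha => ?_)
    have h4 := abs_im_le_norm ((x:ℂ) + (1/2:ℝ) * I - a + δ n * I)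
    have h5 : ((x:ℂ) + (1/2:ℝ) * I - a + δ n * I).im = 1/2 + δ n := by simp
    rw [h5] at h4
    have := le_abs_self (1/2 + δ n)
    linarith [hδ0 n]

lemma ClsG.mul_bdd {G F : ℂ → ℂ} {C B : ℝ} (hG : ClsG G C) (hF : ∀ z : ℂ, 0 ≤ z.im → z.im ≤ 1 → DifferentiableAt ℂ F z)
    (hB : ∀ z : ℂ, 0 ≤ z.im → z.im ≤ 1 → ‖F z‖ ≤ B) : ClsG (fun z => F z * G z) (B * C) where
  hd := fun z h0 h1 => (hF z h0 h1).mul (hG.hd z h0 h1)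
  hb := fun z h0 h1 => by
    rw [norm_mul, mul_assoc]
    exact mul_le_mul (hB z h0 h1) (hG.hb z h0 h1) (norm_nonneg _) ((norm_nonneg _).trans (hB z h0 h1))

lemma ClsG.continuous0 {G : ℂ → ℂ} {C : ℝ} (hG : ClsG G C) : Continuous (fun x : ℝ => G x) := by
  have := hG.continuous_line (y := 0) (by simp)
  simpa using this

lemma ClsG.bound0 {G : ℂ → ℂ} {C : ℝ} (hG : ClsG G C) (x : ℝ) : ‖G x‖ ≤ C * wt x ^ 2 := by
  have := hG.bound_line (y := 0) (x := x) (by simp)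
  simpa using this

lemma continuous_div_wt {φ : ℝ → ℂ} (hφ : Continuous φ) : Continuous (fun x => φ x / (wt x : ℂ) ^ 2) := by
  have := continuous_wt
  refine Continuous.div hφ (by fun_prop) (fun x => ?_)
  have := (wt_pos x).ne'
  exact pow_ne_zero _ (by exact_mod_cast this)

lemma norm_div_wt {φ : ℝ → ℂ} {C : ℝ} {x : ℝ} (hφ : ‖φ x‖ ≤ C * wt x ^ 2) : ‖φ x / (wt x : ℂ) ^ 2‖ ≤ C := by
  rw [norm_div, norm_pow, Complex.norm_real, Real.norm_of_nonneg (wt_pos x).le,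
    div_le_iff₀ (pow_pos (wt_pos x) 2)]
  exact hφ

lemma null_compact {μ : Measure ℝ} [IsFiniteMeasure μ] {k h12 : ℝ → ℂ} (hk : Integrable k μ)
    (hh : Integrable (fun x => ‖h12 x‖ * wt x)) (hhm : AEStronglyMeasurable h12 volume)
    (heq : ∀ G C, ClsG G C → ∫ x, k x * (G x / wt x ^ 2) ∂μ = ∫ x : ℝ, h12 x * G (x + (1/2:ℝ) * I))
    {K : Set ℝ} (hK : IsCompact K) (h0 : volume K = 0) : ∀ᵐ x ∂(μ.restrict K), k x = 0 := by
  obtain ⟨F, hFd, hFb, hF0, hF1, hF2⟩ := peak_fn hK h0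
  have hKm := hK.measurableSet
  have hzero : ∀ ξ, ∫ x in K, k x * (gau ξ x / wt x ^ 2) ∂μ = 0 := by
    intro ξ
    have hg := clsG_gau ξ
    set C := Real.exp (1 + 2 * π * |ξ|) * 4 with hC
    have hcl : ∀ n, ClsG (fun z => F n z * gau ξ z) (1 * C) := fun n =>
      hg.mul_bdd (fun z h0 h1 => hFd n z h0) (fun z h0 h1 => hFb n z h0)
    have hki : Integrable (fun x => k x * (gau ξ x / wt x ^ 2)) μ := by
      refine hk.mul_bdd (c := C) (continuous_div_wt hg.continuous0).aestronglyMeasurable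
        (Eventually.of_forall fun x => norm_div_wt (φ := fun x : ℝ => gau ξ x) (hg.bound0 x))
    have hL : Tendsto (fun n => ∫ x : ℝ, k x * (F n x * gau ξ x / wt x ^ 2) ∂μ) atTop
        (𝓝 (∫ x : ℝ, Kᶜ.indicator (fun x : ℝ => k x * (gau ξ x / wt x ^ 2)) x ∂μ)) := by
      refine tendsto_integral_of_dominated_convergence (fun x => ‖k x * (gau ξ x / wt x ^ 2)‖)
        (fun n => ?_) hki.norm (fun n => Eventually.of_forall fun x => ?_) (Eventually.of_forall fun x => ?_)
      · exact hk.1.mul (continuous_div_wt (hcl n).continuous0).aestronglyMeasurable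
      · have := hFb n x (by simp)
        rw [mul_div_assoc, norm_mul, norm_mul, norm_mul]
        calc ‖k x‖ * (‖F n x‖ * ‖gau ξ x / wt x ^ 2‖) ≤ ‖k x‖ * (1 * ‖gau ξ x / wt x ^ 2‖) := by gcongr
          _ = _ := by rw [one_mul]
      · by_cases hx : x ∈ K
        · rw [indicator_of_notMem (by simpa using hx)]
          have := ((hF0 x hx).mul_const (k x * (gau ξ x / wt x ^ 2)))
          rw [zero_mul] at this
          refine this.congr fun n => by ring
        · rw [indicator_of_mem (by simpa using hx)]
          have := ((hF1 x hx).mul_const (k x * (gau ξ x / wt x ^ 2)))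
          rw [one_mul] at this
          refine this.congr fun n => by ring
    have hyI : (1/2:ℝ) ∈ Icc (0:ℝ) 1 := by constructor <;> norm_num
    have hR : Tendsto (fun n => ∫ x : ℝ, h12 x * (F n (x + (1/2:ℝ) * I) * gau ξ (x + (1/2:ℝ) * I))) atTop
        (𝓝 (∫ x : ℝ, h12 x * gau ξ (x + (1/2:ℝ) * I))) := by
      refine tendsto_integral_of_dominated_convergence (fun x => C * (‖h12 x‖ * wt x))
        (fun n => ?_) (hh.const_mul C) (fun n => Eventually.of_forall fun x => ?_) (Eventually.of_forall fun x => ?_)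
      · exact hhm.mul ((hcl n).continuous_line hyI).aestronglyMeasurable
      · have := le_wt_of_sq (hcl n).nonneg ((hcl n).bound_line (x := x) hyI)
        rw [norm_mul]
        simp only [one_mul] at this
        nlinarith [norm_nonneg (h12 x)]
      · have := ((hF2 x).mul_const (h12 x * gau ξ (x + (1/2:ℝ) * I)))
        rw [one_mul] at this
        refine this.congr fun n => by ring
    have hlim := tendsto_nhds_unique hL (hR.congr fun n => (heq _ _ (hcl n)).symm)
    rw [integral_indicator hKm.compl, ← heq _ _ hg, ← integral_add_compl hKm hki] at hlim
    exact (right_eq_add.1 hlim)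
  have hwc := continuous_wt
  have hb : ∃ B, ∀ x ∈ K, ‖(1 + x^2 : ℝ)‖ ≤ B := hK.exists_bound_of_continuousOn (by fun_prop)
  obtain ⟨B, hB⟩ := hb
  have := ae_zero_of_gau (μ := μ.restrict K) (k := fun x => k x / wt x ^ 2) ?_ ?_ ?_
  · filter_upwards [this] with x hx
    have := (wt_pos x).ne'
    rcases div_eq_zero_iff.1 hx with h | h
    · exact h
    · exact absurd (pow_eq_zero_iff (two_ne_zero) |>.1 h) (by exact_mod_cast this)
  · have : (fun x => k x / (wt x:ℂ) ^ 2) = fun x => k x * ((fun _ => (1:ℂ)) x / (wt x:ℂ)^2) := by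
      ext x; ring
    rw [this]
    exact hk.1.restrict.mul (continuous_div_wt continuous_const).aestronglyMeasurable
  · have : (fun x => ‖k x / (wt x:ℂ) ^ 2‖ * wt x) = fun x => ‖k x‖ * (1 + x^2) := by
      ext x
      rw [norm_div, norm_pow, Complex.norm_real, Real.norm_of_nonneg (wt_pos x).le]
      unfold wt
      have : (0:ℝ) < 1 + x^2 := by positivity
      field_simp
    rw [this]
    refine hk.norm.restrict.mul_bdd (c := B) (Continuous.aestronglyMeasurable (by fun_prop)) ?_
    rw [ae_restrict_iff' hKm]
    exact Eventually.of_forall hB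
  · intro ξ
    rw [← hzero ξ]
    congr 1; ext x; ring

lemma density_of_null {μ : Measure ℝ} [IsFiniteMeasure μ] {k : ℝ → ℂ} (hk : Integrable k μ)
    (hn : ∀ K : Set ℝ, IsCompact K → volume K = 0 → ∀ᵐ x ∂(μ.restrict K), k x = 0) :
    ∃ m : ℝ → ℂ, Integrable m ∧ ∀ θ : ℝ → ℂ, ∫ x, k x * θ x ∂μ = ∫ x, m x * θ x := by
  let k' := hk.1.mk k
  have hk' : k =ᵐ[μ] k' := hk.1.ae_eq_mk
  have hk'm : StronglyMeasurable k' := hk.1.stronglyMeasurable_mk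
  let S := {x | k' x ≠ 0}
  have hS : MeasurableSet S := (hk'm.measurable (measurableSet_singleton 0)).compl
  let ν := μ.restrict S
  have hac : ν ≪ volume := by
    refine Measure.AbsolutelyContinuous.mk fun s hs hs0 => ?_
    rw [Measure.restrict_apply hs]
    by_contra hne
    obtain ⟨K, hKs, hK, hK0⟩ := (hs.inter hS).exists_lt_isCompact (μ := μ) (pos_iff_ne_zero.2 hne)
    have h1 := hn K hK (measure_mono_null (hKs.trans inter_subset_left) hs0)
    have h2 := ae_restrict_of_ae (s := K) hk'
    have h3 : ∀ᵐ x ∂(μ.restrict K), False := by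
      filter_upwards [h1, h2, ae_restrict_mem hK.measurableSet] with x hx1 hx2 hx3
      exact (hKs hx3).2 (by rw [← hx2, hx1])
    have h4 : μ.restrict K = 0 := by
      rwa [Filter.eventually_false_iff_eq_bot, ae_eq_bot] at h3
    rw [Measure.restrict_eq_zero] at h4
    exact hK0.ne' h4
  have hki' : Integrable k' μ := hk.congr hk'
  refine ⟨fun x => (ν.rnDeriv volume x).toReal • k' x, ?_, fun θ => ?_⟩
  · exact (integrable_rnDeriv_smul_iff hac).2 hki'.restrict
  · have h1 : ∫ x, k x * θ x ∂μ = ∫ x, k' x * θ x ∂μ := integral_congr_ae (by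
      filter_upwards [hk'] with x hx; rw [hx])
    have h2 : ∫ x, k' x * θ x ∂μ = ∫ x in S, k' x * θ x ∂μ := by
      rw [setIntegral_eq_integral_of_forall_compl_eq_zero]
      intro x hx
      have : k' x = 0 := by by_contra h; exact hx h
      rw [this, zero_mul]
    rw [h1, h2]
    change ∫ x, k' x * θ x ∂ν = _
    rw [← integral_rnDeriv_smul hac]
    congr 1; ext x; rw [smul_mul_assoc]

lemma trace_U {h : ℂ → ℂ} {M : ℝ} (hA : ClsA h M) (U : Ultrafilter ℝ) (hU : (U : Filter ℝ) ≤ 𝓝[>] 0) :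
    ∃ m : ℝ → ℂ, Integrable m ∧ ∀ θ : BoundedContinuousFunction ℝ ℂ,
      Tendsto (fun y : ℝ => ∫ x : ℝ, h (x + y * I) * (wt x ^ 2 * θ x)) U (𝓝 (∫ x, m x * θ x)) := by
  classical
  have hM0 : 0 ≤ M := (integral_nonneg fun x => mul_nonneg (norm_nonneg _) (wt_pos x).le).trans
    (hA.hM (1/2) (by constructor <;> norm_num))
  have hev : ∀ᶠ y : ℝ in U, y ∈ Ioo (0:ℝ) 1 := hU (Ioo_mem_nhdsGT zero_lt_one)
  obtain ⟨μ, k, hk, hlim⟩ := weak_limit U (fun y x => if y ∈ Ioo (0:ℝ) 1 then h (x + y * I) else 0) M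
    (fun y => by
      by_cases hy : y ∈ Ioo (0:ℝ) 1
      · simp only [hy, if_true]; exact continuous_line hA.hd hy
      · simp only [hy, if_false]; exact continuous_const)
    (fun y => by
      by_cases hy : y ∈ Ioo (0:ℝ) 1
      · simp only [hy, if_true]; exact hA.hi y hy
      · simp only [hy, if_false]; simp)
    (fun y => by
      by_cases hy : y ∈ Ioo (0:ℝ) 1
      · simp only [hy, if_true]; exact hA.hM y hy
      · simp only [hy, if_false]; simpa using hM0)
  have hlim' : ∀ θ : BoundedContinuousFunction ℝ ℂ,
      Tendsto (fun y : ℝ => ∫ x : ℝ, h (x + y * I) * (wt x ^ 2 * θ x)) U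
        (𝓝 (∫ x, k x * θ x ∂(μ : Measure ℝ))) := fun θ => by
    refine (hlim θ).congr' ?_
    filter_upwards [hev] with y hy
    simp only [hy, if_true]
  have hhalf : (1/2:ℝ) ∈ Ioo (0:ℝ) 1 := by constructor <;> norm_num
  obtain ⟨m, hm, hmk⟩ := density_of_null hk (fun K hK hK0 => null_compact hk (hA.hi (1/2) hhalf)
    (continuous_line hA.hd hhalf).aestronglyMeasurable (fun G C hG => by
      let θ : BoundedContinuousFunction ℝ ℂ := BoundedContinuousFunction.ofNormedAddCommGroup
        (fun x => G x / wt x ^ 2) (continuous_div_wt hG.continuous0) C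
        (fun x => norm_div_wt (φ := fun x : ℝ => G x) (hG.bound0 x))
      refine tendsto_nhds_unique (hlim' θ) (((hA.tendsto_G hG hhalf).mono_left hU).congr fun y => ?_)
      congr 1; ext x
      have := (wt_pos x).ne'
      have : (wt x : ℂ) ≠ 0 := by exact_mod_cast this
      change _ = _ * (_ * (G x / wt x ^ 2))
      field_simp) hK hK0)
  exact ⟨m, hm, fun θ => by rw [← hmk]; exact hlim' θ⟩

lemma ae_zero_of_clsG {m : ℝ → ℂ} (hm : Integrable m)
    (h0 : ∀ G C, ClsG G C → ∫ x, m x * (G x / wt x ^ 2) = 0) : m =ᵐ[volume] 0 := by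
  have hb : ∀ z : ℂ, 0 ≤ z.im → z.im ≤ 1 → ‖Complex.exp (-z^2)‖ ≤ Real.exp 1 := fun z h0 h1 => by
    rw [Complex.norm_exp, Real.exp_le_exp]
    simp [pow_two]; nlinarith [sq_nonneg z.re]
  have h1 := ae_zero_of_gau (μ := volume) (k := fun x => m x * (Complex.exp (-(x:ℂ)^2) / wt x ^ 2)) ?_ ?_ ?_
  · filter_upwards [h1] with x hx
    have := (wt_pos x).ne'
    have : (wt x : ℂ) ≠ 0 := by exact_mod_cast this
    simpa [this] using hx
  · exact hm.1.mul (continuous_div_wt (by fun_prop)).aestronglyMeasurable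
  · have hwc := continuous_wt
    have : Integrable (fun x => m x * (Complex.exp (-(x:ℂ)^2) / wt x ^ 2)) := by
      refine hm.mul_bdd (c := 4) (continuous_div_wt (by fun_prop)).aestronglyMeasurable
        (Eventually.of_forall fun x => norm_div_wt (φ := fun x : ℝ => Complex.exp (-(x:ℂ)^2)) ?_)
      rw [Complex.norm_exp]
      have : (-(x:ℂ)^2).re = -x^2 := by simp [pow_two]
      rw [this]
      exact exp_neg_sq_le x
    refine this.norm.mul_bdd (c := 1) hwc.aestronglyMeasurable (Eventually.of_forall fun x => ?_)
    rw [Real.norm_of_nonneg (wt_pos x).le]; exact wt_le_one x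
  · intro ξ
    rw [← h0 _ _ ((clsG_gau ξ).mul_bdd (F := fun z => Complex.exp (-z^2)) (fun z _ _ => by fun_prop) hb)]
    congr 1; ext x; ring

/-- existence of the boundary trace -/
lemma ClsA.trace {h : ℂ → ℂ} {M : ℝ} (hA : ClsA h M) :
    ∃ h0 : ℝ → ℂ, AEStronglyMeasurable h0 volume ∧ Integrable (fun x => ‖h0 x‖ * wt x ^ 2) ∧
      (∀ (φ : ℝ → ℂ) (C : ℝ), Continuous φ → (∀ x, ‖φ x‖ ≤ C * wt x ^ 2) →
        Tendsto (fun y : ℝ => ∫ x : ℝ, h (x + y * I) * φ x) (𝓝[>] 0) (𝓝 (∫ x, h0 x * φ x))) ∧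
      (∀ G C, ClsG G C → ∀ y ∈ Ioo (0:ℝ) 1, ∫ x : ℝ, h0 x * G x = ∫ x : ℝ, h (x + y * I) * G (x + y * I)) := by
  have key : ∀ m : ℝ → ℂ, ∀ U : Ultrafilter ℝ, (U : Filter ℝ) ≤ 𝓝[>] 0 →
      (∀ θ : BoundedContinuousFunction ℝ ℂ,
      Tendsto (fun y : ℝ => ∫ x : ℝ, h (x + y * I) * (wt x ^ 2 * θ x)) U (𝓝 (∫ x, m x * θ x))) →
      ∀ G C, ClsG G C → ∀ y ∈ Ioo (0:ℝ) 1, ∫ x : ℝ, m x * (G x / wt x ^ 2) =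
        ∫ x : ℝ, h (x + y * I) * G (x + y * I) := by
    intro m U hU hlim G C hG y1 hy1
    let θ : BoundedContinuousFunction ℝ ℂ := BoundedContinuousFunction.ofNormedAddCommGroup
        (fun x => G x / wt x ^ 2) (continuous_div_wt hG.continuous0) C
        (fun x => norm_div_wt (φ := fun x : ℝ => G x) (hG.bound0 x))
    refine tendsto_nhds_unique (hlim θ) (((hA.tendsto_G hG hy1).mono_left hU).congr fun y => ?_)
    congr 1; ext x
    have := (wt_pos x).ne'
    have : (wt x : ℂ) ≠ 0 := by exact_mod_cast this
    change _ = _ * (_ * (G x / wt x ^ 2))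
    field_simp
  let U0 : Ultrafilter ℝ := Ultrafilter.of (𝓝[>] (0:ℝ))
  have hU0 : (U0 : Filter ℝ) ≤ 𝓝[>] 0 := Ultrafilter.of_le _
  have hhalf : (1/2:ℝ) ∈ Ioo (0:ℝ) 1 := by constructor <;> norm_num
  obtain ⟨m, hm, hmlim⟩ := trace_U hA U0 hU0
  have hall : ∀ θ : BoundedContinuousFunction ℝ ℂ,
      Tendsto (fun y : ℝ => ∫ x : ℝ, h (x + y * I) * (wt x ^ 2 * θ x)) (𝓝[>] 0) (𝓝 (∫ x, m x * θ x)) := by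
    intro θ
    rw [tendsto_iff_ultrafilter]
    intro U hU
    obtain ⟨m', hm', hmlim'⟩ := trace_U hA U hU
    have hd := ae_zero_of_clsG (hm.sub hm') (fun G C hG => by
      have hc := (continuous_div_wt hG.continuous0).aestronglyMeasurable (μ := volume)
      have hbd := fun x => norm_div_wt (φ := fun x : ℝ => G x) (hG.bound0 x)
      have h1 := key m U0 hU0 hmlim G C hG _ hhalf
      have h2 := key m' U hU hmlim' G C hG _ hhalf
      have h3 := integral_sub (hm.mul_bdd (c := C) hc (Eventually.of_forall hbd))
        (hm'.mul_bdd (c := C) hc (Eventually.of_forall hbd))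
      rw [h1, h2, sub_self] at h3
      rw [← h3]
      congr 1; ext x; simp; ring)
    have : ∫ x, m x * θ x = ∫ x, m' x * θ x := integral_congr_ae (by
      filter_upwards [hd] with x hx
      simp only [Pi.sub_apply, Pi.zero_apply, sub_eq_zero] at hx
      rw [hx])
    rw [this]
    exact hmlim' θ
  have hw : ∀ x, (wt x : ℂ) ≠ 0 := fun x => by
    have := (wt_pos x).ne'
    exact_mod_cast this
  refine ⟨fun x => m x / wt x ^ 2, ?_, ?_, fun φ C hφ hb => ?_, fun G C hG y hy => ?_⟩
  · have : (fun x => m x / (wt x:ℂ) ^ 2) = fun x => m x * ((fun _ => (1:ℂ)) x / (wt x:ℂ)^2) := by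
      ext x; ring
    rw [this]
    exact hm.1.mul (continuous_div_wt continuous_const).aestronglyMeasurable
  · refine hm.norm.congr (Eventually.of_forall fun x => ?_)
    have := (wt_pos x).ne'
    simp only [norm_div, norm_pow, Complex.norm_real, Real.norm_of_nonneg (wt_pos x).le]
    field_simp
  · let θ : BoundedContinuousFunction ℝ ℂ := BoundedContinuousFunction.ofNormedAddCommGroup
        (fun x => φ x / wt x ^ 2) (continuous_div_wt hφ) C
        (fun x => norm_div_wt (hb x))
    have := hall θ
    have e1 : ∀ y : ℝ, ∫ x : ℝ, h (x + y * I) * (wt x ^ 2 * θ x) = ∫ x : ℝ, h (x + y * I) * φ x := by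
      intro y
      congr 1; ext x
      have := hw x
      change _ * (_ * (φ x / wt x ^ 2)) = _
      field_simp
    have e2 : ∫ x : ℝ, m x * θ x = ∫ x : ℝ, m x / wt x ^ 2 * φ x := by
      congr 1; ext x
      change _ * (φ x / wt x ^ 2) = _
      ring
    rw [e2] at this
    exact this.congr e1
  · rw [← key m U0 hU0 hmlim G C hG y hy]
    congr 1; ext x; ring

lemma exists_conj {p : ℝ≥0∞} (hp : 1 ≤ p) : ∃ p', 1 ≤ p' ∧ ENNReal.HolderConjugate p' p := by
  have h1 : p⁻¹ ≤ 1 := ENNReal.inv_le_one.2 hp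
  refine ⟨(1 - p⁻¹)⁻¹, ENNReal.one_le_inv.2 tsub_le_self, ?_⟩
  rw [ENNReal.holderConjugate_iff, inv_inv]
  exact tsub_add_cancel_of_le h1

/-- Hölder against the weight. -/
lemma holder_wt {p : ℝ≥0∞} (hp : 1 ≤ p) : ∃ K : NNReal, ∀ f : ℝ → ℂ, AEStronglyMeasurable f volume →
    ∫⁻ x, ‖f x‖ₑ * ENNReal.ofReal (wt x) ≤ K * eLpNorm f p volume := by
  obtain ⟨p', hp', hc⟩ := exists_conj hp
  have hw := memLp_wt p' hp'
  refine ⟨(eLpNorm wt p' volume).toNNReal, fun f hf => ?_⟩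
  rw [ENNReal.coe_toNNReal hw.2.ne]
  have := eLpNorm_smul_le_mul_eLpNorm (p := p') (q := p) (r := 1) hf hw.1
  refine le_trans (le_of_eq ?_) this
  rw [eLpNorm_one_eq_lintegral_enorm]
  congr 1; ext x
  rw [Pi.smul_apply', enorm_smul, mul_comm, Real.enorm_of_nonneg (wt_pos x).le]

lemma lint_wt_eq (f : ℝ → ℂ) : ∫⁻ x, ‖f x‖ₑ * ENNReal.ofReal (wt x) = ∫⁻ x, ‖‖f x‖ * wt x‖ₑ := by
  congr 1; ext x
  rw [enorm_mul, enorm_norm, Real.enorm_of_nonneg (wt_pos x).le]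

lemma wt_integrable_of_memLp {p : ℝ≥0∞} (hp : 1 ≤ p) {f : ℝ → ℂ} (hf : MemLp f p volume) :
    Integrable (fun x => ‖f x‖ * wt x) := by
  obtain ⟨K, hK⟩ := holder_wt hp
  refine ⟨hf.1.norm.mul continuous_wt.aestronglyMeasurable, ?_⟩
  rw [hasFiniteIntegral_def, ← lint_wt_eq]
  exact (hK f hf.1).trans_lt (ENNReal.mul_lt_top ENNReal.coe_lt_top hf.2)

lemma hardy_decomp {p q : ℝ≥0∞} {h : ℂ → ℂ} {N : ℝ≥0∞} (hN : hardyNorm p q h < N) {y : ℝ}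
    (hy : y ∈ Ioo (0:ℝ) 1) : ∃ f g : ℝ → ℂ, Measurable f ∧ Measurable g ∧ (∀ x : ℝ, f x + g x = h (x + y * I)) ∧
      eLpNorm f p volume ≤ ENNReal.ofReal (1 - y) * N ∧ eLpNorm g q volume ≤ ENNReal.ofReal y * N := by
  have h1 := (le_iSup₂ (f := fun (y : ℝ) (_ : y ∈ Ioo (0:ℝ) 1) => ⨅ (f : ℝ → ℂ) (g : ℝ → ℂ) (_ : Measurable f) (_ : Measurable g)
      (_ : f + g = bLine h y),
      ENNReal.ofReal (1 - y)⁻¹ * eLpNorm f p volume +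
        ENNReal.ofReal y⁻¹ * eLpNorm g q volume) y hy).trans_lt hN
  simp only [iInf_lt_iff] at h1
  obtain ⟨f, g, hf, hg, hfg, hlt⟩ := h1
  have aux : ∀ (a : ℝ) (b : ℝ≥0∞), 0 < a → ENNReal.ofReal a⁻¹ * b ≤ N → b ≤ ENNReal.ofReal a * N := by
    intro a b ha hb
    have : ENNReal.ofReal a * (ENNReal.ofReal a⁻¹ * b) = b := by
      rw [← mul_assoc, ← ENNReal.ofReal_mul ha.le, mul_inv_cancel₀ ha.ne', ENNReal.ofReal_one, one_mul]
    rw [← this]; gcongr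
  refine ⟨f, g, hf, hg, fun x => congrFun hfg x, aux _ _ (by linarith [hy.2]) ?_, aux _ _ hy.1 ?_⟩
  · exact (self_le_add_right _ _).trans hlt.le
  · exact (self_le_add_left _ _).trans hlt.le

lemma MemHardy.clsA {p q : ℝ≥0∞} (hp : 1 ≤ p) (hq : 1 ≤ q) {h : ℂ → ℂ} (hh : MemHardy p q h) :
    ∃ M, ClsA h M := by
  obtain ⟨K, hK⟩ := holder_wt hp
  obtain ⟨L, hL⟩ := holder_wt hq
  have hN : hardyNorm p q h < hardyNorm p q h + 1 := ENNReal.lt_add_right hh.2.ne one_ne_zero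
  set N := hardyNorm p q h + 1 with hNd
  have hNt : N ≠ ⊤ := by simp [hNd, hh.2.ne]
  have hB : ((K + L : NNReal) : ℝ≥0∞) * N ≠ ⊤ := ENNReal.mul_ne_top ENNReal.coe_ne_top hNt
  have key : ∀ y ∈ Ioo (0:ℝ) 1, ∫⁻ x : ℝ, ‖‖h (x + y * I)‖ * wt x‖ₑ ≤ ((K + L : NNReal) : ℝ≥0∞) * N := by
    intro y hy
    obtain ⟨f, g, hf, hg, hfg, hfn, hgn⟩ := hardy_decomp hN hy
    rw [← lint_wt_eq]
    have h1 : ENNReal.ofReal (1 - y) ≤ 1 := by rw [ENNReal.ofReal_le_one]; linarith [hy.1]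
    have h2 : ENNReal.ofReal y ≤ 1 := by rw [ENNReal.ofReal_le_one]; linarith [hy.2]
    calc ∫⁻ x : ℝ, ‖h (x + y * I)‖ₑ * ENNReal.ofReal (wt x)
        ≤ ∫⁻ x : ℝ, (‖f x‖ₑ * ENNReal.ofReal (wt x) + ‖g x‖ₑ * ENNReal.ofReal (wt x)) := by
          refine lintegral_mono fun x => ?_
          rw [← hfg x, ← add_mul]
          gcongr
          exact enorm_add_le _ _
      _ = (∫⁻ x : ℝ, ‖f x‖ₑ * ENNReal.ofReal (wt x)) + ∫⁻ x : ℝ, ‖g x‖ₑ * ENNReal.ofReal (wt x) := by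
          refine lintegral_add_left ?_ _
          exact hf.enorm.mul continuous_wt.measurable.ennreal_ofReal
      _ ≤ K * (1 * N) + L * (1 * N) := by
          gcongr
          · exact (hK f hf.aestronglyMeasurable).trans (by gcongr; exact hfn.trans (by gcongr))
          · exact (hL g hg.aestronglyMeasurable).trans (by gcongr; exact hgn.trans (by gcongr))
      _ = _ := by push_cast; ring
  have hm : ∀ y ∈ Ioo (0:ℝ) 1, AEStronglyMeasurable (fun x : ℝ => ‖h (x + y * I)‖ * wt x) volume := fun y hy =>
    ((continuous_line hh.1 hy).norm.mul continuous_wt).aestronglyMeasurable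
  refine ⟨(((K + L : NNReal) : ℝ≥0∞) * N).toReal, hh.1, fun y hy => ⟨hm y hy, ?_⟩, fun y hy => ?_⟩
  · rw [hasFiniteIntegral_def]; exact (key y hy).trans_lt hB.lt_top
  · have e : ∫ x : ℝ, ‖h (x + y * I)‖ * wt x = ∫ x : ℝ, ‖‖h (x + y * I)‖ * wt x‖ := by
      congr 1; ext x; rw [Real.norm_of_nonneg (mul_nonneg (norm_nonneg _) (wt_pos x).le)]
    rw [e, integral_norm_eq_lintegral_enorm (hm y hy)]
    exact ENNReal.toReal_mono hB (key y hy)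

/-- Young inequality for a nonnegative kernel. -/
lemma young {P : ℝ → ℝ} (hP : Continuous P) (h0 : ∀ u, 0 ≤ P u) (hi : Integrable P) {p : ℝ≥0∞}
    (hp : 1 ≤ p) {v : ℝ → ℂ} (hv : AEStronglyMeasurable v volume) :
    eLpNorm (fun s => ∫ t, v t * (P (t - s) : ℂ)) p volume ≤ ENNReal.ofReal (∫ u, P u) * eLpNorm v p volume := by
  set m := ENNReal.ofReal (∫ u, P u) with hm
  have hmt : m ≠ ⊤ := ENNReal.ofReal_ne_top
  let ν : ℝ → Measure ℝ := fun s => volume.withDensity (fun t => ENNReal.ofReal (P (t - s)))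
  have hν : ∀ s, ν s univ = m := by
    intro s
    simp only [ν]
    rw [withDensity_apply _ MeasurableSet.univ, Measure.restrict_univ,
      lintegral_sub_right_eq_self (fun t => ENNReal.ofReal (P t)) s, hm,
      ofReal_integral_eq_lintegral_ofReal hi (Eventually.of_forall h0)]
  have hmeas : ∀ s, Measurable (fun t => ENNReal.ofReal (P (t - s))) := fun s =>
    (Continuous.measurable (by fun_prop : Continuous fun t => P (t - s))).ennreal_ofReal
  have hac : ∀ s, ν s ≪ volume := fun s => withDensity_absolutelyContinuous _ _
  have hpt : ∀ s, ‖∫ t, v t * (P (t - s) : ℂ)‖ₑ ≤ eLpNorm v p (ν s) * m ^ (1 - 1 / p.toReal) := by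
    intro s
    have h1 := eLpNorm_le_eLpNorm_mul_rpow_measure_univ (μ := ν s) (p := 1) (q := p) hp
      (hv.mono_ac (hac s))
    rw [hν] at h1
    refine le_trans (le_trans (enorm_integral_le_lintegral_enorm _) (le_of_eq ?_)) (h1.trans (le_of_eq ?_))
    · rw [eLpNorm_one_eq_lintegral_enorm]
      have h2 := lintegral_withDensity_eq_lintegral_mul_non_measurable₀ (μ := (volume : Measure ℝ)) (hmeas s).aemeasurable
        (Eventually.of_forall fun t => ENNReal.ofReal_lt_top) (fun t => ‖v t‖ₑ)
      refine Eq.trans ?_ h2.symm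
      congr 1; ext t
      rw [enorm_mul, Pi.mul_apply, mul_comm]
      congr 1
      rw [← Real.enorm_of_nonneg (h0 _), ← ofReal_norm, ← ofReal_norm, Complex.norm_real]
    · simp
  rcases eq_or_ne p ⊤ with rfl | hpt'
  · rw [eLpNorm_exponent_top (f := fun s => ∫ t, v t * (P (t - s) : ℂ))]
    refine eLpNormEssSup_le_of_ae_enorm_bound (Eventually.of_forall fun s => (hpt s).trans ?_)
    simp only [ENNReal.toReal_top, div_zero, sub_zero, ENNReal.rpow_one]
    rw [mul_comm]
    refine mul_le_mul_right ?_ _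
    rw [eLpNorm_exponent_top, eLpNorm_exponent_top]
    exact eLpNormEssSup_mono_measure v (hac s)
  · have hp0 : p ≠ 0 := (one_pos.trans_le hp).ne'
    have hr : 1 ≤ p.toReal := by
      rw [← ENNReal.toReal_one]; exact ENNReal.toReal_mono hpt' hp
    set r := p.toReal with hrd
    have hr0 : 0 < r := by linarith
    rw [eLpNorm_eq_lintegral_rpow_enorm_toReal hp0 hpt', eLpNorm_eq_lintegral_rpow_enorm_toReal hp0 hpt', ← hrd]
    have h3 : ∀ s, ‖∫ t, v t * (P (t - s) : ℂ)‖ₑ ^ r ≤ m ^ (r - 1) * ∫⁻ t, ENNReal.ofReal (P (t - s)) * ‖v t‖ₑ ^ r := by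
      intro s
      refine (ENNReal.rpow_le_rpow (hpt s) hr0.le).trans (le_of_eq ?_)
      rw [eLpNorm_eq_lintegral_rpow_enorm_toReal hp0 hpt', ← hrd, ENNReal.mul_rpow_of_nonneg _ _ hr0.le,
        ← ENNReal.rpow_mul, ← ENNReal.rpow_mul, one_div_mul_cancel hr0.ne', ENNReal.rpow_one, mul_comm]
      congr 1
      · congr 1; field_simp
      · exact lintegral_withDensity_eq_lintegral_mul_non_measurable₀ (μ := (volume : Measure ℝ)) (hmeas s).aemeasurable
          (Eventually.of_forall fun t => ENNReal.ofReal_lt_top) (fun t => ‖v t‖ₑ ^ r)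
    have h4 : ∫⁻ s, ‖∫ t, v t * (P (t - s) : ℂ)‖ₑ ^ r ≤ m ^ r * ∫⁻ t, ‖v t‖ₑ ^ r := by
      calc _ ≤ ∫⁻ s, m ^ (r - 1) * ∫⁻ t, ENNReal.ofReal (P (t - s)) * ‖v t‖ₑ ^ r := lintegral_mono h3
        _ = m ^ (r - 1) * ∫⁻ s, ∫⁻ t, ENNReal.ofReal (P (t - s)) * ‖v t‖ₑ ^ r :=
            lintegral_const_mul' _ _ (ENNReal.rpow_ne_top_of_nonneg (by linarith) hmt)
        _ = m ^ (r - 1) * ∫⁻ t, ∫⁻ s, ENNReal.ofReal (P (t - s)) * ‖v t‖ₑ ^ r := by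
            rw [lintegral_lintegral_swap]
            refine AEMeasurable.mul ?_ ?_
            · exact (Continuous.measurable (by fun_prop : Continuous fun z : ℝ × ℝ => P (z.2 - z.1))).ennreal_ofReal.aemeasurable
            · exact ((hv.comp_snd (μ := volume)).enorm).pow_const r
        _ = m ^ (r - 1) * ∫⁻ t, m * ‖v t‖ₑ ^ r := by
            congr 2; ext t
            rw [lintegral_mul_const _ (Continuous.measurable (by fun_prop : Continuous fun s => P (t - s))).ennreal_ofReal,
              lintegral_sub_left_eq_self (fun t => ENNReal.ofReal (P t)) t, hm,
              ofReal_integral_eq_lintegral_ofReal hi (Eventually.of_forall h0)]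
        _ = _ := by
            rw [lintegral_const_mul' _ _ hmt, ← mul_assoc]
            congr 1
            nth_rewrite 2 [← ENNReal.rpow_one m]
            rw [← ENNReal.rpow_add_of_nonneg _ _ (by linarith) zero_le_one]
            congr 1; ring
    refine (ENNReal.rpow_le_rpow h4 (by positivity)).trans (le_of_eq ?_)
    rw [ENNReal.mul_rpow_of_nonneg _ _ (by positivity), ← ENNReal.rpow_mul, mul_one_div_cancel hr0.ne', ENNReal.rpow_one]

lemma bound_of_compactSupport {φ : ℝ → ℂ} (hφ : Continuous φ) (hc : HasCompactSupport φ) :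
    ∃ C, ∀ x, ‖φ x‖ ≤ C * wt x ^ 2 := by
  have h1 : Continuous (fun x => φ x / (wt x:ℂ) ^ 2) := continuous_div_wt hφ
  have h2 : HasCompactSupport (fun x => φ x / (wt x:ℂ) ^ 2) := by
    simp only [div_eq_mul_inv]
    exact hc.mul_right
  obtain ⟨C, hC⟩ := h2.exists_bound_of_continuous h1
  refine ⟨C, fun x => ?_⟩
  have := hC x
  rwa [norm_div, norm_pow, Complex.norm_real, Real.norm_of_nonneg (wt_pos x).le,
    div_le_iff₀ (pow_pos (wt_pos x) 2)] at this

lemma moll_bound {p q : ℝ≥0∞} (hp : 1 ≤ p) (hq : 1 ≤ q) {h : ℂ → ℂ} {h0 : ℝ → ℂ}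
    (htr : ∀ (φ : ℝ → ℂ) (C : ℝ), Continuous φ → (∀ x, ‖φ x‖ ≤ C * wt x ^ 2) →
        Tendsto (fun y : ℝ => ∫ x : ℝ, h (x + y * I) * φ x) (𝓝[>] 0) (𝓝 (∫ x, h0 x * φ x)))
    {N : ℝ≥0∞} (hN : hardyNorm p q h < N) (hNt : N ≠ ⊤)
    {P : ℝ → ℝ} (hP : Continuous P) (hP0 : ∀ u, 0 ≤ P u) (hPc : HasCompactSupport P) (hP1 : ∫ u, P u = 1) :
    eLpNorm (fun s => ∫ t, h0 t * (P (t - s) : ℂ)) p volume ≤ N := by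
  have hex : ∀ y : ℝ, ∃ f g : ℝ → ℂ, Measurable f ∧ Measurable g ∧ (y ∈ Ioo (0:ℝ) 1 →
      (∀ x : ℝ, f x + g x = h (x + y * I)) ∧
      eLpNorm f p volume ≤ ENNReal.ofReal (1 - y) * N ∧ eLpNorm g q volume ≤ ENNReal.ofReal y * N) := by
    intro y
    by_cases hy : y ∈ Ioo (0:ℝ) 1
    · obtain ⟨f, g, h1, h2, h3⟩ := hardy_decomp hN hy
      exact ⟨f, g, h1, h2, fun _ => h3⟩
    · exact ⟨0, 0, measurable_zero, measurable_zero, fun h => absurd h hy⟩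
  choose f g hf hg hfg using hex
  have hev : ∀ᶠ y : ℝ in 𝓝[>] 0, y ∈ Ioo (0:ℝ) 1 := Ioo_mem_nhdsGT zero_lt_one
  have hPi : Integrable P := hP.integrable_of_hasCompactSupport hPc
  refine Lp.eLpNorm_le_of_ae_tendsto (u := 𝓝[>] (0:ℝ)) (f := fun y s => ∫ t, f y t * (P (t - s) : ℂ)) ?_ ?_ ?_
  · filter_upwards [hev] with y hy
    refine (young hP hP0 hPi hp (hf y).aestronglyMeasurable).trans ?_
    rw [hP1, ENNReal.ofReal_one, one_mul]
    refine (hfg y hy).2.1.trans ?_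
    have h1 : ENNReal.ofReal (1 - y) ≤ 1 := by rw [ENNReal.ofReal_le_one]; linarith [hy.1]
    calc _ ≤ 1 * N := by gcongr
      _ = N := one_mul _
  · intro y
    have : StronglyMeasurable (fun z : ℝ × ℝ => f y z.2 * (P (z.2 - z.1) : ℂ)) := by
      refine StronglyMeasurable.mul ?_ (Continuous.stronglyMeasurable (by fun_prop))
      exact ((hf y).comp measurable_snd).stronglyMeasurable
    exact this.integral_prod_right'.aestronglyMeasurable
  · refine Eventually.of_forall fun s => ?_
    have hφc : Continuous (fun t => (P (t - s) : ℂ)) := by fun_prop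
    have hφs : HasCompactSupport (fun t => (P (t - s) : ℂ)) := by
      have h1 : HasCompactSupport (fun t => P (t - s)) :=
        hPc.comp_homeomorph (Homeomorph.subRight s)
      exact h1.comp_left (g := fun r : ℝ => (r:ℂ)) (by simp)
    obtain ⟨B, hB⟩ := bound_of_compactSupport hφc hφs
    have hB0 : 0 ≤ B := by
      have h1 := (norm_nonneg _).trans (hB 0)
      simpa [wt] using h1
    obtain ⟨L, hL⟩ := holder_wt hq
    have hmain := htr _ B hφc hB
    have hg0 : Tendsto (fun y => ∫ t, g y t * (P (t - s) : ℂ)) (𝓝[>] 0) (𝓝 0) := by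
      have hlim : Tendsto (fun y : ℝ => B * (L * (y * N.toReal))) (𝓝[>] 0) (𝓝 0) := by
        have : Continuous (fun y : ℝ => B * (L * (y * N.toReal))) := by fun_prop
        have := this.tendsto 0
        simp only [zero_mul, mul_zero] at this
        exact this.mono_left nhdsWithin_le_nhds
      refine squeeze_zero_norm' ?_ hlim
      filter_upwards [hev] with y hy
      have hgn := (hfg y hy).2.2
      have hgm : MemLp (g y) q volume := ⟨(hg y).aestronglyMeasurable,
        hgn.trans_lt (ENNReal.mul_lt_top ENNReal.ofReal_lt_top hNt.lt_top)⟩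
      have hgi := wt_integrable_of_memLp hq hgm
      refine (norm_integral_mul_le_wt hgi (fun x => le_wt_of_sq hB0 (hB x))).trans ?_
      refine mul_le_mul_of_nonneg_left ?_ hB0
      have e : ∫ x : ℝ, ‖g y x‖ * wt x = ∫ x : ℝ, ‖‖g y x‖ * wt x‖ := by
        congr 1; ext x; rw [Real.norm_of_nonneg (mul_nonneg (norm_nonneg _) (wt_pos x).le)]
      rw [e, integral_norm_eq_lintegral_enorm hgi.1, ← lint_wt_eq]
      have h5 : (L : ℝ≥0∞) * eLpNorm (g y) q volume ≤ L * (ENNReal.ofReal y * N) := by gcongr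
      have h6 := ENNReal.toReal_mono (ENNReal.mul_ne_top ENNReal.coe_ne_top
        (ENNReal.mul_ne_top ENNReal.ofReal_ne_top hNt)) ((hL (g y) (hg y).aestronglyMeasurable).trans h5)
      rwa [ENNReal.toReal_mul, ENNReal.toReal_mul, ENNReal.toReal_ofReal hy.1.le, ENNReal.coe_toReal] at h6
    have hsub := hmain.sub hg0
    rw [sub_zero] at hsub
    refine hsub.congr' ?_
    filter_upwards [hev] with y hy
    have hfm : MemLp (f y) p volume := ⟨(hf y).aestronglyMeasurable,
        (hfg y hy).2.1.trans_lt (ENNReal.mul_lt_top ENNReal.ofReal_lt_top hNt.lt_top)⟩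
    have hgm : MemLp (g y) q volume := ⟨(hg y).aestronglyMeasurable,
        (hfg y hy).2.2.trans_lt (ENNReal.mul_lt_top ENNReal.ofReal_lt_top hNt.lt_top)⟩
    have i1 := integrable_mul_of_wt (wt_integrable_of_memLp hp hfm) hfm.1 hφc.aestronglyMeasurable
      (fun x => le_wt_of_sq hB0 (hB x))
    have i2 := integrable_mul_of_wt (wt_integrable_of_memLp hq hgm) hgm.1 hφc.aestronglyMeasurable
      (fun x => le_wt_of_sq hB0 (hB x))
    have e : ∀ x : ℝ, h (x + y * I) * (P (x - s) : ℂ) = f y x * (P (x - s) : ℂ) + g y x * (P (x - s) : ℂ) := by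
      intro x; rw [← (hfg y hy).1 x, add_mul]
    simp only [e]
    rw [integral_add i1 i2]
    ring

lemma trace_norm_le {p q : ℝ≥0∞} (hp : 1 ≤ p) (hq : 1 ≤ q) {h : ℂ → ℂ} {h0 : ℝ → ℂ}
    (hm : AEStronglyMeasurable h0 volume) (hi : Integrable (fun x => ‖h0 x‖ * wt x ^ 2))
    (htr : ∀ (φ : ℝ → ℂ) (C : ℝ), Continuous φ → (∀ x, ‖φ x‖ ≤ C * wt x ^ 2) →
        Tendsto (fun y : ℝ => ∫ x : ℝ, h (x + y * I) * φ x) (𝓝[>] 0) (𝓝 (∫ x, h0 x * φ x))) :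
    eLpNorm h0 p volume ≤ hardyNorm p q h := by
  refine le_of_forall_gt_imp_ge_of_dense fun N hN => ?_
  rcases eq_or_ne N ⊤ with rfl | hNt
  · exact le_top
  have hloc : LocallyIntegrable h0 volume := by
    rw [locallyIntegrable_iff]
    intro K hK
    obtain ⟨B, hB⟩ := hK.exists_bound_of_continuousOn (f := fun x : ℝ => (1 + x^2)^2) (by fun_prop)
    refine Integrable.mono' (g := fun x => B * (‖h0 x‖ * wt x ^ 2)) (hi.const_mul B).restrict hm.restrict ?_
    rw [ae_restrict_iff' hK.measurableSet]
    refine Eventually.of_forall fun x hx => ?_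
    have h1 := hB x hx
    rw [Real.norm_of_nonneg (by positivity)] at h1
    have h2 : (1 + x^2)^2 * wt x ^ 2 = 1 := by
      unfold wt
      have : (0:ℝ) < 1 + x^2 := by positivity
      field_simp
    calc ‖h0 x‖ = ((1 + x^2)^2) * (‖h0 x‖ * wt x ^ 2) := by
          rw [mul_comm (‖h0 x‖), ← mul_assoc, h2, one_mul]
      _ ≤ _ := mul_le_mul_of_nonneg_right h1 (mul_nonneg (norm_nonneg _) (sq_nonneg _))
  let φ : ℕ → ContDiffBump (0:ℝ) := fun n => ⟨1/((n:ℝ)+1), 2/((n:ℝ)+1), by positivity, by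
    rw [div_lt_div_iff_of_pos_right (by positivity)]; norm_num⟩
  have h1 := ContDiffBump.ae_convolution_tendsto_right_of_locallyIntegrable (μ := volume) (φ := φ) (l := atTop)
    (K := 2) ?_ ?_ hloc
  · refine Lp.eLpNorm_le_of_ae_tendsto (u := atTop) (f := fun n s => ∫ t, h0 t * ((φ n).normed volume (t - s) : ℂ))
      (Eventually.of_forall fun n => ?_) (fun n => ?_) ?_
    · exact moll_bound hp hq htr hN hNt (φ n).continuous_normed (φ n).nonneg_normed
        (φ n).hasCompactSupport_normed (φ n).integral_normed
    · have hc := (φ n).continuous_normed (μ := volume)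
      have : AEStronglyMeasurable (fun z : ℝ × ℝ => h0 z.2 * ((φ n).normed volume (z.2 - z.1) : ℂ)) (volume.prod volume) := by
        refine AEStronglyMeasurable.mul hm.comp_snd (Continuous.aestronglyMeasurable (by fun_prop))
      exact this.integral_prod_right'
    · filter_upwards [h1] with x hx
      refine hx.congr fun n => ?_
      rw [convolution_eq_swap]
      congr 1; ext t
      rw [ContinuousLinearMap.lsmul_apply, ← (φ n).normed_neg (μ := volume) (x - t), neg_sub, Complex.real_smul, mul_comm]
  · change Tendsto (fun n : ℕ => 2/((n:ℝ)+1)) atTop (𝓝 0)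
    have := (tendsto_one_div_add_atTop_nhds_zero_nat (𝕜 := ℝ)).const_mul 2
    rw [mul_zero] at this
    refine this.congr fun n => by ring
  · refine Eventually.of_forall fun n => ?_
    change 2/((n:ℝ)+1) ≤ 2 * (1/((n:ℝ)+1))
    apply le_of_eq; ring

def reflS (h : ℂ → ℂ) : ℂ → ℂ := fun z => h (I - z)

lemma wt_neg (x : ℝ) : wt (-x) = wt x := by simp [wt]

lemma reflS_line (h : ℂ → ℂ) (x y : ℝ) : reflS h (x + y * I) = h ((-x : ℝ) + (1 - y : ℝ) * I) := by
  unfold reflS; congr 1; push_cast; ring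

lemma hardyNorm_reflS (p q : ℝ≥0∞) (h : ℂ → ℂ) : hardyNorm q p (reflS h) ≤ hardyNorm p q h := by
  refine iSup₂_le fun y hy => ?_
  have hy' : 1 - y ∈ Ioo (0:ℝ) 1 := ⟨by linarith [hy.2], by linarith [hy.1]⟩
  refine le_trans ?_ (le_iSup₂ (f := fun (y : ℝ) (_ : y ∈ Ioo (0:ℝ) 1) => ⨅ (f : ℝ → ℂ) (g : ℝ → ℂ) (_ : Measurable f) (_ : Measurable g)
      (_ : f + g = bLine h y),
      ENNReal.ofReal (1 - y)⁻¹ * eLpNorm f p volume +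
        ENNReal.ofReal y⁻¹ * eLpNorm g q volume) (1 - y) hy')
  refine le_iInf fun f => le_iInf fun g => le_iInf fun hf => le_iInf fun hg => le_iInf fun hfg => ?_
  refine iInf_le_of_le (fun x => g (-x)) (iInf_le_of_le (fun x => f (-x)) (iInf_le_of_le (hg.comp measurable_neg)
    (iInf_le_of_le (hf.comp measurable_neg) (iInf_le_of_le ?_ ?_))))
  · ext x
    have := congrFun hfg (-x)
    rw [Pi.add_apply] at this ⊢
    unfold bLine at this ⊢
    rw [reflS_line, ← this, add_comm]
  · have e1 : eLpNorm (fun x => g (-x)) q volume = eLpNorm g q volume :=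
      eLpNorm_comp_measurePreserving hg.aestronglyMeasurable (Measure.measurePreserving_neg volume)
    have e2 : eLpNorm (fun x => f (-x)) p volume = eLpNorm f p volume :=
      eLpNorm_comp_measurePreserving hf.aestronglyMeasurable (Measure.measurePreserving_neg volume)
    rw [e1, e2, sub_sub_cancel, add_comm]

lemma MemHardy.reflM {p q : ℝ≥0∞} {h : ℂ → ℂ} (hh : MemHardy p q h) : MemHardy q p (reflS h) := by
  refine ⟨?_, (hardyNorm_reflS p q h).trans_lt hh.2⟩
  refine hh.1.comp (f := fun z => I - z) (by fun_prop) ?_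
  intro z hz
  simp only [Strip, mem_setOf_eq] at hz ⊢
  simp only [sub_im, I_im]
  exact ⟨by linarith [hz.2], by linarith [hz.1]⟩

lemma ClsG.reflG {G : ℂ → ℂ} {C : ℝ} (hG : ClsG G C) : ClsG (reflS G) C where
  hd := fun z h0 h1 => by
    have := hG.hd (I - z) (by simpa using h1) (by simpa using h0)
    exact DifferentiableAt.comp (f := fun z => I - z) z this (by fun_prop)
  hb := fun z h0 h1 => by
    have := hG.hb (I - z) (by simpa using h1) (by simpa using h0)
    simpa [wt_neg, reflS] using this

structure Traces (p q : ℝ≥0∞) (h : ℂ → ℂ) (h0 h1 : ℝ → ℂ) : Prop where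
  m0 : MemLp h0 p volume
  m1 : MemLp h1 q volume
  n0 : eLpNorm h0 p volume ≤ hardyNorm p q h
  n1 : eLpNorm h1 q volume ≤ hardyNorm p q h
  t0 : ∀ (φ : ℝ → ℂ) (C : ℝ), Continuous φ → (∀ x, ‖φ x‖ ≤ C * wt x ^ 2) →
        Tendsto (fun y : ℝ => ∫ x : ℝ, h (x + y * I) * φ x) (𝓝[>] 0) (𝓝 (∫ x, h0 x * φ x))
  t1 : ∀ (φ : ℝ → ℂ) (C : ℝ), Continuous φ → (∀ x, ‖φ x‖ ≤ C * wt x ^ 2) →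
        Tendsto (fun y : ℝ => ∫ x : ℝ, h (x + y * I) * φ x) (𝓝[<] 1) (𝓝 (∫ x, h1 x * φ x))
  g0 : ∀ G C, ClsG G C → ∀ y ∈ Ioo (0:ℝ) 1, ∫ x : ℝ, h0 x * G x = ∫ x : ℝ, h (x + y * I) * G (x + y * I)
  g1 : ∀ G C, ClsG G C → ∫ x : ℝ, h0 x * G x = ∫ x : ℝ, h1 x * G (x + I)

lemma MemHardy.traces {p q : ℝ≥0∞} (hp : 1 ≤ p) (hq : 1 ≤ q) {h : ℂ → ℂ} (hh : MemHardy p q h) :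
    ∃ h0 h1, Traces p q h h0 h1 := by
  obtain ⟨M, hA⟩ := hh.clsA hp hq
  obtain ⟨h0, m0, i0, t0, g0⟩ := hA.trace
  have n0 := trace_norm_le hp hq m0 i0 t0
  obtain ⟨M', hA'⟩ := hh.reflM.clsA hq hp
  obtain ⟨k, mk, ik, tk, gk⟩ := hA'.trace
  have nk := (trace_norm_le hq hp mk ik tk).trans (hardyNorm_reflS p q h)
  have e1 : eLpNorm (fun x => k (-x)) q volume = eLpNorm k q volume :=
      eLpNorm_comp_measurePreserving mk (Measure.measurePreserving_neg volume)
  have hhalf : (1/2:ℝ) ∈ Ioo (0:ℝ) 1 := by constructor <;> norm_num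
  refine ⟨h0, fun x => k (-x), ⟨m0, n0.trans_lt hh.2⟩,
    ⟨mk.comp_measurePreserving (Measure.measurePreserving_neg volume), ?_⟩, n0, ?_, t0, ?_, g0, ?_⟩
  · rw [e1]; exact nk.trans_lt hh.2
  · rw [e1]; exact nk
  · intro φ C hφ hb
    have h1 := tk (fun x => φ (-x)) C (by fun_prop) (fun x => by rw [← wt_neg]; exact hb (-x))
    have h2 : Tendsto (fun y : ℝ => 1 - y) (𝓝[<] 1) (𝓝[>] 0) := by
      refine tendsto_nhdsWithin_iff.2 ⟨?_, ?_⟩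
      · have : Continuous (fun y : ℝ => 1 - y) := by fun_prop
        have := this.tendsto 1
        rw [sub_self] at this
        exact this.mono_left nhdsWithin_le_nhds
      · filter_upwards [self_mem_nhdsWithin] with y hy
        simpa using hy
    have h3 := h1.comp h2
    have e2 : ∫ x, k x * φ (-x) = ∫ x, k (-x) * φ x := by
      rw [← integral_neg_eq_self]; simp
    rw [e2] at h3
    refine h3.congr fun y => ?_
    simp only [Function.comp]
    rw [← integral_neg_eq_self]
    congr 1; ext x
    rw [reflS_line]; simp
  · intro G C hG
    rw [g0 G C hG _ hhalf]
    have h1 := gk _ C hG.reflG _ hhalf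
    have e2 : ∫ x : ℝ, k x * reflS G x = ∫ x : ℝ, k (-x) * G (x + I) := by
      rw [← integral_neg_eq_self]
      congr 1; ext x
      unfold reflS
      push_cast
      congr 2; ring
    rw [← e2, h1, ← integral_neg_eq_self]
    congr 1; ext x
    rw [reflS_line, reflS_line]
    have : (1 - (1/2:ℝ)) = 1/2 := by norm_num
    rw [this]

lemma schwartz_bound (φ : SchwartzMap ℝ ℂ) : ∃ C, ∀ x, ‖(starRingEnd ℂ) (φ x)‖ ≤ C * wt x ^ 2 := by
  obtain ⟨C0, h0⟩ := φ.decay 0 0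
  obtain ⟨C2, h2⟩ := φ.decay 2 0
  obtain ⟨C4, h4⟩ := φ.decay 4 0
  refine ⟨C0 + 2 * C2 + C4, fun x => ?_⟩
  have a0 := h0.2 x
  have a2 := h2.2 x
  have a4 := h4.2 x
  simp only [norm_iteratedFDeriv_zero, Real.norm_eq_abs, pow_zero, one_mul] at a0 a2 a4
  have e4 : |x|^4 = x^4 := by rw [← abs_pow]; exact abs_of_nonneg (by positivity)
  rw [sq_abs] at a2
  rw [e4] at a4
  rw [RCLike.norm_conj, wt, inv_pow, ← div_eq_mul_inv, le_div_iff₀ (by positivity)]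
  nlinarith

lemma Traces.isTrace0 {p q : ℝ≥0∞} {h : ℂ → ℂ} {h0 h1 : ℝ → ℂ} (H : Traces p q h h0 h1) : IsTrace0 h h0 := by
  intro φ
  obtain ⟨C, hC⟩ := schwartz_bound φ
  exact H.t0 _ C (Complex.continuous_conj.comp φ.continuous) hC

lemma Traces.isTrace1 {p q : ℝ≥0∞} {h : ℂ → ℂ} {h0 h1 : ℝ → ℂ} (H : Traces p q h h0 h1) : IsTrace1 h h1 := by
  intro φ
  obtain ⟨C, hC⟩ := schwartz_bound φ
  exact H.t1 _ C (Complex.continuous_conj.comp φ.continuous) hC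

/-- Fourier-Laplace transform -/
def FL (ψ : ℝ → ℂ) (z : ℂ) : ℂ := ∫ k : ℝ, ψ k * Complex.exp (-(I * k * z))

lemma fInt_eq_FL (ψ : ℝ → ℂ) (x : ℝ) : fInt ψ x = FL ψ x := rfl

lemma norm_exp_FL (k : ℝ) (z : ℂ) : ‖Complex.exp (-(I * k * z))‖ = Real.exp (k * z.im) := by
  rw [Complex.norm_exp]; congr 1; simp

lemma exp_FL_le {k B : ℝ} {z : ℂ} (hz : |z.im| ≤ B) : ‖Complex.exp (-(I * k * z))‖ ≤ Real.exp (B * |k|) := by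
  rw [norm_exp_FL]
  refine Real.exp_le_exp.2 ?_
  calc k * z.im ≤ |k * z.im| := le_abs_self _
    _ = |z.im| * |k| := by rw [abs_mul, mul_comm]
    _ ≤ _ := mul_le_mul_of_nonneg_right hz (abs_nonneg _)

lemma integrable_FL_bound {ψ : ℝ → ℂ} (hψ : Continuous ψ) (hc : HasCompactSupport ψ) (B : ℝ) :
    Integrable (fun k => ‖ψ k‖ * Real.exp (B * |k|)) := by
  refine Continuous.integrable_of_hasCompactSupport (by fun_prop) ?_
  exact hc.norm.mul_right

lemma norm_FL_le {ψ : ℝ → ℂ} (hψ : Continuous ψ) (hc : HasCompactSupport ψ) {B : ℝ} {z : ℂ} (hz : |z.im| ≤ B) :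
    ‖FL ψ z‖ ≤ ∫ k, ‖ψ k‖ * Real.exp (B * |k|) := by
  refine norm_integral_le_of_norm_le (integrable_FL_bound hψ hc B) (Eventually.of_forall fun k => ?_)
  rw [norm_mul]
  exact mul_le_mul_of_nonneg_left (exp_FL_le hz) (norm_nonneg _)

lemma differentiable_FL {ψ : ℝ → ℂ} (hψ : Continuous ψ) (hc : HasCompactSupport ψ) : Differentiable ℂ (FL ψ) := by
  intro z
  refine differentiableAt_integral (R := 1) (b := fun k => ‖ψ k‖ * Real.exp ((|z.im| + 1) * |k|)) one_pos ?_ ?_ ?_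
    (integrable_FL_bound hψ hc _)
  · intro w _
    exact Continuous.aestronglyMeasurable (by fun_prop)
  · refine Eventually.of_forall fun k => ?_
    fun_prop
  · refine Eventually.of_forall fun k w hw => ?_
    rw [norm_mul]
    refine mul_le_mul_of_nonneg_left (exp_FL_le ?_) (norm_nonneg _)
    have h1 : |w.im - z.im| ≤ ‖w - z‖ := by
      rw [← sub_im]; exact abs_im_le_norm _
    rw [Metric.mem_ball, dist_eq_norm] at hw
    have := abs_sub_abs_le_abs_sub w.im z.im
    linarith

lemma FL_deriv {ψ : ℝ → ℂ} (hψ : ContDiff ℝ (⊤ : ℕ∞) ψ) (hc : HasCompactSupport ψ) (z : ℂ) :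
    I * z * FL ψ z = FL (deriv ψ) z := by
  have hd : ∀ k : ℝ, HasDerivAt (fun k : ℝ => Complex.exp (-(I * k * z))) (Complex.exp (-(I * k * z)) * (-(I * z))) k := by
    intro k
    have h1 : HasDerivAt (fun k : ℝ => -(I * (k:ℂ) * z)) (-(I * z)) k := by
      have := (((hasDerivAt_id k).ofReal_comp.const_mul I).mul_const z).fun_neg
      simpa using this
    exact h1.cexp
  have hψd : ∀ k, HasDerivAt ψ (deriv ψ k) k := fun k => (hψ.differentiable (by simp) k).hasDerivAt
  have hcd : Continuous (deriv ψ) := hψ.continuous_deriv (by simp)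
  have key := integral_mul_deriv_eq_deriv_mul_of_integrable (u := ψ) (v := fun k : ℝ => Complex.exp (-(I * k * z)))
    (u' := deriv ψ) (v' := fun k : ℝ => Complex.exp (-(I * k * z)) * (-(I * z))) (fun k _ => hψd k) (fun k _ => hd k) ?_ ?_ ?_
  · unfold FL
    rw [← neg_eq_iff_eq_neg] at key
    rw [← key, ← integral_const_mul, ← integral_neg]
    congr 1; ext k; ring
  · exact Continuous.integrable_of_hasCompactSupport (by have := hψ.continuous; fun_prop) hc.mul_right
  · exact Continuous.integrable_of_hasCompactSupport (by fun_prop) hc.deriv.mul_right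
  · exact Continuous.integrable_of_hasCompactSupport (by have := hψ.continuous; fun_prop) hc.mul_right

lemma contDiff_deriv_top {ψ : ℝ → ℂ} (hψ : ContDiff ℝ (⊤ : ℕ∞) ψ) : ContDiff ℝ (⊤ : ℕ∞) (deriv ψ) :=
  (contDiff_infty_iff_deriv.1 hψ).2

lemma FL_bound {ψ : ℝ → ℂ} (hψ : ContDiff ℝ (⊤ : ℕ∞) ψ) (hc : HasCompactSupport ψ) :
    ∃ C, 0 ≤ C ∧ ∀ z : ℂ, |z.im| ≤ 1 → ‖FL ψ z‖ ≤ C * wt z.re ^ 2 := by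
  have h1 := contDiff_deriv_top hψ
  have h2 := contDiff_deriv_top h1
  have h3 := contDiff_deriv_top h2
  have h4 := contDiff_deriv_top h3
  set C0 := ∫ k, ‖ψ k‖ * Real.exp (1 * |k|)
  set C2 := ∫ k, ‖deriv (deriv ψ) k‖ * Real.exp (1 * |k|)
  set C4 := ∫ k, ‖deriv (deriv (deriv (deriv ψ))) k‖ * Real.exp (1 * |k|)
  have p0 : 0 ≤ C0 := integral_nonneg fun k => by positivity
  have p2 : 0 ≤ C2 := integral_nonneg fun k => by positivity
  have p4 : 0 ≤ C4 := integral_nonneg fun k => by positivity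
  refine ⟨C0 + 2 * C2 + C4, by positivity, fun z hz => ?_⟩
  have b0 : ‖FL ψ z‖ ≤ C0 := norm_FL_le hψ.continuous hc hz
  have b2 : ‖FL _ z‖ ≤ C2 := norm_FL_le h2.continuous hc.deriv.deriv hz
  have b4 : ‖FL _ z‖ ≤ C4 := norm_FL_le h4.continuous hc.deriv.deriv.deriv.deriv hz
  rw [← FL_deriv h3 hc.deriv.deriv.deriv, ← FL_deriv h2 hc.deriv.deriv, ← FL_deriv h1 hc.deriv, ← FL_deriv hψ hc] at b4
  rw [← FL_deriv h1 hc.deriv, ← FL_deriv hψ hc] at b2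
  simp only [norm_mul, norm_I, one_mul] at b2 b4
  have hr := abs_re_le_norm z
  have hr2 : z.re ^ 2 ≤ ‖z‖ ^ 2 := by rw [← sq_abs]; gcongr
  have hr4 : z.re ^ 4 ≤ ‖z‖ ^ 4 := by nlinarith [sq_nonneg z.re]
  rw [wt, inv_pow, ← div_eq_mul_inv, le_div_iff₀ (by positivity)]
  have e : (1 + z.re^2)^2 = 1 + 2 * z.re^2 + z.re^4 := by ring
  rw [e]
  have n := norm_nonneg (FL ψ z)
  nlinarith [mul_le_mul_of_nonneg_right hr2 n, mul_le_mul_of_nonneg_right hr4 n]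

lemma clsG_FL {ψ : ℝ → ℂ} (hψ : ContDiff ℝ (⊤ : ℕ∞) ψ) (hc : HasCompactSupport ψ) : ∃ C, ClsG (FL ψ) C := by
  obtain ⟨C, h0, hC⟩ := FL_bound hψ hc
  refine ⟨C, fun z _ _ => differentiable_FL hψ.continuous hc z, fun z h0 h1 => hC z ?_⟩
  rw [abs_of_nonneg h0]; exact h1

lemma contDiff_expmul {φ : ℝ → ℂ} (hφ : ContDiff ℝ (⊤ : ℕ∞) φ) :
    ContDiff ℝ (⊤ : ℕ∞) (fun k : ℝ => (Real.exp (-k) : ℂ) * φ k) := by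
  refine ContDiff.mul ?_ hφ
  exact ofRealCLM.contDiff.comp (Real.contDiff_exp.comp contDiff_neg)

lemma FL_expmul (φ : ℝ → ℂ) (z : ℂ) : FL (fun k : ℝ => (Real.exp (-k) : ℂ) * φ k) z = FL φ (z - I) := by
  unfold FL
  congr 1; ext k
  have : -(I * k * (z - I)) = -(k:ℂ) + -(I * k * z) := by
    linear_combination (k:ℂ) * I_mul_I
  rw [this, Complex.exp_add]; push_cast; ring

lemma Traces.fre {p q : ℝ≥0∞} {h : ℂ → ℂ} {h0 h1 : ℝ → ℂ} (H : Traces p q h h0 h1) : FourierRelExp h0 h1 := by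
  intro φ hφ hc
  obtain ⟨C, hG⟩ := clsG_FL (contDiff_expmul hφ) hc.mul_left
  have := H.g1 _ C hG
  simp only [fInt_eq_FL]
  rw [this]
  congr 1; ext x
  rw [FL_expmul]; simp

section FTpart
open scoped FourierTransform

lemma ClsG.int_eq {G : ℂ → ℂ} {C : ℝ} (hG : ClsG G C) : ∫ x : ℝ, G x = ∫ x : ℝ, G (x + I) := by
  have hb : ∀ y ∈ Icc (0:ℝ) 1, ∀ x : ℝ, ‖G (x + y * I)‖ ≤ C * wt x := fun y hy x =>
    le_wt_of_sq hG.nonneg (hG.bound_line hy)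
  have hi : ∀ y ∈ Icc (0:ℝ) 1, Integrable (fun x : ℝ => G (x + y * I)) := fun y hy =>
    (integrable_wt.const_mul C).mono' (hG.continuous_line hy).aestronglyMeasurable
      (Eventually.of_forall fun x => hb y hy x)
  have := shift (Φ := G) (a := 0) (b := 1) (M := ∫ x, C * wt x) zero_le_one hG.hd hi
    (fun y hy => integral_mono (hi y hy).norm (integrable_wt.const_mul C) (fun x => hb y hy x))
  simpa using this

lemma exists_FL_int : ∃ ψ : ℝ → ℂ, ContDiff ℝ (⊤ : ℕ∞) ψ ∧ HasCompactSupport ψ ∧ ∫ x : ℝ, FL ψ x ≠ 0 := by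
  let f : ContDiffBump (0:ℝ) := ⟨1, 2, one_pos, one_lt_two⟩
  set ψ : ℝ → ℂ := fun k => (f k : ℂ) with hψd
  have hψ : ContDiff ℝ (⊤ : ℕ∞) ψ := ofRealCLM.contDiff.comp f.contDiff
  have hc : HasCompactSupport ψ := f.hasCompactSupport.comp_left (g := ((↑) : ℝ → ℂ)) (by simp)
  refine ⟨ψ, hψ, hc, fun h0 => ?_⟩
  have hF : ∀ ξ : ℝ, 𝓕 ψ ξ = FL ψ ((2 * π * ξ : ℝ) : ℂ) := by
    intro ξ
    rw [Real.fourier_real_eq_integral_exp_smul]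
    unfold FL
    congr 1; ext k
    rw [smul_eq_mul, mul_comm]
    congr 2; push_cast; ring
  obtain ⟨C, hG⟩ := clsG_FL hψ hc
  have hcont := hG.continuous0
  have hintg : Integrable (fun x : ℝ => FL ψ x) := (integrable_wt.const_mul C).mono' hcont.aestronglyMeasurable
      (Eventually.of_forall fun x => le_wt_of_sq hG.nonneg (hG.bound0 x))
  have e : 𝓕 ψ = fun ξ : ℝ => FL ψ ((2 * π * ξ : ℝ) : ℂ) := funext hF
  have hi2 : Integrable (𝓕 ψ) := by
    rw [e]
    exact hintg.comp_mul_left' (R := 2 * π) (by positivity)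
  have h1 := (hψ.continuous.integrable_of_hasCompactSupport hc).fourierInv_fourier_eq hi2 (v := 0)
    hψ.continuous.continuousAt
  rw [Real.fourierInv_eq'] at h1
  have h2 : ∫ ξ : ℝ, FL ψ ((2 * π * ξ : ℝ) : ℂ) = 0 := by
    rw [Measure.integral_comp_mul_left (fun x : ℝ => FL ψ x), h0, smul_zero]
  rw [e] at h1
  simp only [inner_zero_right, mul_zero, ofReal_zero, zero_mul, Complex.exp_zero, one_smul] at h1
  rw [h2] at h1
  have : ψ 0 = 1 := by
    simp only [hψd]
    rw [f.one_of_mem_closedBall (by simp [f])]; simp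
  rw [this] at h1
  exact zero_ne_one h1

lemma swap_conv {w F g : ℝ → ℂ} {C D : ℝ} (hw : Integrable (fun x => ‖w x‖ * wt x)) (hwm : AEStronglyMeasurable w volume)
    (hF : Continuous F) (hFb : ∀ x, ‖F x‖ ≤ C * wt x ^ 2) (hg : Continuous g) (hgb : ∀ x, ‖g x‖ ≤ D * wt x ^ 2) :
    ∫ t, w t * ∫ s, F (t - s) * g s = ∫ s, (∫ t, w t * F (t - s)) * g s := by
  have hC : 0 ≤ C := by
    have := (norm_nonneg _).trans (hFb 0); have h2 := wt_pos 0
    by_contra h; push Not at h; nlinarith [mul_pos_of_neg_of_neg h (neg_neg_of_pos (pow_pos h2 2))]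
  have hD : 0 ≤ D := by
    have := (norm_nonneg _).trans (hgb 0); have h2 := wt_pos 0
    by_contra h; push Not at h; nlinarith [mul_pos_of_neg_of_neg h (neg_neg_of_pos (pow_pos h2 2))]
  have hintg : Integrable (Function.uncurry fun t s => w t * (F (t - s) * g s)) (volume.prod volume) := by
    have hbd : Integrable (fun p : ℝ × ℝ => (C * D * 2) * ((‖w p.1‖ * wt p.1) * wt p.2)) (volume.prod volume) :=
      (hw.mul_prod integrable_wt).const_mul _
    refine hbd.mono' ?_ (Eventually.of_forall fun p => ?_)
    · refine AEStronglyMeasurable.mul (f := fun p : ℝ × ℝ => w p.1) hwm.comp_fst ?_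
      exact Continuous.aestronglyMeasurable (by fun_prop)
    · obtain ⟨t, s⟩ := p
      simp only [Function.uncurry, norm_mul]
      have h1 := le_wt_of_sq hC (hFb (t - s))
      have h2 := hgb s
      have h3 := wt_mul_le s t
      have p1 := wt_pos s
      have p2 := wt_pos (t - s)
      calc ‖w t‖ * (‖F (t - s)‖ * ‖g s‖) ≤ ‖w t‖ * ((C * wt (t - s)) * (D * wt s ^ 2)) := by gcongr
        _ = C * D * ‖w t‖ * wt s * (wt s * wt (t - s)) := by ring
        _ ≤ C * D * ‖w t‖ * wt s * (2 * wt t) := by gcongr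
        _ = _ := by ring
  have h1 : ∀ t, w t * ∫ s, F (t - s) * g s = ∫ s, w t * (F (t - s) * g s) := fun t => (integral_const_mul _ _).symm
  have h2 : ∀ s, (∫ t, w t * F (t - s)) * g s = ∫ t, w t * (F (t - s) * g s) := fun s => by
    rw [← integral_mul_const]; congr 1; ext t; ring
  simp_rw [h1, h2]
  exact integral_integral_swap hintg

lemma fre_conv {v w : ℝ → ℂ} (hv : Integrable (fun x => ‖v x‖ * wt x)) (hvm : AEStronglyMeasurable v volume)
    (hw : Integrable (fun x => ‖w x‖ * wt x)) (hwm : AEStronglyMeasurable w volume)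
    (hF : FourierRelExp v w) {G : ℂ → ℂ} {D : ℝ} (hG : ClsG G D) {ψ : ℝ → ℂ} (hψ : ContDiff ℝ (⊤ : ℕ∞) ψ)
    (hc : HasCompactSupport ψ) :
    ∫ t : ℝ, w t * ∫ s : ℝ, FL ψ (t - s : ℝ) * G (s + I) = ∫ t : ℝ, v t * ∫ s : ℝ, FL ψ (t - s : ℝ) * G s := by
  obtain ⟨C, hC0, hC⟩ := FL_bound hψ hc
  have hdiff := differentiable_FL hψ.continuous hc
  have hcF := hdiff.continuous
  have hG1c : Continuous (fun s : ℝ => G (s + I)) := by simpa using hG.continuous_line (y := 1) (by simp)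
  have hG1b : ∀ s : ℝ, ‖G (s + I)‖ ≤ D * wt s ^ 2 := fun s => by simpa using hG.bound_line (y := 1) (x := s) (by simp)
  rw [swap_conv (F := fun x : ℝ => FL ψ x) (C := C) hw hwm (by fun_prop) (fun x => by simpa using hC x (by simp)) hG1c hG1b]
  have hinner : ∀ t : ℝ, ∫ s : ℝ, FL ψ (t - s : ℝ) * G s = ∫ s : ℝ, FL ψ ((t - s : ℝ) - I) * G (s + I) := by
    intro t
    have hcl := (hG.mul_bdd (F := fun z => FL ψ (t - z)) (B := C) (fun z _ _ => by
      exact DifferentiableAt.comp (f := fun z => (t:ℂ) - z) z (hdiff _) (by fun_prop)) (fun z h0 h1 => by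
      refine (hC _ (by simp [abs_of_nonneg h0, h1])).trans ?_
      have h3 := wt_pos ((t:ℂ) - z).re
      have h4 := wt_le_one ((t:ℂ) - z).re
      have : wt ((t:ℂ) - z).re ^ 2 ≤ 1 := pow_le_one₀ h3.le h4
      nlinarith)).int_eq
    push_cast
    simp only [sub_sub]
    exact hcl
  simp_rw [hinner]
  rw [swap_conv (F := fun x : ℝ => FL ψ (x - I)) (C := C) hv hvm (by fun_prop) (fun x => by simpa using hC (x - I) (by simp))
    hG1c hG1b]
  congr 1; ext s
  congr 1
  have hh := hF (fun k => ψ k * Complex.exp (I * k * s)) (hψ.mul (by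
    have : ContDiff ℝ (⊤ : ℕ∞) (fun k : ℝ => I * (k:ℂ) * s) :=
      (contDiff_const.mul (ofRealCLM.contDiff)).mul contDiff_const
    exact this.cexp)) hc.mul_right
  have e1 : ∀ t : ℝ, fInt (fun k => ψ k * Complex.exp (I * k * s)) t = FL ψ (t - s : ℝ) := by
    intro t; unfold fInt FL
    congr 1; ext k
    rw [mul_assoc, ← Complex.exp_add]; congr 2; push_cast; ring
  have e2 : ∀ t : ℝ, fInt (fun k => (Real.exp (-k):ℂ) * (ψ k * Complex.exp (I * k * s))) t = FL ψ ((t - s : ℝ) - I) := by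
    intro t; rw [fInt_eq_FL, FL_expmul]
    unfold FL
    congr 1; ext k
    rw [mul_assoc, ← Complex.exp_add]; congr 2; push_cast; ring
  simp_rw [e1, e2] at hh
  exact hh

lemma FL_scale (ψ : ℝ → ℂ) {a : ℝ} (ha : 0 < a) (z : ℂ) : FL (fun k => ψ (a⁻¹ * k)) z = a * FL ψ (a * z) := by
  unfold FL
  have := Measure.integral_comp_mul_left (fun k : ℝ => ψ k * Complex.exp (-(I * k * (a * z)))) a⁻¹
  rw [inv_inv, abs_of_pos ha] at this
  have h2 : (a : ℂ) * ∫ k : ℝ, ψ k * Complex.exp (-(I * k * (a * z))) = a • ∫ k : ℝ, ψ k * Complex.exp (-(I * k * (a * z))) := rfl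
  rw [h2, ← this]
  congr 1; ext k
  congr 3
  have : (a:ℂ) ≠ 0 := by exact_mod_cast ha.ne'
  push_cast; field_simp

lemma conv_scale {χ g : ℝ → ℂ} {a : ℝ} (ha : 0 < a) (t : ℝ) :
    ∫ s : ℝ, (a * χ (a * (t - s))) * g s = ∫ r : ℝ, χ r * g (t - a⁻¹ * r) := by
  have h1 := integral_sub_left_eq_self (fun u : ℝ => (a * χ (a * u)) * g (t - u)) volume t
  simp only [sub_sub_cancel] at h1
  rw [h1]
  have h2 := Measure.integral_comp_mul_left (fun r : ℝ => χ r * g (t - a⁻¹ * r)) a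
  have h3 : ∫ r : ℝ, χ r * g (t - a⁻¹ * r) = a • ∫ r : ℝ, χ (a * r) * g (t - a⁻¹ * (a * r)) := by
    rw [h2, abs_of_pos (by positivity), smul_smul, mul_inv_cancel₀ ha.ne', one_smul]
  rw [h3, ← integral_smul]
  congr 1; ext r
  rw [inv_mul_cancel_left₀ ha.ne', real_smul, mul_assoc]

lemma conv_limit {v χ g : ℝ → ℂ} {C D : ℝ} (hv : Integrable (fun x => ‖v x‖ * wt x)) (hvm : AEStronglyMeasurable v volume)
    (hχ : Continuous χ) (hχb : ∀ x, ‖χ x‖ ≤ C * wt x ^ 2) (hg : Continuous g) (hgb : ∀ x, ‖g x‖ ≤ D * wt x ^ 2) (hC : 0 ≤ C) (hD : 0 ≤ D) :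
    Tendsto (fun n : ℕ => ∫ t, v t * ∫ r, χ r * g (t - ((n:ℝ) + 1)⁻¹ * r)) atTop
      (𝓝 (∫ t, v t * ((∫ r, χ r) * g t))) := by
  have hpt : ∀ (n : ℕ) (t r : ℝ), ‖χ r * g (t - ((n:ℝ) + 1)⁻¹ * r)‖ ≤ 2 * C * D * wt t * wt r := by
    intro n t r
    rw [norm_mul]
    have h1 := hχb r
    have h2 := le_wt_of_sq hD (hgb (t - ((n:ℝ) + 1)⁻¹ * r))
    have h3 := wt_mul_le (((n:ℝ) + 1)⁻¹ * r) t
    have h4 : wt r ≤ wt (((n:ℝ) + 1)⁻¹ * r) := by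
      unfold wt
      refine inv_anti₀ (by positivity) ?_
      have : ((n:ℝ) + 1)⁻¹ ^ 2 ≤ 1 := by
        refine pow_le_one₀ (by positivity) (inv_le_one_of_one_le₀ ?_)
        have : (0:ℝ) ≤ n := Nat.cast_nonneg n
        linarith
      rw [mul_pow]
      nlinarith [sq_nonneg r]
    have p1 := wt_pos r
    have p2 := wt_pos (t - ((n:ℝ) + 1)⁻¹ * r)
    calc ‖χ r‖ * ‖g (t - ((n:ℝ) + 1)⁻¹ * r)‖ ≤ (C * wt r ^ 2) * (D * wt (t - ((n:ℝ) + 1)⁻¹ * r)) := by gcongr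
      _ = C * D * wt r * (wt r * wt (t - ((n:ℝ) + 1)⁻¹ * r)) := by ring
      _ ≤ C * D * wt r * (wt (((n:ℝ) + 1)⁻¹ * r) * wt (t - ((n:ℝ) + 1)⁻¹ * r)) := by gcongr
      _ ≤ C * D * wt r * (2 * wt t) := by gcongr
      _ = _ := by ring
  have hbi : ∀ t, Integrable (fun r => 2 * C * D * wt t * wt r) := fun t => integrable_wt.const_mul _
  have hcont : ∀ n : ℕ, Continuous fun t => ∫ r, χ r * g (t - ((n:ℝ) + 1)⁻¹ * r) := by
    intro n
    refine continuous_of_dominated (bound := fun r => 2 * C * D * wt r) (fun t => ?_) (fun t => ?_)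
      (integrable_wt.const_mul _) ?_
    · exact Continuous.aestronglyMeasurable (by fun_prop)
    · refine Eventually.of_forall fun r => (hpt n t r).trans ?_
      have := wt_le_one t
      have := wt_pos r
      have : 2 * C * D * wt t ≤ 2 * C * D * 1 := by gcongr
      nlinarith
    · exact Eventually.of_forall fun r => by fun_prop
  refine tendsto_integral_of_dominated_convergence (fun t => (2 * C * D * ∫ r, wt r) * (‖v t‖ * wt t))
    (fun n => hvm.mul (hcont n).aestronglyMeasurable) (hv.const_mul _) (fun n => Eventually.of_forall fun t => ?_)
    (Eventually.of_forall fun t => ?_)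
  · rw [norm_mul]
    have : ‖∫ r, χ r * g (t - ((n:ℝ) + 1)⁻¹ * r)‖ ≤ 2 * C * D * wt t * ∫ r, wt r := by
      rw [← integral_const_mul]
      exact norm_integral_le_of_norm_le (hbi t) (Eventually.of_forall fun r => hpt n t r)
    calc ‖v t‖ * ‖∫ r, χ r * g (t - ((n:ℝ) + 1)⁻¹ * r)‖ ≤ ‖v t‖ * (2 * C * D * wt t * ∫ r, wt r) := by gcongr
      _ = _ := by ring
  · refine Tendsto.const_mul _ ?_
    rw [← integral_mul_const]
    refine tendsto_integral_of_dominated_convergence (fun r => 2 * C * D * wt t * wt r)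
      (fun n => Continuous.aestronglyMeasurable (by fun_prop)) (hbi t) (fun n => Eventually.of_forall fun r => hpt n t r)
      (Eventually.of_forall fun r => ?_)
    refine Tendsto.const_mul _ ?_
    have h1 : Tendsto (fun n : ℕ => t - ((n:ℝ) + 1)⁻¹ * r) atTop (𝓝 (t - 0 * r)) := by
      refine Tendsto.const_sub _ (Tendsto.mul_const _ ?_)
      simpa using tendsto_one_div_add_atTop_nhds_zero_nat (𝕜 := ℝ)
    rw [zero_mul, sub_zero] at h1
    exact (hg.tendsto t).comp h1

lemma fre_clsG {v w : ℝ → ℂ} (hv : Integrable (fun x => ‖v x‖ * wt x)) (hvm : AEStronglyMeasurable v volume)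
    (hw : Integrable (fun x => ‖w x‖ * wt x)) (hwm : AEStronglyMeasurable w volume)
    (hF : FourierRelExp v w) {G : ℂ → ℂ} {D : ℝ} (hG : ClsG G D) :
    ∫ t : ℝ, w t * G (t + I) = ∫ t : ℝ, v t * G t := by
  obtain ⟨ψ, hψ, hc, hne⟩ := exists_FL_int
  obtain ⟨C, hCG⟩ := clsG_FL hψ hc
  have hG1c : Continuous (fun s : ℝ => G (s + I)) := by simpa using hG.continuous_line (y := 1) (by simp)
  have hG1b : ∀ s : ℝ, ‖G (s + I)‖ ≤ D * wt s ^ 2 := fun s => by simpa using hG.bound_line (y := 1) (x := s) (by simp)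
  have L1 := conv_limit hw hwm hCG.continuous0 hCG.bound0 hG1c hG1b hCG.nonneg hG.nonneg
  have L0 := conv_limit hv hvm hCG.continuous0 hCG.bound0 hG.continuous0 hG.bound0 hCG.nonneg hG.nonneg
  have heq : ∀ n : ℕ, ∫ t : ℝ, w t * ∫ r : ℝ, FL ψ r * G ((t - ((n:ℝ) + 1)⁻¹ * r : ℝ) + I)
      = ∫ t : ℝ, v t * ∫ r : ℝ, FL ψ r * G ((t - ((n:ℝ) + 1)⁻¹ * r : ℝ)) := by
    intro n
    have hn : (0:ℝ) < (n:ℝ) + 1 := by positivity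
    have hψn : ContDiff ℝ (⊤ : ℕ∞) (fun k => ψ (((n:ℝ) + 1)⁻¹ * k)) := hψ.comp (contDiff_const.mul contDiff_id)
    have hcn : HasCompactSupport (fun k => ψ (((n:ℝ) + 1)⁻¹ * k)) :=
      hc.comp_homeomorph (Homeomorph.mulLeft₀ (((n:ℝ) + 1)⁻¹) (by positivity))
    have := fre_conv hv hvm hw hwm hF hG hψn hcn
    simp_rw [FL_scale ψ hn] at this
    have c1 := fun t => conv_scale (χ := fun x : ℝ => FL ψ x) (g := fun s : ℝ => G (s + I)) hn t
    have c0 := fun t => conv_scale (χ := fun x : ℝ => FL ψ x) (g := fun s : ℝ => G s) hn t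
    simp_rw [← c1, ← c0]
    push_cast at this ⊢
    exact this
  have := tendsto_nhds_unique (L1.congr heq) L0
  have r : ∀ (u g : ℝ → ℂ), ∫ t, u t * ((∫ r : ℝ, FL ψ r) * g t) = (∫ r : ℝ, FL ψ r) * ∫ t, u t * g t := by
    intro u g
    rw [← integral_const_mul]; congr 1; ext t; ring
  rw [r, r] at this
  exact mul_left_cancel₀ hne this

end FTpart

lemma trace0_ae_eq {p : ℝ≥0∞} (hp : 1 ≤ p) {h : ℂ → ℂ} {v v' : ℝ → ℂ} (hv : MemLp v p volume) (hv' : MemLp v' p volume)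
    (t : IsTrace0 h v) (t' : IsTrace0 h v') : v =ᵐ[volume] v' := by
  refine ae_eq_of_integral_contDiff_smul_eq (hv.locallyIntegrable hp) (hv'.locallyIntegrable hp) ?_
  intro g hg hc
  have hg' : ContDiff ℝ (⊤ : ℕ∞) (fun x => (g x : ℂ)) := ofRealCLM.contDiff.comp hg
  have hc' : HasCompactSupport (fun x => (g x : ℂ)) := hc.comp_left (g := ((↑) : ℝ → ℂ)) (by simp)
  have := tendsto_nhds_unique (t (hc'.toSchwartzMap hg')) (t' (hc'.toSchwartzMap hg'))
  simp only [HasCompactSupport.toSchwartzMap_toFun, conj_ofReal] at this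
  simpa [mul_comm] using this

lemma gau_line (ξ x y : ℝ) : gau ξ (x + y * I) =
    Complex.exp (y ^ 2 + 2 * π * ξ * y) * (Complex.exp (-(2 * x * y * I)) * gau ξ x) := by
  unfold gau
  rw [← Complex.exp_add, ← Complex.exp_add, ← Complex.exp_add, ← Complex.exp_add]
  congr 1
  linear_combination (-(y:ℂ)^2 - 2 * π * ξ * y) * I_sq

lemma unique_of_trace0 {p q : ℝ≥0∞} (hp : 1 ≤ p) (hq : 1 ≤ q) {h h' : ℂ → ℂ} {v : ℝ → ℂ} (hv : MemLp v p volume)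
    (hh : MemHardy p q h) (hh' : MemHardy p q h') (t : IsTrace0 h v) (t' : IsTrace0 h' v) :
    ∀ z ∈ Strip, h' z = h z := by
  obtain ⟨a0, a1, A⟩ := hh.traces hp hq
  obtain ⟨b0, b1, B⟩ := hh'.traces hp hq
  have ea := trace0_ae_eq hp A.m0 hv A.isTrace0 t
  have eb := trace0_ae_eq hp B.m0 hv B.isTrace0 t'
  have eab : a0 =ᵐ[volume] b0 := ea.trans eb.symm
  obtain ⟨M, hM⟩ := hh.clsA hp hq
  obtain ⟨M', hM'⟩ := hh'.clsA hp hq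
  intro z hz
  have hy : z.im ∈ Ioo (0:ℝ) 1 := hz
  set y := z.im with hyd
  have c := continuous_line hh.1 hy
  have c' := continuous_line hh'.1 hy
  set k : ℝ → ℂ := fun x => (h' (x + y * I) - h (x + y * I)) * Complex.exp (-(2 * x * y * I)) with hk
  have ck : Continuous k := by
    exact (c'.sub c).mul (by fun_prop)
  have hn : ∀ x : ℝ, ‖Complex.exp (-(2 * x * y * I))‖ = 1 := by
    intro x; rw [Complex.norm_exp]; simp
  have hae := ae_zero_of_gau (μ := volume) (k := k) ck.aestronglyMeasurable ?_ ?_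
  · have : k = 0 := (Continuous.ae_eq_iff_eq volume ck continuous_const).1 hae
    have := congrFun this z.re
    simp only [hk, Pi.zero_apply, mul_eq_zero, Complex.exp_ne_zero, or_false, hyd, re_add_im] at this
    exact sub_eq_zero.1 this
  · refine ((hM'.hi y hy).add (hM.hi y hy)).mono' (ck.norm.mul continuous_wt).aestronglyMeasurable
      (Eventually.of_forall fun x => ?_)
    have pw := wt_pos x
    simp only [hk, norm_mul, hn, mul_one, norm_norm, Real.norm_of_nonneg pw.le, Pi.add_apply]
    rw [← add_mul]
    gcongr
    exact norm_sub_le _ _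
  · intro ξ
    have g := clsG_gau ξ
    have h1 := A.g0 _ _ g y hy
    have h2 := B.g0 _ _ g y hy
    have h3 : ∫ x : ℝ, a0 x * gau ξ x = ∫ x : ℝ, b0 x * gau ξ x :=
      integral_congr_ae (eab.mono fun x hx => by simp only [hx])
    have hyc := Ioo_subset_Icc_self hy
    have i1 : Integrable (fun x : ℝ => h (x + y * I) * gau ξ (x + y * I)) :=
      integrable_mul_of_wt (hM.hi y hy) c.aestronglyMeasurable (g.continuous_line hyc).aestronglyMeasurable
        (fun x => le_wt_of_sq g.nonneg (g.bound_line hyc))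
    have i2 : Integrable (fun x : ℝ => h' (x + y * I) * gau ξ (x + y * I)) :=
      integrable_mul_of_wt (hM'.hi y hy) c'.aestronglyMeasurable (g.continuous_line hyc).aestronglyMeasurable
        (fun x => le_wt_of_sq g.nonneg (g.bound_line hyc))
    have h4 : ∫ x : ℝ, (h' (x + y * I) * gau ξ (x + y * I) - h (x + y * I) * gau ξ (x + y * I)) = 0 := by
      rw [integral_sub i2 i1, ← h1, ← h2, h3, sub_self]
    have h5 : ∫ x : ℝ, (h' (x + y * I) * gau ξ (x + y * I) - h (x + y * I) * gau ξ (x + y * I))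
        = Complex.exp (y ^ 2 + 2 * π * ξ * y) * ∫ x : ℝ, k x * gau ξ x := by
      rw [← integral_const_mul]
      congr 1; ext x
      rw [gau_line]; simp only [hk]; ring
    rw [h5] at h4
    exact (mul_eq_zero.1 h4).resolve_left (Complex.exp_ne_zero _)

/-- Poisson kernel of the strip -/
def PK (y u : ℝ) : ℝ := Real.sin (π * y) / (2 * (Real.cosh (π * u) - Real.cos (π * y)))

lemma cosh_sub_one_ge (u : ℝ) : u ^ 2 * (1 + u ^ 2) ≤ Real.cosh (π * u) - 1 := by
  set r := π * u / 4 with hr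
  have h0 : π * u = 2 * (2 * r) := by rw [hr]; ring
  have h1 : Real.cosh (π * u) - 1 = 8 * Real.sinh r ^ 2 * (1 + Real.sinh r ^ 2) := by
    rw [h0, Real.cosh_two_mul, Real.cosh_sq, Real.sinh_two_mul]
    have := Real.cosh_sq r
    rw [mul_pow, mul_pow, this]; ring
  have h2 : r ^ 2 ≤ Real.sinh r ^ 2 := by
    rcases le_total 0 r with h | h
    · have := Real.self_le_sinh_iff.2 h
      gcongr
    · have := Real.sinh_le_self_iff.2 h
      nlinarith
  have h3 : 9 * u ^ 2 ≤ 16 * r ^ 2 := by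
    have : 16 * r ^ 2 = π ^ 2 * u ^ 2 := by rw [hr]; ring
    rw [this]
    have := Real.pi_gt_three
    gcongr
    nlinarith
  rw [h1]
  have e : 8 * r ^ 2 * (1 + r ^ 2) ≤ 8 * Real.sinh r ^ 2 * (1 + Real.sinh r ^ 2) := by gcongr
  nlinarith [sq_nonneg u, sq_nonneg r, mul_nonneg (sq_nonneg u) (sq_nonneg u)]

lemma cos_lt_one' {y : ℝ} (hy : y ∈ Ioo (0:ℝ) 1) : Real.cos (π * y) < 1 := by
  have hp := Real.pi_pos
  rw [← Real.cos_zero]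
  exact Real.cos_lt_cos_of_nonneg_of_le_pi le_rfl (by nlinarith [hy.2]) (mul_pos hp hy.1)

lemma sin_pos' {y : ℝ} (hy : y ∈ Ioo (0:ℝ) 1) : 0 < Real.sin (π * y) :=
  Real.sin_pos_of_pos_of_lt_pi (mul_pos Real.pi_pos hy.1) (by nlinarith [Real.pi_pos, hy.2])

lemma PK_den_pos {y : ℝ} (hy : y ∈ Ioo (0:ℝ) 1) (u : ℝ) : 0 < Real.cosh (π * u) - Real.cos (π * y) := by
  have := Real.one_le_cosh (π * u)
  have := cos_lt_one' hy
  linarith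

lemma PK_nonneg {y : ℝ} (hy : y ∈ Ioo (0:ℝ) 1) (u : ℝ) : 0 ≤ PK y u :=
  div_nonneg (sin_pos' hy).le (mul_nonneg zero_le_two (PK_den_pos hy u).le)

lemma PK_continuous {y : ℝ} (hy : y ∈ Ioo (0:ℝ) 1) : Continuous (PK y) := by
  unfold PK
  refine Continuous.div continuous_const ?_ (fun u => ?_)
  · have := Real.continuous_cosh
    fun_prop
  · exact (mul_pos two_pos (PK_den_pos hy u)).ne'

lemma PK_bound {y : ℝ} (hy : y ∈ Ioo (0:ℝ) 1) : ∃ C, ∀ u, PK y u ≤ C * wt u ^ 2 := by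
  set δ := 1 - Real.cos (π * y) with hδ
  have hδ0 : 0 < δ := by have := cos_lt_one' hy; linarith
  have hδ2 : δ ≤ 2 := by have := Real.neg_one_le_cos (π * y); linarith
  refine ⟨Real.sin (π * y) * (2 / δ), fun u => ?_⟩
  have h1 := cosh_sub_one_ge u
  have h2 : δ / 4 * (1 + u ^ 2) ^ 2 ≤ Real.cosh (π * u) - Real.cos (π * y) := by
    have : Real.cosh (π * u) - Real.cos (π * y) = (Real.cosh (π * u) - 1) + δ := by rw [hδ]; ring
    rw [this]
    nlinarith [sq_nonneg u, mul_nonneg (sq_nonneg u) (sq_nonneg u)]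
  unfold PK
  rw [div_eq_mul_inv, mul_assoc]
  refine mul_le_mul_of_nonneg_left ?_ (sin_pos' hy).le
  calc (2 * (Real.cosh (π * u) - Real.cos (π * y)))⁻¹ ≤ (2 * (δ / 4 * (1 + u ^ 2) ^ 2))⁻¹ := by
        refine inv_anti₀ (by positivity) (by linarith)
    _ = 2 / δ * wt u ^ 2 := by unfold wt; field_simp; norm_num

lemma PK_integrable {y : ℝ} (hy : y ∈ Ioo (0:ℝ) 1) : Integrable (PK y) := by
  obtain ⟨C, hC⟩ := PK_bound hy
  have hi : Integrable (fun u => wt u ^ 2) := integrable_wt.mono' (by have := continuous_wt; fun_prop)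
    (Eventually.of_forall fun u => by rw [Real.norm_of_nonneg (by positivity)]; exact wt_sq_le u)
  exact (hi.const_mul C).mono' (PK_continuous hy).aestronglyMeasurable
    (Eventually.of_forall fun u => by rw [Real.norm_of_nonneg (PK_nonneg hy u)]; exact hC u)

lemma PK_sq_le {y : ℝ} (hy : y ∈ Ioo (0:ℝ) 1) (u : ℝ) : u ^ 2 * PK y u ≤ Real.sin (π * y) * wt u := by
  have h1 := cosh_sub_one_ge u
  have h2 := cos_lt_one' hy
  have h3 := PK_den_pos hy u
  have h4 := sin_pos' hy
  unfold PK wt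
  rw [← div_eq_mul_inv, ← mul_div_assoc, div_le_div_iff₀ (by positivity) (by positivity)]
  have : u ^ 2 * (1 + u ^ 2) ≤ 2 * (Real.cosh (π * u) - Real.cos (π * y)) := by nlinarith [sq_nonneg u]
  nlinarith [mul_le_mul_of_nonneg_left this h4.le]

lemma PK_mass {y : ℝ} (hy : y ∈ Ioo (0:ℝ) 1) : ∫ u, PK y u = 1 - y := by
  have hs := sin_pos' hy
  have hpi := Real.pi_pos
  have hder : ∀ u, HasDerivAt (fun u => π⁻¹ * Real.arctan ((Real.exp (π * u) - Real.cos (π * y)) / Real.sin (π * y)))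
      (PK y u) u := by
    intro u
    have h1 : HasDerivAt (fun u => (Real.exp (π * u) - Real.cos (π * y)) / Real.sin (π * y))
        (Real.exp (π * u) * π / Real.sin (π * y)) u := by
      have := (((hasDerivAt_id u).const_mul π).exp.sub_const (Real.cos (π * y))).div_const (Real.sin (π * y))
      simpa using this
    have h2 := h1.arctan.const_mul π⁻¹
    refine h2.congr_deriv (Eq.symm ?_)
    unfold PK
    rw [Real.cosh_eq, Real.exp_neg]
    have he := Real.exp_pos (π * u)
    have hsc := Real.sin_sq_add_cos_sq (π * y)
    have hd := PK_den_pos hy u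
    rw [Real.cosh_eq, Real.exp_neg] at hd
    set E := Real.exp (π * u)
    set s := Real.sin (π * y)
    set c := Real.cos (π * y)
    have hE : E * (2 * ((E + E⁻¹) / 2 - c)) = s ^ 2 + (E - c) ^ 2 := by
      have : E * E⁻¹ = 1 := mul_inv_cancel₀ he.ne'
      linear_combination this - hsc
    have hne : 2 * ((E + E⁻¹) / 2 - c) ≠ 0 := by positivity
    have hp : 0 < s ^ 2 + (E - c) ^ 2 := by positivity
    have e3 : 1 + ((E - c) / s) ^ 2 = (s ^ 2 + (E - c) ^ 2) / s ^ 2 := by field_simp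
    rw [e3, ← hE]
    field_simp
  have htop : Tendsto (fun u => π⁻¹ * Real.arctan ((Real.exp (π * u) - Real.cos (π * y)) / Real.sin (π * y))) atTop
      (𝓝 (π⁻¹ * (π / 2))) := by
    refine Tendsto.const_mul _ ((Real.tendsto_arctan_atTop.mono_right nhdsWithin_le_nhds).comp ?_)
    refine Tendsto.atTop_div_const hs ?_
    refine tendsto_atTop_add_const_right _ _ ?_
    exact Real.tendsto_exp_atTop.comp (tendsto_id.const_mul_atTop hpi)
  have hbot : Tendsto (fun u => π⁻¹ * Real.arctan ((Real.exp (π * u) - Real.cos (π * y)) / Real.sin (π * y))) atBot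
      (𝓝 (π⁻¹ * (π * y - π / 2))) := by
    have e : Real.arctan ((0 - Real.cos (π * y)) / Real.sin (π * y)) = π * y - π / 2 := by
      have : (0 - Real.cos (π * y)) / Real.sin (π * y) = Real.tan (π * y - π / 2) := by
        rw [Real.tan_eq_sin_div_cos, Real.sin_sub_pi_div_two, Real.cos_sub_pi_div_two, zero_sub]
      rw [this, Real.arctan_tan]
      · nlinarith [hy.1]
      · nlinarith [hy.2]
    rw [← e]
    refine Tendsto.const_mul _ ((Real.continuous_arctan.tendsto _).comp ?_)
    refine Tendsto.div_const (Tendsto.sub_const ?_ _) _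
    exact Real.tendsto_exp_atBot.comp (tendsto_id.const_mul_atBot hpi)
  rw [integral_of_hasDerivAt_of_tendsto hder (PK_integrable hy) hbot htop]
  field_simp
  ring

lemma PK_moment {y : ℝ} (hy : y ∈ Ioo (0:ℝ) 1) : Integrable (fun u => u ^ 2 * PK y u) ∧
    ∫ u, u ^ 2 * PK y u ≤ Real.sin (π * y) * ∫ u, wt u := by
  have hi := integrable_wt.const_mul (Real.sin (π * y))
  have : Integrable (fun u => u ^ 2 * PK y u) := hi.mono'
    (by have := PK_continuous hy; exact Continuous.aestronglyMeasurable (by fun_prop))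
    (Eventually.of_forall fun u => by
      rw [Real.norm_of_nonneg (mul_nonneg (sq_nonneg u) (PK_nonneg hy u))]; exact PK_sq_le hy u)
  refine ⟨this, ?_⟩
  rw [← integral_const_mul]
  exact integral_mono this hi (fun u => PK_sq_le hy u)

lemma PK_conv_bound {y : ℝ} (hy : y ∈ Ioo (0:ℝ) 1) {φ : ℝ → ℂ} {C : ℝ} (hC : 0 ≤ C)
    (hb : ∀ x, ‖φ x‖ ≤ C * wt x ^ 2) (t : ℝ) :
    ‖∫ x, (PK y (t - x) : ℂ) * φ x‖ ≤ 2 * C * (1 + ∫ u, wt u) * wt t := by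
  have h1 := integral_sub_left_eq_self (fun u : ℝ => (PK y u : ℂ) * φ (t - u)) volume t
  simp only [sub_sub_cancel] at h1
  rw [h1]
  obtain ⟨mi, ml⟩ := PK_moment hy
  have hi : Integrable (fun u => 2 * C * wt t * (PK y u + u ^ 2 * PK y u)) := ((PK_integrable hy).add mi).const_mul _
  have h2 : ‖∫ u, (PK y u : ℂ) * φ (t - u)‖ ≤ ∫ u, 2 * C * wt t * (PK y u + u ^ 2 * PK y u) := by
    refine norm_integral_le_of_norm_le hi (Eventually.of_forall fun u => ?_)
    have hP := PK_nonneg hy u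
    rw [norm_mul, Complex.norm_real, Real.norm_of_nonneg hP]
    have h3 := le_wt_of_sq hC (hb (t - u))
    have h4 := wt_mul_le u t
    have h5 : wt (t - u) ≤ 2 * wt t * (1 + u ^ 2) := by
      have : wt u * (1 + u ^ 2) = 1 := by unfold wt; field_simp
      calc wt (t - u) = (wt u * wt (t - u)) * (1 + u ^ 2) := by linear_combination -wt (t - u) * this
        _ ≤ _ := by gcongr
    calc PK y u * ‖φ (t - u)‖ ≤ PK y u * (C * (2 * wt t * (1 + u ^ 2))) := by
          refine mul_le_mul_of_nonneg_left (h3.trans ?_) hP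
          gcongr
      _ = _ := by ring
  refine h2.trans ?_
  rw [integral_const_mul, integral_add (PK_integrable hy) mi, PK_mass hy]
  have h6 : 0 ≤ ∫ u, wt u := integral_nonneg fun u => (wt_pos u).le
  have h7 : (1 - y + ∫ u, u ^ 2 * PK y u) ≤ 1 + ∫ u, wt u := by
    have := Real.sin_le_one (π * y)
    nlinarith [hy.1]
  have := wt_pos t
  calc 2 * C * wt t * (1 - y + ∫ u, u ^ 2 * PK y u) ≤ 2 * C * wt t * (1 + ∫ u, wt u) := by gcongr
    _ = _ := by ring

lemma Ioo_mem_zero : Ioo (0:ℝ) 1 ∈ 𝓝[>] (0:ℝ) := Ioo_mem_nhdsGT one_pos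
lemma Ioo_mem_one : Ioo (0:ℝ) 1 ∈ 𝓝[<] (1:ℝ) := Ioo_mem_nhdsLT one_pos

lemma bdd_of_wt {φ : ℝ → ℂ} {C : ℝ} (hC : 0 ≤ C) (hb : ∀ x, ‖φ x‖ ≤ C * wt x ^ 2) (x : ℝ) : ‖φ x‖ ≤ C := by
  have h3 := wt_pos x
  have h4 := wt_le_one x
  have : wt x ^ 2 ≤ 1 := pow_le_one₀ h3.le h4
  have := hb x
  nlinarith

lemma PK_limit0 {φ : ℝ → ℂ} {C : ℝ} (hC : 0 ≤ C) (hφ : Continuous φ)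
    (hb : ∀ x, ‖φ x‖ ≤ C * wt x ^ 2) (t : ℝ) :
    Tendsto (fun y => ∫ x, (PK y (t - x) : ℂ) * φ x) (𝓝[>] 0) (𝓝 (φ t)) := by
  have hB := bdd_of_wt hC hb
  rw [Metric.tendsto_nhds]
  intro ε hε
  obtain ⟨δ, hδ, hcl⟩ := Metric.continuousAt_iff.1 (hφ.continuousAt (x := t)) (ε / 2) (by positivity)
  set K := 2 * C / δ ^ 2 with hK
  have hK0 : 0 ≤ K := by positivity
  have hpt : ∀ u, ‖φ (t - u) - φ t‖ ≤ ε / 2 + K * u ^ 2 := by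
    intro u
    by_cases hu : |u| < δ
    · have := hcl (x := t - u) (by rw [Real.dist_eq]; simpa using hu)
      rw [dist_eq_norm] at this
      have : 0 ≤ K * u ^ 2 := by positivity
      linarith
    · push Not at hu
      have h1 : δ ^ 2 ≤ u ^ 2 := by rw [← sq_abs u]; gcongr
      have h2 : 2 * C ≤ K * u ^ 2 := by
        rw [hK, div_mul_eq_mul_div, le_div_iff₀ (by positivity)]; gcongr
      have h3 := norm_sub_le (φ (t - u)) (φ t)
      have := hB (t - u)
      have := hB t
      linarith
  have hlim : Tendsto (fun y : ℝ => ε / 2 + K * (Real.sin (π * y) * ∫ u, wt u) + y * ‖φ t‖) (𝓝[>] 0) (𝓝 (ε / 2)) := by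
    have : Continuous (fun y : ℝ => ε / 2 + K * (Real.sin (π * y) * ∫ u, wt u) + y * ‖φ t‖) := by fun_prop
    have := this.tendsto 0
    simp at this
    exact this.mono_left nhdsWithin_le_nhds
  filter_upwards [Ioo_mem_zero, hlim.eventually_lt_const (u := ε) (by linarith)] with y hy hlt
  refine lt_of_le_of_lt ?_ hlt
  have h1 := integral_sub_left_eq_self (fun u : ℝ => (PK y u : ℂ) * φ (t - u)) volume t
  simp only [sub_sub_cancel] at h1
  rw [h1, dist_eq_norm]
  have hP := PK_integrable hy
  obtain ⟨mi, ml⟩ := PK_moment hy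
  have i1 : Integrable (fun u => (PK y u : ℂ) * φ (t - u)) :=
    hP.ofReal.mul_bdd (c := C) (by exact Continuous.aestronglyMeasurable (by fun_prop)) (Eventually.of_forall fun u => hB _)
  have i2 : Integrable (fun u => (PK y u : ℂ) * φ t) := hP.ofReal.mul_const _
  have e1 : ∫ u, (PK y u : ℂ) * φ t = ((1 - y : ℝ) : ℂ) * φ t := by
    rw [integral_mul_const, integral_complex_ofReal, PK_mass hy]
  have e2 : (∫ u, (PK y u : ℂ) * φ (t - u)) - φ t = (∫ u, (PK y u : ℂ) * (φ (t - u) - φ t)) - y * φ t := by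
    simp_rw [mul_sub]
    rw [integral_sub i1 i2, e1]; push_cast; ring
  rw [e2]
  refine (norm_sub_le _ _).trans ?_
  rw [norm_mul, Complex.norm_real, Real.norm_of_nonneg hy.1.le]
  gcongr
  have h2 : ‖∫ u, (PK y u : ℂ) * (φ (t - u) - φ t)‖ ≤ ∫ u, (ε / 2 * PK y u + K * (u ^ 2 * PK y u)) := by
    refine norm_integral_le_of_norm_le ((hP.const_mul _).add (mi.const_mul _)) (Eventually.of_forall fun u => ?_)
    rw [norm_mul, Complex.norm_real, Real.norm_of_nonneg (PK_nonneg hy u)]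
    nlinarith [hpt u, PK_nonneg hy u]
  refine h2.trans ?_
  rw [integral_add (hP.const_mul _) (mi.const_mul _), integral_const_mul, integral_const_mul, PK_mass hy]
  have := mul_le_mul_of_nonneg_left ml hK0
  nlinarith [hy.1]

lemma PK_limit1 {φ : ℝ → ℂ} {C : ℝ} (hC : 0 ≤ C)
    (hb : ∀ x, ‖φ x‖ ≤ C * wt x ^ 2) (t : ℝ) :
    Tendsto (fun y => ∫ x, (PK y (t - x) : ℂ) * φ x) (𝓝[<] 1) (𝓝 0) := by
  have hB := bdd_of_wt hC hb
  have hlim : Tendsto (fun y : ℝ => C * (1 - y)) (𝓝[<] 1) (𝓝 0) := by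
    have : Continuous (fun y : ℝ => C * (1 - y)) := by fun_prop
    have := this.tendsto 1
    simp only [sub_self, mul_zero] at this
    exact this.mono_left nhdsWithin_le_nhds
  refine squeeze_zero_norm' ?_ hlim
  filter_upwards [Ioo_mem_one] with y hy
  have hP := (PK_integrable hy).comp_sub_left t
  have h2 : ‖∫ x, (PK y (t - x) : ℂ) * φ x‖ ≤ ∫ x, C * PK y (t - x) := by
    refine norm_integral_le_of_norm_le (hP.const_mul _) (Eventually.of_forall fun u => ?_)
    rw [norm_mul, Complex.norm_real, Real.norm_of_nonneg (PK_nonneg hy _)]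
    nlinarith [hB u, PK_nonneg hy (t - u)]
  refine h2.trans ?_
  rw [integral_const_mul, integral_sub_left_eq_self (PK y) volume t, PK_mass hy]

lemma PK_conv_meas {y : ℝ} (hy : y ∈ Ioo (0:ℝ) 1) {φ : ℝ → ℂ} (hφ : Continuous φ) : AEStronglyMeasurable (fun t => ∫ x, (PK y (t - x) : ℂ) * φ x) volume := by
  have hc := PK_continuous hy
  have : Continuous (Function.uncurry fun t x : ℝ => (PK y (t - x) : ℂ) * φ x) := by
    unfold Function.uncurry; fun_prop
  exact (this.stronglyMeasurable.integral_prod_right).aestronglyMeasurable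

lemma PK_lim_int {v φ : ℝ → ℂ} {C : ℝ} {l : Filter ℝ} [l.IsCountablyGenerated] {g : ℝ → ℂ} (hl : Ioo (0:ℝ) 1 ∈ l)
    (hv : Integrable (fun x => ‖v x‖ * wt x)) (hvm : AEStronglyMeasurable v volume) (hC : 0 ≤ C) (hφ : Continuous φ)
    (hb : ∀ x, ‖φ x‖ ≤ C * wt x ^ 2)
    (ht : ∀ t, Tendsto (fun y => ∫ x, (PK y (t - x) : ℂ) * φ x) l (𝓝 (g t))) :
    Tendsto (fun y => ∫ x, (∫ t, v t * (PK y (t - x) : ℂ)) * φ x) l (𝓝 (∫ t, v t * g t)) := by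
  have h1 : Tendsto (fun y => ∫ t, v t * ∫ x, (PK y (t - x) : ℂ) * φ x) l (𝓝 (∫ t, v t * g t)) := by
    refine tendsto_integral_filter_of_dominated_convergence (fun t => (2 * C * (1 + ∫ u, wt u)) * (‖v t‖ * wt t)) ?_ ?_
      (hv.const_mul _) (Eventually.of_forall fun t => (ht t).const_mul _)
    · filter_upwards [hl] with y hy
      exact hvm.mul (PK_conv_meas hy hφ)
    · filter_upwards [hl] with y hy
      refine Eventually.of_forall fun t => ?_
      rw [norm_mul]
      have := mul_le_mul_of_nonneg_left (PK_conv_bound hy hC hb t) (norm_nonneg (v t))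
      linarith
  refine h1.congr' ?_
  filter_upwards [hl] with y hy
  obtain ⟨D, hD⟩ := PK_bound hy
  have hc := PK_continuous hy
  exact swap_conv (F := fun u => (PK y u : ℂ)) hv hvm (by fun_prop) (fun u => by
    rw [Complex.norm_real, Real.norm_of_nonneg (PK_nonneg hy u)]; exact hD u) hφ hb

lemma PK_lim0 {v φ : ℝ → ℂ} {C : ℝ} (hv : Integrable (fun x => ‖v x‖ * wt x)) (hvm : AEStronglyMeasurable v volume)
    (hC : 0 ≤ C) (hφ : Continuous φ) (hb : ∀ x, ‖φ x‖ ≤ C * wt x ^ 2) :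
    Tendsto (fun y => ∫ x, (∫ t, v t * (PK y (t - x) : ℂ)) * φ x) (𝓝[>] 0) (𝓝 (∫ t, v t * φ t)) :=
  PK_lim_int Ioo_mem_zero hv hvm hC hφ hb (PK_limit0 hC hφ hb)

lemma PK_lim1 {v φ : ℝ → ℂ} {C : ℝ} (hv : Integrable (fun x => ‖v x‖ * wt x)) (hvm : AEStronglyMeasurable v volume)
    (hC : 0 ≤ C) (hφ : Continuous φ) (hb : ∀ x, ‖φ x‖ ≤ C * wt x ^ 2) :
    Tendsto (fun y => ∫ x, (∫ t, v t * (PK y (t - x) : ℂ)) * φ x) (𝓝[<] 1) (𝓝 0) := by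
  simpa using PK_lim_int Ioo_mem_one hv hvm hC hφ hb (g := fun _ => 0) (PK_limit1 hC hb)

lemma tendsto_one_sub0 : Tendsto (fun y : ℝ => 1 - y) (𝓝[>] 0) (𝓝[<] 1) := by
  refine tendsto_nhdsWithin_iff.2 ⟨?_, ?_⟩
  · have : Continuous (fun y : ℝ => 1 - y) := by fun_prop
    have := this.tendsto 0
    rw [sub_zero] at this
    exact this.mono_left nhdsWithin_le_nhds
  · filter_upwards [self_mem_nhdsWithin] with y hy
    simpa using hy

lemma tendsto_one_sub1 : Tendsto (fun y : ℝ => 1 - y) (𝓝[<] 1) (𝓝[>] 0) := by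
  refine tendsto_nhdsWithin_iff.2 ⟨?_, ?_⟩
  · have : Continuous (fun y : ℝ => 1 - y) := by fun_prop
    have := this.tendsto 1
    rw [sub_self] at this
    exact this.mono_left nhdsWithin_le_nhds
  · filter_upwards [self_mem_nhdsWithin] with y hy
    simpa using hy

/-- Poisson extension -/
def PE (v w : ℝ → ℂ) (z : ℂ) : ℂ :=
  (∫ t, v t * (PK z.im (t - z.re) : ℂ)) + ∫ t, w t * (PK (1 - z.im) (t - z.re) : ℂ)

lemma PE_line (v w : ℝ → ℂ) (x y : ℝ) : PE v w (x + y * I) =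
    (∫ t, v t * (PK y (t - x) : ℂ)) + ∫ t, w t * (PK (1 - y) (t - x) : ℂ) := by
  simp [PE]

lemma one_sub_mem {y : ℝ} (hy : y ∈ Ioo (0:ℝ) 1) : 1 - y ∈ Ioo (0:ℝ) 1 := ⟨by linarith [hy.2], by linarith [hy.1]⟩

lemma PK_conv_meas' {y : ℝ} (hy : y ∈ Ioo (0:ℝ) 1) {v : ℝ → ℂ} (hvm : AEStronglyMeasurable v volume) :
    StronglyMeasurable (fun x => ∫ t, v t * (PK y (t - x) : ℂ)) := by
  have hc := PK_continuous hy
  have e : (fun x => ∫ t, v t * (PK y (t - x) : ℂ)) = fun x => ∫ t, hvm.mk v t * (PK y (t - x) : ℂ) := by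
    ext x
    exact integral_congr_ae (hvm.ae_eq_mk.mono fun t ht => by simp only [ht])
  rw [e]
  have h1 : StronglyMeasurable (Function.uncurry fun x t : ℝ => hvm.mk v t * (PK y (t - x) : ℂ)) := by
    refine StronglyMeasurable.mul (f := fun p : ℝ × ℝ => hvm.mk v p.2) (hvm.stronglyMeasurable_mk.comp_measurable measurable_snd) ?_
    exact Continuous.stronglyMeasurable (by fun_prop)
  exact h1.integral_prod_right

lemma PK_conv_int {y : ℝ} (hy : y ∈ Ioo (0:ℝ) 1) {v φ : ℝ → ℂ} {p : ℝ≥0∞} (hp : 1 ≤ p) (hv : MemLp v p volume)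
    {C : ℝ} (hC : 0 ≤ C) (hφ : Continuous φ) (hb : ∀ x, ‖φ x‖ ≤ C * wt x ^ 2) :
    Integrable (fun x => (∫ t, v t * (PK y (t - x) : ℂ)) * φ x) := by
  have hm : MemLp (fun x => ∫ t, v t * (PK y (t - x) : ℂ)) p volume :=
    ⟨(PK_conv_meas' hy hv.1).aestronglyMeasurable,
      (young (PK_continuous hy) (PK_nonneg hy) (PK_integrable hy) hp hv.1).trans_lt
        (ENNReal.mul_lt_top ENNReal.ofReal_lt_top hv.2)⟩
  exact integrable_mul_of_wt (wt_integrable_of_memLp hp hm) hm.1 hφ.aestronglyMeasurable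
    (fun x => le_wt_of_sq hC (hb x))

lemma PE_hardyNorm {p q : ℝ≥0∞} (hp : 1 ≤ p) (hq : 1 ≤ q) {v w : ℝ → ℂ} (hv : MemLp v p volume) (hw : MemLp w q volume) :
    hardyNorm p q (PE v w) ≤ eLpNorm v p volume + eLpNorm w q volume := by
  refine iSup₂_le fun y hy => ?_
  have hy' := one_sub_mem hy
  refine iInf_le_of_le (fun x => ∫ t, v t * (PK y (t - x) : ℂ)) (iInf_le_of_le (fun x => ∫ t, w t * (PK (1 - y) (t - x) : ℂ))
    (iInf_le_of_le (PK_conv_meas' hy hv.1).measurable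
    (iInf_le_of_le (PK_conv_meas' hy' hw.1).measurable (iInf_le_of_le ?_ ?_))))
  · ext x
    rw [Pi.add_apply, bLine, PE_line]
  · have y1 := young (PK_continuous hy) (PK_nonneg hy) (PK_integrable hy) hp hv.1
    have y2 := young (PK_continuous hy') (PK_nonneg hy') (PK_integrable hy') hq hw.1
    rw [PK_mass hy] at y1
    rw [PK_mass hy', sub_sub_cancel] at y2
    refine add_le_add ?_ ?_
    · refine (mul_le_mul_right y1 _).trans ?_
      rw [← mul_assoc, ← ENNReal.ofReal_mul (by have := hy'.1; positivity), inv_mul_cancel₀ hy'.1.ne']; simp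
    · refine (mul_le_mul_right y2 _).trans ?_
      rw [← mul_assoc, ← ENNReal.ofReal_mul (by have := hy.1; positivity), inv_mul_cancel₀ hy.1.ne']; simp

lemma PE_traces {p q : ℝ≥0∞} (hp : 1 ≤ p) (hq : 1 ≤ q) {v w : ℝ → ℂ} (hv : MemLp v p volume) (hw : MemLp w q volume) :
    IsTrace0 (PE v w) v ∧ IsTrace1 (PE v w) w := by
  have iv := wt_integrable_of_memLp hp hv
  have iw := wt_integrable_of_memLp hq hw
  have hsplit : ∀ (φ : ℝ → ℂ) (C : ℝ), 0 ≤ C → Continuous φ → (∀ x, ‖φ x‖ ≤ C * wt x ^ 2) → ∀ y ∈ Ioo (0:ℝ) 1,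
      (∫ x, (∫ t, v t * (PK y (t - x) : ℂ)) * φ x) + (∫ x, (∫ t, w t * (PK (1 - y) (t - x) : ℂ)) * φ x)
        = ∫ x : ℝ, PE v w (x + y * I) * φ x := by
    intro φ C hC hφ hb y hy
    rw [← integral_add (PK_conv_int hy hp hv hC hφ hb) (PK_conv_int (one_sub_mem hy) hq hw hC hφ hb)]
    congr 1; ext x
    rw [PE_line, add_mul]
  constructor
  · intro φ
    obtain ⟨C, hC⟩ := schwartz_bound φ
    have hc : Continuous fun x => (starRingEnd ℂ) (φ x) := Complex.continuous_conj.comp φ.continuous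
    have hC0 : 0 ≤ C := by
      have := (norm_nonneg _).trans (hC 0); have h2 := wt_pos 0
      by_contra h; push Not at h; nlinarith [mul_pos_of_neg_of_neg h (neg_neg_of_pos (pow_pos h2 2))]
    have l := (PK_lim0 iv hv.1 hC0 hc hC).add ((PK_lim1 iw hw.1 hC0 hc hC).comp tendsto_one_sub0)
    rw [add_zero] at l
    refine l.congr' ?_
    filter_upwards [Ioo_mem_zero] with y hy
    exact hsplit _ C hC0 hc hC y hy
  · intro φ
    obtain ⟨C, hC⟩ := schwartz_bound φ
    have hc : Continuous fun x => (starRingEnd ℂ) (φ x) := Complex.continuous_conj.comp φ.continuous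
    have hC0 : 0 ≤ C := by
      have := (norm_nonneg _).trans (hC 0); have h2 := wt_pos 0
      by_contra h; push Not at h; nlinarith [mul_pos_of_neg_of_neg h (neg_neg_of_pos (pow_pos h2 2))]
    have l := (PK_lim1 iv hv.1 hC0 hc hC).add ((PK_lim0 iw hw.1 hC0 hc hC).comp tendsto_one_sub1)
    rw [zero_add] at l
    refine l.congr' ?_
    filter_upwards [Ioo_mem_one] with y hy
    exact hsplit _ C hC0 hc hC y hy

/-- reciprocal of `sinh (π ζ / 2)` -/
def SI (ζ : ℂ) : ℂ := (Complex.sinh (π * ζ / 2))⁻¹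

lemma sin_half_ge {b δ : ℝ} (h1 : δ ≤ b) (h2 : b ≤ 2 - δ) (hδ : 0 < δ) : δ ≤ Real.sin (π * b / 2) := by
  have hpi := Real.pi_pos
  rcases le_total b 1 with h | h
  · have := Real.mul_le_sin (x := π * b / 2) (by have : 0 < b := by linarith
                                                 positivity) (by nlinarith)
    have e : 2 / π * (π * b / 2) = b := by field_simp
    linarith
  · have := Real.mul_le_sin (x := π - π * b / 2) (by nlinarith) (by nlinarith)
    have e : 2 / π * (π - π * b / 2) = 2 - b := by field_simp
    rw [Real.sin_pi_sub] at this
    linarith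

lemma normSq_sinh_half (ζ : ℂ) : ‖Complex.sinh (π * ζ / 2)‖ ^ 2
    = (Real.cosh (π * ζ.re) - 1) / 2 + Real.sin (π * ζ.im / 2) ^ 2 := by
  have e : (π * ζ / 2 : ℂ) = ((π * ζ.re / 2 : ℝ) : ℂ) + ((π * ζ.im / 2 : ℝ) : ℂ) * I := by
    conv_lhs => rw [← re_add_im ζ]
    push_cast; ring
  rw [e, Complex.sinh_add, Complex.cosh_mul_I, Complex.sinh_mul_I, ← ofReal_sinh, ← ofReal_cosh, ← ofReal_sin, ← ofReal_cos,
    ← mul_assoc, ← ofReal_mul, ← ofReal_mul, ← Complex.normSq_eq_norm_sq, Complex.normSq_add_mul_I]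
  have h1 : π * ζ.re = 2 * (π * ζ.re / 2) := by ring
  rw [h1, Real.cosh_two_mul]
  have h2 : 2 * (π * ζ.re / 2) / 2 = π * ζ.re / 2 := by ring
  rw [h2]
  have h3 := Real.cosh_sq (π * ζ.re / 2)
  have h4 := Real.sin_sq_add_cos_sq (π * ζ.im / 2)
  rw [mul_pow, mul_pow, h3]
  linear_combination (Real.sinh (π * ζ.re / 2)) ^ 2 * h4

lemma SI_bound {δ : ℝ} (hδ : 0 < δ) (hδ1 : δ ≤ 1) {ζ : ℂ} (h1 : δ ≤ |ζ.im|) (h2 : |ζ.im| ≤ 2 - δ) :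
    Complex.sinh (π * ζ / 2) ≠ 0 ∧ ‖SI ζ‖ ≤ 2 / δ * wt ζ.re := by
  have hs := sin_half_ge h1 h2 hδ
  have hs2 : δ ^ 2 ≤ Real.sin (π * ζ.im / 2) ^ 2 := by
    have e : Real.sin (π * ζ.im / 2) ^ 2 = Real.sin (π * |ζ.im| / 2) ^ 2 := by
      rcases abs_choice ζ.im with h | h
      · rw [h]
      · rw [h, mul_neg, neg_div, Real.sin_neg, neg_sq]
    rw [e]; gcongr
  have h3 := cosh_sub_one_ge ζ.re
  have h4 : (δ / 2 * (1 + ζ.re ^ 2)) ^ 2 ≤ ‖Complex.sinh (π * ζ / 2)‖ ^ 2 := by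
    rw [normSq_sinh_half]
    have hd : δ ^ 2 ≤ 1 := pow_le_one₀ hδ.le hδ1
    have a2 := sq_nonneg ζ.re
    have a4 := mul_nonneg a2 a2
    nlinarith [mul_le_mul_of_nonneg_right hd a2, mul_le_mul_of_nonneg_right hd a4]
  have h5 : δ / 2 * (1 + ζ.re ^ 2) ≤ ‖Complex.sinh (π * ζ / 2)‖ :=
    (sq_le_sq₀ (by positivity) (norm_nonneg _)).1 h4
  have h6 : 0 < δ / 2 * (1 + ζ.re ^ 2) := by positivity
  refine ⟨norm_pos_iff.1 (h6.trans_le h5), ?_⟩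
  rw [SI, norm_inv]
  refine (inv_anti₀ h6 h5).trans (le_of_eq ?_)
  unfold wt; field_simp

lemma SI_diff {ζ : ℂ} (h : Complex.sinh (π * ζ / 2) ≠ 0) : DifferentiableAt ℂ SI ζ := by
  unfold SI
  exact DifferentiableAt.inv (by fun_prop) h

lemma SI_cont {a : ℂ} {δ : ℝ} (hδ : 0 < δ) (hδ1 : δ ≤ 1) (h1 : δ ≤ |a.im|) (h2 : |a.im| ≤ 2 - δ) :
    Continuous (fun t : ℝ => SI (t + a)) := by
  unfold SI
  refine Continuous.inv₀ (by fun_prop) (fun t => ?_)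
  exact (SI_bound hδ hδ1 (ζ := t + a) (by simpa using h1) (by simpa using h2)).1

/-- generic integrability and measurability -/
lemma SI_prod_int {v : ℝ → ℂ} (iv : Integrable (fun x => ‖v x‖ * wt x)) (hvm : AEStronglyMeasurable v volume)
    {a b : ℂ} {δ : ℝ} (hδ : 0 < δ) (hδ1 : δ ≤ 1) (h1 : δ ≤ |a.im|) (h2 : |a.im| ≤ 2 - δ)
    (hbr : b.re = 0) (h3 : 1 / 2 ≤ |b.im|) (h4 : |b.im| ≤ 3 / 2) :
    AEStronglyMeasurable (fun t : ℝ => v t * (SI (t + a) * SI (t + b))) volume ∧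
    (∀ t : ℝ, ‖v t * (SI (t + a) * SI (t + b))‖ ≤ 8 / δ * (‖v t‖ * wt t)) ∧
    Integrable (fun t : ℝ => v t * (SI (t + a) * SI (t + b))) := by
  have m : AEStronglyMeasurable (fun t : ℝ => v t * (SI (t + a) * SI (t + b))) volume :=
    hvm.mul ((SI_cont hδ hδ1 h1 h2).mul (SI_cont (δ := 1/2) (by norm_num) (by norm_num) h3 (by linarith))).aestronglyMeasurable
  have hb : ∀ t : ℝ, ‖v t * (SI (t + a) * SI (t + b))‖ ≤ 8 / δ * (‖v t‖ * wt t) := by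
    intro t
    have b1 := (SI_bound hδ hδ1 (ζ := t + a) (by simpa using h1) (by simpa using h2)).2
    have b2 := (SI_bound (δ := 1/2) (by norm_num) (by norm_num) (ζ := t + b) (by simpa using h3)
      (by simp only [add_im, ofReal_im, zero_add]; linarith)).2
    have e : ((t:ℂ) + b).re = t := by simp [hbr]
    rw [e] at b2
    have := wt_le_one ((t:ℂ) + a).re
    have b1' : ‖SI (t + a)‖ ≤ 2 / δ := b1.trans (by
      have : 0 < 2 / δ := by positivity
      nlinarith)
    rw [norm_mul, norm_mul]
    have hw := wt_pos t
    calc ‖v t‖ * (‖SI (t + a)‖ * ‖SI (t + b)‖) ≤ ‖v t‖ * (2 / δ * (2 / (1 / 2) * wt t)) := by gcongr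
      _ = _ := by ring
  exact ⟨m, hb, (iv.const_mul _).mono' m (Eventually.of_forall hb)⟩

lemma SI_hol {v : ℝ → ℂ} (iv : Integrable (fun x => ‖v x‖ * wt x)) (hvm : AEStronglyMeasurable v volume)
    {a b z₀ : ℂ} {δ : ℝ} (hδ : 0 < δ) (hδ1 : δ ≤ 1) (h1 : 2 * δ ≤ |(a - z₀).im|) (h2 : |(a - z₀).im| ≤ 2 - 2 * δ)
    (hbr : b.re = 0) (h3 : 1 / 2 ≤ |b.im|) (h4 : |b.im| ≤ 3 / 2) :
    DifferentiableAt ℂ (fun z => ∫ t : ℝ, v t * (SI (t + (a - z)) * SI (t + b))) z₀ := by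
  have hball : ∀ z ∈ Metric.ball z₀ δ, δ ≤ |(a - z).im| ∧ |(a - z).im| ≤ 2 - δ := by
    intro z hz
    rw [Metric.mem_ball, dist_eq_norm] at hz
    have e1 : |(a - z).im - (a - z₀).im| ≤ ‖z - z₀‖ := by
      have : (a - z).im - (a - z₀).im = -(z - z₀).im := by simp
      rw [this, abs_neg]; exact abs_im_le_norm _
    have e2 := abs_sub_abs_le_abs_sub (a - z).im (a - z₀).im
    have e3 := abs_sub_abs_le_abs_sub (a - z₀).im (a - z).im
    rw [abs_sub_comm] at e3
    constructor <;> linarith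
  refine differentiableAt_integral (R := δ) (b := fun t => 8 / δ * (‖v t‖ * wt t)) hδ ?_ ?_ ?_ (iv.const_mul _)
  · intro z hz
    exact (SI_prod_int iv hvm hδ hδ1 (hball z hz).1 (hball z hz).2 hbr h3 h4).1
  · refine Eventually.of_forall fun t z hz => DifferentiableAt.differentiableWithinAt ?_
    refine DifferentiableAt.const_mul (DifferentiableAt.mul_const ?_ _) _
    refine DifferentiableAt.comp (f := fun z => (t:ℂ) + (a - z)) z (SI_diff ?_) (by fun_prop)
    exact (SI_bound hδ hδ1 (ζ := t + (a - z)) (by simpa using (hball z hz).1) (by simpa using (hball z hz).2)).1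
  · exact Eventually.of_forall fun t z hz =>
      (SI_prod_int iv hvm hδ hδ1 (hball z hz).1 (hball z hz).2 hbr h3 h4).2.1 t

/-- holomorphic representation -/
def HR (v w : ℝ → ℂ) (z : ℂ) : ℂ :=
  Complex.sinh (π * (z + I / 2) / 2) / (4 * I) * ((∫ t : ℝ, v t * (SI (t + (0 - z)) * SI (t + I / 2)))
    - ∫ t : ℝ, w t * (SI (t + (I - z)) * SI (t + (3 / 2 : ℝ) * I)))

lemma HR_diff {v w : ℝ → ℂ} (iv : Integrable (fun x => ‖v x‖ * wt x)) (hvm : AEStronglyMeasurable v volume)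
    (iw : Integrable (fun x => ‖w x‖ * wt x)) (hwm : AEStronglyMeasurable w volume) {z : ℂ} (hz : z ∈ Strip) :
    DifferentiableAt ℂ (HR v w) z := by
  obtain ⟨h0, h1⟩ := hz
  unfold HR
  set δ := min z.im (1 - z.im) / 2 with hδd
  have hm : 0 < min z.im (1 - z.im) := lt_min h0 (by linarith)
  have hm1 := min_le_left z.im (1 - z.im)
  have hm2 := min_le_right z.im (1 - z.im)
  have hδ : 0 < δ := by positivity
  refine DifferentiableAt.mul (by fun_prop) (DifferentiableAt.sub ?_ ?_)
  · refine SI_hol iv hvm hδ (by linarith) ?_ ?_ (by simp) ?_ ?_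
    · simp only [zero_sub, neg_im, abs_neg, abs_of_pos h0]; linarith
    · simp only [zero_sub, neg_im, abs_neg, abs_of_pos h0]; linarith
    · simp
    · simp; norm_num
  · have e : |(I - z).im| = 1 - z.im := by simp only [sub_im, I_im]; exact abs_of_pos (by linarith)
    refine SI_hol iw hwm hδ (by linarith) ?_ ?_ (by simp) ?_ ?_
    · rw [e]; linarith
    · rw [e]; linarith
    · simp; norm_num
    · simp; norm_num

/-- the correction kernel -/
lemma clsG_corr {z : ℂ} (hz : z ∈ Strip) : ∃ C, ClsG (fun ζ => SI (ζ - (starRingEnd ℂ) z) * SI (ζ + I / 2)) C := by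
  obtain ⟨h0, h1⟩ := hz
  set δ := min z.im (1 - z.im) with hδd
  have hδ : 0 < δ := lt_min h0 (by linarith)
  have hm1 := min_le_left z.im (1 - z.im)
  have hm2 := min_le_right z.im (1 - z.im)
  have hA : ∀ ζ : ℂ, 0 ≤ ζ.im → ζ.im ≤ 1 → δ ≤ |(ζ - (starRingEnd ℂ) z).im| ∧ |(ζ - (starRingEnd ℂ) z).im| ≤ 2 - δ := by
    intro ζ a b
    have e : (ζ - (starRingEnd ℂ) z).im = ζ.im + z.im := by simp
    rw [e, abs_of_pos (by linarith)]
    constructor <;> linarith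
  have hB : ∀ ζ : ℂ, 0 ≤ ζ.im → ζ.im ≤ 1 → 1/2 ≤ |(ζ + I / 2).im| ∧ |(ζ + I / 2).im| ≤ 2 - 1/2 := by
    intro ζ a b
    have e : (ζ + I / 2).im = ζ.im + 1/2 := by simp
    rw [e, abs_of_pos (by linarith)]
    constructor <;> linarith
  refine ⟨2 / δ * (2 / (1/2)) * (2 / wt z.re), ?_, ?_⟩
  · intro ζ a b
    have s1 := (SI_bound hδ (by linarith) (hA ζ a b).1 (hA ζ a b).2).1
    have s2 := (SI_bound (by norm_num) (by norm_num) (hB ζ a b).1 (hB ζ a b).2).1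
    refine DifferentiableAt.mul ?_ ?_
    · exact DifferentiableAt.comp (f := fun ζ => ζ - (starRingEnd ℂ) z) ζ (SI_diff s1) (by fun_prop)
    · exact DifferentiableAt.comp (f := fun ζ => ζ + I / 2) ζ (SI_diff s2) (by fun_prop)
  · intro ζ a b
    have s1 := (SI_bound hδ (by linarith) (hA ζ a b).1 (hA ζ a b).2).2
    have s2 := (SI_bound (by norm_num) (by norm_num) (hB ζ a b).1 (hB ζ a b).2).2
    have e1 : (ζ - (starRingEnd ℂ) z).re = ζ.re - z.re := by simp
    have e2 : (ζ + I / 2).re = ζ.re := by simp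
    rw [e1] at s1
    rw [e2] at s2
    have h3 : wt (ζ.re - z.re) ≤ 2 / wt z.re * wt ζ.re := by
      have := wt_mul_le z.re ζ.re
      rw [div_mul_eq_mul_div, le_div_iff₀ (wt_pos _)]
      linarith
    have p1 := wt_pos z.re
    have p2 := wt_pos ζ.re
    have p3 := wt_pos (ζ.re - z.re)
    rw [norm_mul]
    calc ‖SI (ζ - (starRingEnd ℂ) z)‖ * ‖SI (ζ + I / 2)‖
        ≤ (2 / δ * (2 / wt z.re * wt ζ.re)) * (2 / (1/2) * wt ζ.re) := by
          gcongr
          exact s1.trans (by gcongr)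
      _ = _ := by ring

lemma sinh_plucker (a b c d : ℂ) : Complex.sinh (a - b) * Complex.sinh (c - d)
    - Complex.sinh (a - d) * Complex.sinh (c - b) = Complex.sinh (c - a) * Complex.sinh (d - b) := by
  simp only [Complex.sinh_sub]; ring

/-- complex form of the Poisson kernel -/
lemma PK_complex (x y : ℝ) (ζ : ℂ) : 4 * (Complex.sinh (π * (ζ - (x + y * I)) / 2) * Complex.sinh (π * (ζ - (x - y * I)) / 2))
    = 2 * (Complex.cosh (π * (ζ - x)) - Complex.cos (π * y)) := by
  have e1 : Complex.cosh (π * (ζ - x)) = Complex.cosh (π * (ζ - (x + y * I)) / 2 + π * (ζ - (x - y * I)) / 2) := by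
    congr 1; ring
  have e2 : Complex.cos (π * y) = Complex.cosh (π * (ζ - (x - y * I)) / 2 - π * (ζ - (x + y * I)) / 2) := by
    rw [← Complex.cosh_mul_I]; congr 1; ring
  rw [e1, e2, Complex.cosh_add, Complex.cosh_sub]; ring

lemma kernel_split {z ζ : ℂ} (h1 : Complex.sinh (π * (ζ - z) / 2) ≠ 0)
    (h2 : Complex.sinh (π * (ζ - (starRingEnd ℂ) z) / 2) ≠ 0)
    (h3 : Complex.sinh (π * (ζ + I / 2) / 2) ≠ 0) :
    Complex.sin (π * z.im) / (2 * (Complex.cosh (π * (ζ - z.re)) - Complex.cos (π * z.im))) =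
    Complex.sinh (π * (z + I / 2) / 2) / (4 * I) * (SI (ζ - z) * SI (ζ + I / 2)) +
    Complex.sinh (π * (-(I / 2) - (starRingEnd ℂ) z) / 2) / (4 * I) * (SI (ζ - (starRingEnd ℂ) z) * SI (ζ + I / 2)) := by
  have ez : z = z.re + z.im * I := (re_add_im z).symm
  have ezc : (starRingEnd ℂ) z = z.re - z.im * I := by
    apply Complex.ext <;> simp
  have hP := PK_complex z.re z.im ζ
  rw [← ez, ← ezc] at hP
  rw [← hP]
  have hs : Complex.sin (π * z.im) * I = Complex.sinh (π * z / 2 - π * (starRingEnd ℂ) z / 2) := by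
    rw [← Complex.sinh_mul_I]; congr 1
    rw [ezc]; linear_combination (-(π:ℂ)/2) * ez
  have pl := sinh_plucker (π * z / 2) (π * (starRingEnd ℂ) z / 2) (π * ζ / 2) (π * (-(I / 2)) / 2)
  rw [← hs] at pl
  have r1 : (π * ζ / 2 - π * (-(I / 2)) / 2 : ℂ) = π * (ζ + I / 2) / 2 := by ring
  have r2 : (π * z / 2 - π * (-(I / 2)) / 2 : ℂ) = π * (z + I / 2) / 2 := by ring
  have r3 : (π * ζ / 2 - π * (starRingEnd ℂ) z / 2 : ℂ) = π * (ζ - (starRingEnd ℂ) z) / 2 := by ring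
  have r4 : (π * ζ / 2 - π * z / 2 : ℂ) = π * (ζ - z) / 2 := by ring
  have r5 : (π * (-(I / 2)) / 2 - π * (starRingEnd ℂ) z / 2 : ℂ) = π * (-(I / 2) - (starRingEnd ℂ) z) / 2 := by ring
  rw [r1, r2, r3, r4, r5] at pl
  unfold SI
  generalize Complex.sinh (π * (ζ - z) / 2) = A at *
  generalize Complex.sinh (π * (ζ - (starRingEnd ℂ) z) / 2) = B at *
  generalize Complex.sinh (π * (ζ + I / 2) / 2) = E at *
  generalize Complex.sinh (π * (z + I / 2) / 2) = F at *
  generalize Complex.sinh (π * (-(I / 2) - (starRingEnd ℂ) z) / 2) = K at *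
  generalize Complex.sin (π * z.im) = s at *
  have hI := I_ne_zero
  field_simp
  linear_combination pl

lemma PK_eq_complex (y u : ℝ) : (PK y u : ℂ) =
    Complex.sin (π * y) / (2 * (Complex.cosh (π * u) - Complex.cos (π * y))) := by
  unfold PK; push_cast; rfl

lemma PE_eq_HR {v w : ℝ → ℂ} (iv : Integrable (fun x => ‖v x‖ * wt x)) (hvm : AEStronglyMeasurable v volume)
    (iw : Integrable (fun x => ‖w x‖ * wt x)) (hwm : AEStronglyMeasurable w volume)
    (hF : FourierRelExp v w) {z : ℂ} (hz : z ∈ Strip) : PE v w z = HR v w z := by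
  obtain ⟨C, hG⟩ := clsG_corr hz
  have hfre := fre_clsG iv hvm iw hwm hF hG
  obtain ⟨h0, h1⟩ := hz
  set δ := min z.im (1 - z.im) with hδd
  have hδ : 0 < δ := lt_min h0 (by linarith)
  have hm1 := min_le_left z.im (1 - z.im)
  have hm2 := min_le_right z.im (1 - z.im)
  have hδ1 : δ ≤ 1 := by linarith
  have im2 : |(-(starRingEnd ℂ) z).im| = z.im := by simp [abs_of_pos h0]
  have im3 : |(I - (starRingEnd ℂ) z).im| = 1 + z.im := by
    rw [sub_im, conj_im, I_im, sub_neg_eq_add]; exact abs_of_pos (by linarith)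
  have im1 : |(0 - z).im| = z.im := by simp [abs_of_pos h0]
  have im4 : |(I - z).im| = 1 - z.im := by simp only [sub_im, I_im]; exact abs_of_pos (by linarith)
  have hb1 : |(I / 2).im| = 1 / 2 := by simp
  have hb2 : |((3 / 2 : ℝ) * I).im| = 3 / 2 := by
    rw [im_ofReal_mul, I_im, mul_one]; exact abs_of_pos (by norm_num)
  have J1 := (SI_prod_int iv hvm hδ hδ1 (a := 0 - z) (b := I / 2) (by rw [im1]; linarith) (by rw [im1]; linarith)
    (by simp) hb1.ge (by rw [hb1]; norm_num)).2.2
  have J2 := (SI_prod_int iv hvm hδ hδ1 (a := -(starRingEnd ℂ) z) (b := I / 2) (by rw [im2]; linarith) (by rw [im2]; linarith)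
    (by simp) hb1.ge (by rw [hb1]; norm_num)).2.2
  have J3 := (SI_prod_int iw hwm hδ hδ1 (a := I - z) (b := (3 / 2 : ℝ) * I) (by rw [im4]; linarith) (by rw [im4]; linarith)
    (by simp) (by rw [hb2]; norm_num) hb2.le).2.2
  have J4 := (SI_prod_int iw hwm hδ hδ1 (a := I - (starRingEnd ℂ) z) (b := (3 / 2 : ℝ) * I) (by rw [im3]; linarith)
    (by rw [im3]; linarith) (by simp) (by rw [hb2]; norm_num) hb2.le).2.2
  set α := Complex.sinh (π * (z + I / 2) / 2) / (4 * I) with hα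
  set β := Complex.sinh (π * (-(I / 2) - (starRingEnd ℂ) z) / 2) / (4 * I) with hβ
  have K1 : ∀ t : ℝ, v t * (PK z.im (t - z.re) : ℂ) = α * (v t * (SI (t + (0 - z)) * SI (t + I / 2)))
      + β * (v t * (SI (t + -(starRingEnd ℂ) z) * SI (t + I / 2))) := by
    intro t
    have k := kernel_split (z := z) (ζ := t)
      (by have := (SI_bound hδ hδ1 (ζ := t - z) (by simp [abs_of_pos h0]; exact hm1) (by simp [abs_of_pos h0]; linarith)).1; exact this)
      (by have := (SI_bound hδ hδ1 (ζ := t - (starRingEnd ℂ) z) (by simp [abs_of_pos h0]; exact hm1) (by simp [abs_of_pos h0]; linarith)).1; exact this)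
      (by have := (SI_bound (δ := 1/2) (by norm_num) (by norm_num) (ζ := t + I / 2) (by simp) (by simp; norm_num)).1; exact this)
    rw [PK_eq_complex, ofReal_sub, k]
    have e1 : (t : ℂ) + (0 - z) = t - z := by ring
    have e2 : (t : ℂ) + -(starRingEnd ℂ) z = t - (starRingEnd ℂ) z := by ring
    rw [e1, e2]; ring
  have K2 : ∀ t : ℝ, w t * (PK (1 - z.im) (t - z.re) : ℂ) = -(α * (w t * (SI (t + (I - z)) * SI (t + (3 / 2 : ℝ) * I)))
      + β * (w t * (SI (t + (I - (starRingEnd ℂ) z)) * SI (t + (3 / 2 : ℝ) * I)))) := by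
    intro t
    have e1 : (t : ℂ) + (I - z) = (t + I) - z := by ring
    have e2 : (t : ℂ) + (I - (starRingEnd ℂ) z) = (t + I) - (starRingEnd ℂ) z := by ring
    have e3 : (t : ℂ) + (3 / 2 : ℝ) * I = (t + I) + I / 2 := by push_cast; ring
    have k := kernel_split (z := z) (ζ := t + I)
      (by rw [← e1]; exact (SI_bound hδ hδ1 (ζ := t + (I - z)) (by rw [add_im, ofReal_im, zero_add, im4]; exact hm2)
            (by rw [add_im, ofReal_im, zero_add, im4]; linarith)).1)
      (by rw [← e2]; exact (SI_bound hδ hδ1 (ζ := t + (I - (starRingEnd ℂ) z)) (by rw [add_im, ofReal_im, zero_add, im3]; linarith)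
            (by rw [add_im, ofReal_im, zero_add, im3]; linarith)).1)
      (by rw [← e3]; exact (SI_bound (δ := 1/2) (by norm_num) (by norm_num) (ζ := t + (3 / 2 : ℝ) * I)
            (by rw [add_im, ofReal_im, zero_add, hb2]; norm_num) (by rw [add_im, ofReal_im, zero_add, hb2]; norm_num)).1)
    have hPK : (PK (1 - z.im) (t - z.re) : ℂ) =
        -(Complex.sin (π * z.im) / (2 * (Complex.cosh (π * (t + I - z.re)) - Complex.cos (π * z.im)))) := by
      rw [PK_eq_complex]
      have a1 : (π * ((1 - z.im : ℝ) : ℂ)) = π - π * z.im := by push_cast; ring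
      have a2 : (π * (t + I - z.re) : ℂ) = π * ((t - z.re : ℝ) : ℂ) + π * I := by push_cast; ring
      rw [a1, a2, Complex.sin_pi_sub, Complex.cos_pi_sub, Complex.cosh_add, Complex.cosh_mul_I, Complex.sinh_mul_I,
        Complex.cos_pi, Complex.sin_pi]
      rw [← div_neg]
      congr 1; ring
    rw [hPK, k, e1, e2, e3]; ring
  unfold PE
  simp_rw [K1, K2]
  rw [integral_neg, integral_add (J1.const_mul _) (J2.const_mul _), integral_add (J3.const_mul _) (J4.const_mul _),
    integral_const_mul, integral_const_mul, integral_const_mul, integral_const_mul]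
  have f1 : ∫ t : ℝ, v t * (SI (t + -(starRingEnd ℂ) z) * SI (t + I / 2))
      = ∫ t : ℝ, w t * (SI (t + (I - (starRingEnd ℂ) z)) * SI (t + (3 / 2 : ℝ) * I)) := by
    have g1 : ∀ t : ℝ, (t : ℂ) + -(starRingEnd ℂ) z = t - (starRingEnd ℂ) z := fun t => by ring
    have g2 : ∀ t : ℝ, (t : ℂ) + (I - (starRingEnd ℂ) z) = (t + I) - (starRingEnd ℂ) z := fun t => by ring
    have g3 : ∀ t : ℝ, (t : ℂ) + (3 / 2 : ℝ) * I = (t + I) + I / 2 := fun t => by push_cast; ring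
    simp_rw [g1, g2, g3]
    exact hfre.symm
  rw [f1, HR]; ring

lemma PE_memHardy {p q : ℝ≥0∞} (hp : 1 ≤ p) (hq : 1 ≤ q) {v w : ℝ → ℂ} (hv : MemLp v p volume) (hw : MemLp w q volume)
    (hF : FourierRelExp v w) : MemHardy p q (PE v w) := by
  have iv := wt_integrable_of_memLp hp hv
  have iw := wt_integrable_of_memLp hq hw
  refine ⟨?_, (PE_hardyNorm hp hq hv hw).trans_lt (ENNReal.add_lt_top.2 ⟨hv.2, hw.2⟩)⟩
  have : DifferentiableOn ℂ (HR v w) Strip := fun z hz =>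
    (HR_diff iv hv.1 iw hw.1 hz).differentiableWithinAt
  exact this.congr fun z hz => PE_eq_HR iv hv.1 iw hw.1 hF hz

lemma hardyNorm_congr {p q : ℝ≥0∞} {h h' : ℂ → ℂ} (heq : ∀ z ∈ Strip, h z = h' z) :
    hardyNorm p q h = hardyNorm p q h' := by
  unfold hardyNorm
  refine iSup_congr fun y => iSup_congr fun hy => ?_
  have : bLine h y = bLine h' y := by
    ext x; exact heq _ (mem_Strip_line hy)
  rw [this]

/-- **Boundary values of `H^{p,q}(S)`** (Theorem 2.4): characterization of traces,
holomorphic extension, and equivalence of norms. -/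
theorem boundary_values (p q : ℝ≥0∞) (hp : 1 ≤ p) (hq : 1 ≤ q) :
    (∀ v w : ℝ → ℂ, MemLp v p volume → MemLp w q volume → FourierRelExp v w →
      ∃ h : ℂ → ℂ, MemHardy p q h ∧ IsTrace0 h v ∧ IsTrace1 h w ∧
        ∀ h' : ℂ → ℂ, MemHardy p q h' → IsTrace0 h' v → ∀ z ∈ Strip, h' z = h z) ∧
    (∃ c C : ℝ, 0 < c ∧ 0 < C ∧ ∀ h : ℂ → ℂ, MemHardy p q h →
      ∃ h0 h1 : ℝ → ℂ, MemLp h0 p volume ∧ MemLp h1 q volume ∧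
        IsTrace0 h h0 ∧ IsTrace1 h h1 ∧ FourierRelExp h0 h1 ∧
        c * (hardyNorm p q h).toReal ≤
            (eLpNorm h0 p volume).toReal + (eLpNorm h1 q volume).toReal ∧
        (eLpNorm h0 p volume).toReal + (eLpNorm h1 q volume).toReal ≤
            C * (hardyNorm p q h).toReal) := by
  refine ⟨fun v w hv hw hF => ⟨PE v w, PE_memHardy hp hq hv hw hF, (PE_traces hp hq hv hw).1,
    (PE_traces hp hq hv hw).2, fun h' hh' t' => unique_of_trace0 hp hq hv
      (PE_memHardy hp hq hv hw hF) hh' (PE_traces hp hq hv hw).1 t'⟩, 1, 2, one_pos, two_pos, ?_⟩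
  intro h hh
  obtain ⟨h0, h1, H⟩ := MemHardy.traces hp hq hh
  refine ⟨h0, h1, H.m0, H.m1, H.isTrace0, H.isTrace1, H.fre, ?_, ?_⟩
  · have e : hardyNorm p q h = hardyNorm p q (PE h0 h1) :=
      hardyNorm_congr (unique_of_trace0 hp hq H.m0 (PE_memHardy hp hq H.m0 H.m1 H.fre) hh
        (PE_traces hp hq H.m0 H.m1).1 H.isTrace0)
    rw [one_mul, e, ← ENNReal.toReal_add H.m0.2.ne H.m1.2.ne]
    exact ENNReal.toReal_mono (ENNReal.add_ne_top.2 ⟨H.m0.2.ne, H.m1.2.ne⟩)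
      (PE_hardyNorm hp hq H.m0 H.m1)
  · have a := ENNReal.toReal_mono hh.2.ne H.n0
    have b := ENNReal.toReal_mono hh.2.ne H.n1
    linarith
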